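/- Let n ∈ ℕ and let W be a finite or countable subset of R_n satisfying inf{τ(r) : r ∈ W} > 0 (in particular, any finite subset of R_n). Then dim ⋂_{r ∈ W} Bad(r) = n. -/

import Mathlib

open MeasureTheory ENNReal

/-- Distance from a real number to the nearest integer. -/
noncomputable def distNearestInt (x : ℝ) : ℝ := ⨅ p : ℤ, |x - (p : ℝ)|

/-- `badPow ρ x = x ^ (1/ρ)`, with the convention `x ^ (1/0) = 0`. -/
noncomputable def badPow (ρ x : ℝ) : ℝ := if ρ = 0 then 0 else x ^ (1 / ρ)

/-- The set `R_n` of weight vectors: nonnegative components summing to `1`. -/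
def Weights (n : ℕ) : Set (Fin n → ℝ) := {r | (∑ i, r i) = 1 ∧ ∀ i, 0 ≤ r i}

/-- `τ(r)`: the smallest strictly positive component of `r`. -/
noncomputable def tauW {n : ℕ} (r : Fin n → ℝ) : ℝ := sInf {t | 0 < t ∧ ∃ i, r i = t}

/-- The set `Bad(r)` of `r`-badly approximable points of `ℝⁿ`. -/
def BadSet {n : ℕ} (r : Fin n → ℝ) : Set (EuclideanSpace ℝ (Fin n)) :=
  {y | ∃ c > 0, ∀ q : ℕ, 1 ≤ q →
    ∃ i, c * (q : ℝ)⁻¹ ≤ badPow (r i) (distNearestInt (q * y i))}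

/-- minors of a tuple of vectors -/
noncomputable def mn {ι : Type} {d : ℕ} (c : Fin d → ι → ℝ) (I : Fin d → ι) : ℝ :=
  (Matrix.of fun i j => c j (I i)).det

section Minors
set_option linter.unusedSectionVars false
variable {ι : Type} [Fintype ι] [DecidableEq ι]

lemma mn_not_inj {d : ℕ} (c : Fin d → ι → ℝ) (I : Fin d → ι) (h : ¬ Function.Injective I) :
    mn c I = 0 := by
  simp only [Function.Injective, not_forall] at h
  obtain ⟨a, b, hab, hne⟩ := h
  unfold mn
  apply Matrix.det_zero_of_row_eq hne
  ext j
  simp [hab]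

lemma mn_update {d : ℕ} (c : Fin d → ι → ℝ) (I : Fin d → ι) (p : Fin d) (i : ι) :
    mn c (Function.update I p i) =
      ((Matrix.of fun i j => c j (I i)).updateRow p (fun j => c j i)).det := by
  unfold mn
  congr 1
  ext a b
  by_cases h : a = p
  · subst h; simp
  · simp [h, Matrix.updateRow_ne]

lemma mn_plucker {d : ℕ} (c : Fin d → ι → ℝ) (I J : Fin d → ι) (p : Fin d) :
    mn c I * mn c J =
      ∑ k, mn c (Function.update I k (J p)) * mn c (Function.update J p (I k)) := by
  have key : (Matrix.of fun i j => c j (I i)).det • (fun j => c j (J p)) =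
      ∑ k, mn c (Function.update I k (J p)) • (fun j => c j (I k)) := by
    have h := Matrix.mulVec_cramer (Matrix.of fun i j => c j (I i)).transpose (fun j => c j (J p))
    rw [Matrix.det_transpose] at h
    rw [← h]
    ext j
    simp only [Matrix.mulVec, dotProduct, Matrix.transpose_apply, Matrix.of_apply, Finset.sum_apply,
      Pi.smul_apply, smul_eq_mul]
    apply Finset.sum_congr rfl
    intro k _
    rw [mn_update, Matrix.cramer_transpose_apply, mul_comm]
  have h1 : mn c J = ((Matrix.of fun i j => c j (J i)).updateRow p (fun j => c j (J p))).det := by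
    rw [← mn_update, Function.update_eq_self]
  rw [h1]
  change (Matrix.of fun i j => c j (I i)).det * _ = _
  rw [← Matrix.det_updateRow_smul, key]
  simp_rw [mn_update c J]
  have := (Matrix.detRowAlternating (R := ℝ) (n := Fin d)).toMultilinearMap.toLinearMap
      (Matrix.of fun i j => c j (J i)) p
  have h2 : ∀ v : Fin d → ℝ, ((Matrix.of fun i j => c j (J i)).updateRow p v).det =
     (Matrix.detRowAlternating (R := ℝ) (n := Fin d)).toMultilinearMap.toLinearMap
      (Matrix.of fun i j => c j (J i)) p v := by
    intro v
    rfl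
  simp_rw [h2, map_sum, map_smul, smul_eq_mul]

lemma mn_snoc {d : ℕ} (c : Fin d → ι → ℝ) (b : ι → ℝ) :
    ‖mn (Fin.cons b c : Fin (d+1) → ι → ℝ)‖ ≤ (d+1) * (‖mn c‖ * ‖b‖) := by
  rw [pi_norm_le_iff_of_nonneg (by positivity)]
  intro I
  rw [mn, Matrix.det_succ_column_zero]
  refine (norm_sum_le _ _).trans ?_
  have : ∀ i ∈ (Finset.univ : Finset (Fin (d+1))), ‖(-1:ℝ) ^ (i : ℕ) * (Matrix.of fun i j => (Fin.cons b c : Fin (d+1) → ι → ℝ) j (I i)) i 0 *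
      ((Matrix.of fun i j => (Fin.cons b c : Fin (d+1) → ι → ℝ) j (I i)).submatrix i.succAbove Fin.succ).det‖ ≤ ‖mn c‖ * ‖b‖ := by
    intro i _
    have e : ((Matrix.of fun i j => (Fin.cons b c : Fin (d+1) → ι → ℝ) j (I i)).submatrix i.succAbove Fin.succ).det = mn c (fun k => I (i.succAbove k)) := by
      unfold mn
      congr 1
    rw [e]
    simp only [Matrix.of_apply, Fin.cons_zero, norm_mul, norm_pow, norm_neg, norm_one, one_pow, one_mul]
    rw [mul_comm]
    exact mul_le_mul (norm_le_pi_norm (mn c) _) (norm_le_pi_norm b _) (norm_nonneg _) (norm_nonneg _)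
  refine (Finset.sum_le_card_nsmul _ _ _ this).trans ?_
  simp

lemma mn_span {d : ℕ} (A A' : Fin d → ι → ℝ)
    (h : ∀ j, A' j ∈ Submodule.span ℝ (Set.range A)) :
    ∃ s : ℝ, ∀ L : (ι → ℝ) →ₗ[ℝ] (ι → ℝ), mn (fun j => L (A' j)) = s • mn (fun j => L (A j)) := by
  have h' : ∀ j, ∃ c : Fin d → ℝ, ∑ k, c k • A k = A' j := by
    intro j
    exact (Submodule.mem_span_range_iff_exists_fun ℝ).1 (h j)
  choose C hC using h'
  refine ⟨(Matrix.of fun k j => C j k).det, ?_⟩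
  intro L
  ext I
  simp only [Pi.smul_apply, smul_eq_mul]
  unfold mn
  rw [mul_comm, ← Matrix.det_mul]
  congr 1
  ext i j
  simp only [Matrix.of_apply, Matrix.mul_apply]
  rw [← hC j, map_sum]
  simp [mul_comm]

/-- the minors of an independent tuple do not all vanish -/
lemma mn_ne_zero {d : ℕ} (c : Fin d → ι → ℝ) (h : LinearIndependent ℝ c) : mn c ≠ 0 := by
  intro h0
  let M : Matrix ι (Fin d) ℝ := Matrix.of fun i j => c j i
  have hr : M.rank = d := by
    have : LinearIndependent ℝ M.col := h
    rw [← Matrix.rank_transpose]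
    have h3 : LinearIndependent ℝ M.transpose.row := h
    rw [h3.rank_matrix]; simp
  rw [Matrix.rank_eq_finrank_span_row] at hr
  obtain ⟨f, hf1, hf2, hf3⟩ := Submodule.exists_fun_fin_finrank_span_eq ℝ (Set.range M.row)
  have hc : ∀ i, ∃ k, M.row k = f i := fun i => hf1 i
  choose I hI using hc
  have hli : LinearIndependent ℝ (fun i => M.row (I (Fin.cast hr.symm i))) := by
    simp_rw [hI]
    exact hf3.comp _ (Fin.cast_injective _)
  have h1 := congrFun h0 (fun i => I (Fin.cast hr.symm i))
  have h2 : IsUnit (Matrix.of fun i j => c j (I (Fin.cast hr.symm i))) := by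
    rw [← Matrix.linearIndependent_rows_iff_isUnit]
    exact hli
  rw [Matrix.isUnit_iff_isUnit_det] at h2
  exact h2.ne_zero h1

end Minors

section Mink
set_option linter.unusedSectionVars false
variable {ι : Type} [Fintype ι] [DecidableEq ι]

lemma mn_cramer {d : ℕ} (c : Fin d → ι → ℝ) (I : Fin d → ι) (i : ι) (j : Fin d) :
    mn c I * c j i = ∑ k, mn c (Function.update I k i) * c j (I k) := by
  have h := Matrix.mulVec_cramer (Matrix.of fun i j => c j (I i)).transpose (fun j => c j i)
  rw [Matrix.det_transpose] at h
  have h := congrFun h j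
  simp only [Matrix.mulVec, dotProduct, Matrix.transpose_apply, Matrix.of_apply,
      Pi.smul_apply, smul_eq_mul] at h
  unfold mn at *
  rw [← h]
  apply Finset.sum_congr rfl
  intro k _
  have := mn_update c I k i
  unfold mn at this
  rw [this, Matrix.cramer_transpose_apply, mul_comm]

lemma minkowski_sq {d : ℕ} (hd : 0 < d) (M : Matrix (Fin d) (Fin d) ℝ) (h0 : M.det ≠ 0)
    (h1 : |M.det| ≤ 1) : ∃ k : Fin d → ℤ, k ≠ 0 ∧ ∀ i, |∑ j, M i j * (k j : ℝ)| ≤ 2 := by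
  classical
  let b := Pi.basisFun ℝ (Fin d)
  let f : (Fin d → ℝ) →ₗ[ℝ] (Fin d → ℝ) := Matrix.toLin' M
  have hdet : LinearMap.det f = M.det := LinearMap.det_toLin' M
  let s : Set (Fin d → ℝ) := f ⁻¹' (Metric.closedBall 0 2)
  have fund := ZSpan.isAddFundamentalDomain b (volume : Measure (Fin d → ℝ))
  have hF : volume (ZSpan.fundamentalDomain b) = 1 := by
    have : ZSpan.fundamentalDomain b = Set.pi Set.univ fun _ => Set.Ico (0:ℝ) 1 :=
      ZSpan.fundamentalDomain_pi_basisFun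
    rw [this, volume_pi_pi]; simp
  have hs : volume s = ENNReal.ofReal (|M.det|⁻¹) * ENNReal.ofReal ((2*2)^d) := by
    rw [Measure.addHaar_preimage_linearMap _ (by rw [hdet]; exact h0), hdet, abs_inv,
      Real.volume_pi_closedBall _ (by norm_num)]
    simp
  have : Countable (Submodule.span ℤ (Set.range b)).toAddSubgroup := by
    change Countable (Submodule.span ℤ (Set.range b))
    infer_instance
  have := exists_ne_zero_mem_lattice_of_measure_mul_two_pow_lt_measure
    (L := (Submodule.span ℤ (Set.range b)).toAddSubgroup) (s := s) fund ?_ ?_ ?_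
  · obtain ⟨⟨x, hx⟩, hx0, hxs⟩ := this
    have hx' : x ∈ Submodule.span ℤ (Set.range b) := hx
    rw [Module.Basis.mem_span_iff_repr_mem] at hx'
    choose k hk using hx'
    refine ⟨k, ?_, ?_⟩
    · rintro rfl
      apply hx0
      ext i
      have := hk i
      simp [b] at this
      simp [← this]
    · intro i
      have h3 : ‖f x‖ ≤ 2 := by simpa [s] using hxs
      have h4 := (norm_le_pi_norm (f x) i).trans h3
      have h5 : f x i = ∑ j, M i j * (k j : ℝ) := by
        simp only [f, Matrix.toLin'_apply, Matrix.mulVec, dotProduct]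
        apply Finset.sum_congr rfl
        intro j _
        have := hk j
        simp [b] at this
        rw [this]
      rw [h5] at h4
      exact h4
  · intro x hx
    simpa [s] using hx
  · exact (convex_closedBall 0 2).linear_preimage f
  · rw [hF, hs, one_mul, ← ENNReal.ofReal_mul (by positivity)]
    have : (2:ℝ≥0∞) ^ Module.finrank ℝ (Fin d → ℝ) = ENNReal.ofReal (2^d) := by
      rw [ENNReal.ofReal_pow (by norm_num)]; simp
    rw [this, ENNReal.ofReal_lt_ofReal_iff (by positivity)]
    have h2 : 1 ≤ |M.det|⁻¹ := by
      rw [one_le_inv₀ (by positivity)]; exact h1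
    have h3 : (2:ℝ)^d < (2*2)^d := by
      apply pow_lt_pow_left₀ (by norm_num) (by norm_num) (by omega)
    exact h3.trans_le (le_mul_of_one_le_left (by positivity) h2)

lemma minkowski_tuple {d : ℕ} (hd : 0 < d) (c : Fin d → ι → ℝ) (hne : mn c ≠ 0)
    (h1 : ∀ I, |mn c I| ≤ 1) : ∃ k : Fin d → ℤ, k ≠ 0 ∧ ∀ i, |∑ j, (k j : ℝ) * c j i| ≤ 2 * d := by
  have : ∃ I0, mn c I0 ≠ 0 := by
    by_contra hcon
    push Not at hcon
    exact hne (funext hcon)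
  obtain ⟨I0, hI0⟩ := this
  obtain ⟨I, _, hI⟩ := Finset.exists_max_image (Finset.univ : Finset (Fin d → ι)) (fun I => |mn c I|) ⟨I0, Finset.mem_univ _⟩
  have hIne : mn c I ≠ 0 := by
    intro h
    have := hI I0 (Finset.mem_univ _)
    rw [h, abs_zero] at this
    exact hI0 (abs_nonpos_iff.1 this)
  obtain ⟨k, hk0, hk⟩ := minkowski_sq hd (Matrix.of fun i j => c j (I i)) hIne (h1 I)
  refine ⟨k, hk0, ?_⟩
  intro i
  have e : mn c I * ∑ j, (k j : ℝ) * c j i =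
      ∑ p, mn c (Function.update I p i) * ∑ j, c j (I p) * (k j : ℝ) := by
    rw [Finset.mul_sum]
    have : ∀ j, mn c I * ((k j : ℝ) * c j i) = ∑ p, mn c (Function.update I p i) * (c j (I p) * (k j:ℝ)) := by
      intro j
      have := mn_cramer c I i j
      calc _ = (k j : ℝ) * (mn c I * c j i) := by ring
        _ = _ := by
          rw [this, Finset.mul_sum]
          apply Finset.sum_congr rfl
          intros; ring
    simp_rw [this]
    rw [Finset.sum_comm]
    simp_rw [Finset.mul_sum]
  have h2 : |mn c I| * |∑ j, (k j : ℝ) * c j i| ≤ |mn c I| * (2 * d) := by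
    rw [← abs_mul, e]
    refine (Finset.abs_sum_le_sum_abs _ _).trans ?_
    have : ∀ p ∈ (Finset.univ : Finset (Fin d)), |mn c (Function.update I p i) * ∑ j, c j (I p) * (k j : ℝ)| ≤ |mn c I| * 2 := by
      intro p _
      rw [abs_mul]
      exact mul_le_mul (hI _ (Finset.mem_univ _)) (hk p) (abs_nonneg _) (abs_nonneg _)
    refine (Finset.sum_le_card_nsmul _ _ _ this).trans ?_
    simp
    apply le_of_eq; ring
  exact le_of_mul_le_mul_left h2 (abs_pos.2 hIne)

/-- coordinate maps affine in the coordinate `i0` -/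
lemma mn_affine {d : ℕ} (i0 : ι) (f : ℝ → (ι → ℝ) → ι → ℝ) (p q : (ι → ℝ) → ℝ)
    (R : (ι → ℝ) → ι → ℝ)
    (hf : ∀ x b i, f x b i = if i = i0 then p b + x * q b else R b i)
    (A : Fin d → ι → ℝ) :
    ∃ u v : (Fin d → ι) → ℝ, ∀ x, mn (fun j => f x (A j)) = u + x • v := by
  suffices h : ∀ I, ∃ u v : ℝ, ∀ x, mn (fun j => f x (A j)) I = u + x * v by
    choose u v huv using h
    exact ⟨u, v, fun x => funext fun I => by simp [huv]⟩
  intro I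
  by_cases hinj : Function.Injective I
  · by_cases hp : ∃ k, I k = i0
    · obtain ⟨k, hk⟩ := hp
      let M : Matrix (Fin d) (Fin d) ℝ := Matrix.of fun i j => R (A j) (I i)
      refine ⟨(M.updateRow k (fun j => p (A j))).det, (M.updateRow k (fun j => q (A j))).det, ?_⟩
      intro x
      rw [← Matrix.det_updateRow_smul, ← Matrix.det_updateRow_add]
      unfold mn
      congr 1
      ext i j
      by_cases hik : i = k
      · subst hik
        simp [hf, hk]
      · have : I i ≠ i0 := fun h => hik (hinj (h.trans hk.symm))
        simp [hf, this, hik, Matrix.updateRow_ne, M]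
    · push Not at hp
      refine ⟨(Matrix.of fun i j => R (A j) (I i)).det, 0, ?_⟩
      intro x
      unfold mn
      simp [hf, hp]
  · exact ⟨0, 0, fun x => by rw [mn_not_inj _ _ hinj]; simp⟩

end Mink

lemma affine_small_volume {κ : Type} [Fintype κ] (u v : κ → ℝ) (a h η ε : ℝ) (hh : 0 < h) (hη : 0 < η)
    (hε : 0 ≤ ε) (hbig : η ≤ ‖u + a • v‖ ∨ η ≤ ‖u + (a + h) • v‖) :
    volume {x | x ∈ Set.Icc a (a+h) ∧ ‖u + x • v‖ < ε} ≤ ENNReal.ofReal (4 * ε / η * h) := by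
  by_cases hεη : η / 2 < ε
  · calc _ ≤ volume (Set.Icc a (a+h)) := measure_mono fun x hx => hx.1
      _ = ENNReal.ofReal h := by simp
      _ ≤ _ := by
        apply ENNReal.ofReal_le_ofReal
        have : 1 ≤ 4 * ε / η := by rw [le_div_iff₀ hη]; linarith
        nlinarith
  push Not at hεη
  have main : ∃ i : κ, ∀ x ∈ {x | x ∈ Set.Icc a (a+h) ∧ ‖u + x • v‖ < ε}, η / 2 ≤ h * |v i| := by
    have aux : ∀ e ∈ Set.Icc a (a+h), η ≤ ‖u + e • v‖ →
        ∃ i : κ, ∀ x ∈ {x | x ∈ Set.Icc a (a+h) ∧ ‖u + x • v‖ < ε}, η / 2 ≤ h * |v i| := by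
      intro e he hb
      have : ∃ i, η ≤ ‖(u + e • v) i‖ := by
        by_contra hc
        push Not at hc
        exact absurd ((pi_norm_lt_iff hη).2 hc) (not_lt.2 hb)
      obtain ⟨i, hi⟩ := this
      refine ⟨i, ?_⟩
      rintro x ⟨hx, hx2⟩
      have h3 := (norm_le_pi_norm (u + x • v) i).trans_lt hx2
      simp only [Pi.add_apply, Pi.smul_apply, smul_eq_mul, Real.norm_eq_abs] at h3 hi
      have h4 : |(e - x) * v i| ≥ η / 2 := by
        have : u i + e * v i = (u i + x * v i) + (e - x) * v i := by ring
        rw [this] at hi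
        have := abs_add_le (u i + x * v i) ((e - x) * v i)
        linarith
      rw [abs_mul] at h4
      have h5 : |e - x| ≤ h := by
        rw [abs_le]; constructor <;> linarith [he.1, he.2, hx.1, hx.2]
      nlinarith [abs_nonneg (v i)]
    rcases hbig with hb | hb
    · exact aux a ⟨le_refl _, by linarith⟩ hb
    · exact aux (a+h) ⟨by linarith, le_refl _⟩ hb
  obtain ⟨i, hi⟩ := main
  refine (Real.volume_le_diam _).trans ?_
  refine Metric.ediam_le ?_
  intro x hx y hy
  rw [edist_dist]
  apply ENNReal.ofReal_le_ofReal
  have hv := hi x hx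
  have hx3 := (norm_le_pi_norm (u + x • v) i).trans_lt hx.2
  have hy3 := (norm_le_pi_norm (u + y • v) i).trans_lt hy.2
  simp only [Pi.add_apply, Pi.smul_apply, smul_eq_mul, Real.norm_eq_abs] at hx3 hy3
  rw [Real.dist_eq]
  have h4 : |x - y| * |v i| ≤ 2 * ε := by
    rw [← abs_mul]
    have : (x - y) * v i = (u i + x * v i) - (u i + y * v i) := by ring
    rw [this]
    exact (abs_sub _ _).trans (by linarith)
  rw [div_mul_eq_mul_div, le_div_iff₀ hη]
  nlinarith [abs_nonneg (x - y), abs_nonneg (v i)]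

section Dyadic

/-- index of the dyadic cell of `[a,a+h)` at level `l` containing `x` -/
noncomputable def dyIdx (a h : ℝ) (l : ℕ) (x : ℝ) : ℕ := ⌊(x - a) / h * 2 ^ l⌋₊

def dyCell (a h : ℝ) (l j : ℕ) : Set ℝ := Set.Ico (a + j * (h / 2 ^ l)) (a + j * (h / 2 ^ l) + h / 2 ^ l)

lemma mem_dyCell_iff (a h : ℝ) (hh : 0 < h) (l j : ℕ) (x : ℝ) (hx : a ≤ x) :
    x ∈ dyCell a h l j ↔ dyIdx a h l x = j := by
  unfold dyIdx dyCell
  have h0 : 0 ≤ (x - a) / h * 2 ^ l := by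
    have : 0 ≤ x - a := by linarith
    positivity
  rw [Nat.floor_eq_iff h0, Set.mem_Ico]
  have e : (x - a) / h * 2 ^ l = (x - a) / (h / 2^l) := by field_simp
  have hp : 0 < h / 2 ^ l := by positivity
  rw [e, le_div_iff₀ hp, div_lt_iff₀ hp]
  constructor <;> rintro ⟨h1, h2⟩ <;> constructor <;> linarith

lemma dyIdx_div (a h : ℝ) (l k : ℕ) (x : ℝ) :
    dyIdx a h (l + k) x / 2 ^ k = dyIdx a h l x := by
  unfold dyIdx
  have := Nat.floor_div_natCast ((x - a) / h * 2 ^ (l+k)) (2^k)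
  rw [← this]
  congr 1
  push_cast
  field_simp
  ring

lemma dyadic_cover (a h : ℝ) (hh : 0 < h) (P : ℕ → ℕ → Prop) (E : Set ℝ)
    (hE : E ⊆ Set.Ico a (a + h)) (hP0 : ¬ P 0 0) (hex : ∀ x ∈ E, ∃ l, P l (dyIdx a h l x))
    (C : ℝ≥0∞)
    (hC : ∀ l j, ¬ P l (j / 2) → P (l+1) j → j < 2 ^ (l+1) →
      volume (E ∩ dyCell a h (l+1) j) ≤ C * ENNReal.ofReal (h / 2 ^ (l+1))) :
    volume E ≤ C * ENNReal.ofReal h := by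
  classical
  let 𝒥 : Set (ℕ × ℕ) := {q | ∃ x ∈ Set.Ico a (a+h), q.2 = dyIdx a h q.1 x ∧ P q.1 q.2 ∧
    ∀ l' < q.1, ¬ P l' (dyIdx a h l' x)}
  have hcellsub : ∀ q ∈ 𝒥, dyCell a h q.1 q.2 ⊆ Set.Ico a (a+h) := by
    rintro ⟨l, j⟩ ⟨x, hx, hj, -⟩ y hy
    simp only at hj hy
    have hy0 : a ≤ y := by
      refine le_trans ?_ hy.1
      have : 0 ≤ (j:ℝ) * (h / 2^l) := by positivity
      linarith
    refine ⟨hy0, ?_⟩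
    have hj2 : j + 1 ≤ 2 ^ l := by
      rw [hj]
      have : dyIdx a h l x < 2 ^ l := by
        unfold dyIdx
        have h0 : 0 ≤ (x - a) / h * 2 ^ l := by
          have : 0 ≤ x - a := by linarith [hx.1]
          positivity
        rw [Nat.floor_lt h0]
        push_cast
        have : (x - a) / h < 1 := by rw [div_lt_one hh]; linarith [hx.2]
        have h2 : (0:ℝ) < 2 ^ l := by positivity
        nlinarith
      omega
    refine lt_of_lt_of_le hy.2 ?_
    have hj3 : ((j:ℝ) + 1) ≤ 2 ^ l := by exact_mod_cast hj2
    have hp : 0 < h / 2 ^ l := by positivity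
    have : ((j:ℝ) + 1) * (h / 2 ^ l) ≤ 2 ^ l * (h / 2 ^ l) := by gcongr
    have e : 2 ^ l * (h / 2 ^ l) = h := by field_simp
    nlinarith
  have hdisj : 𝒥.PairwiseDisjoint (fun q => dyCell a h q.1 q.2) := by
    have key : ∀ q ∈ 𝒥, ∀ q' ∈ 𝒥, q.1 ≤ q'.1 → ∀ y, y ∈ dyCell a h q.1 q.2 → y ∈ dyCell a h q'.1 q'.2 → q = q' := by
      intro q hq q' hq' hle y hy hy'
      have hya := (hcellsub q hq hy).1
      rw [mem_dyCell_iff a h hh _ _ _ hya] at hy hy'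
      obtain ⟨x, hx, hj, hP, hmin⟩ := hq
      obtain ⟨x', hx', hj', hP', hmin'⟩ := hq'
      rcases hle.lt_or_eq with hlt | heq
      · exfalso
        apply hmin' q.1 hlt
        have h1 := dyIdx_div a h q.1 (q'.1 - q.1) x'
        have h2 := dyIdx_div a h q.1 (q'.1 - q.1) y
        rw [Nat.add_sub_cancel' hle] at h1 h2
        rw [← h1, ← hj', ← hy', h2, hy]
        exact hP
      · apply Prod.ext heq
        rw [← hy, ← hy', heq]
    intro q hq q' hq' hne
    rw [Function.onFun, Set.disjoint_left]
    intro y hy hy'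
    rcases le_total q.1 q'.1 with hle | hle
    · exact hne (key q hq q' hq' hle y hy hy')
    · exact hne (key q' hq' q hq hle y hy' hy).symm
  have hcov : E ⊆ ⋃ q ∈ 𝒥, E ∩ dyCell a h q.1 q.2 := by
    intro x hx
    have hex' := hex x hx
    let l := Nat.find hex'
    have hl : P l (dyIdx a h l x) := Nat.find_spec hex'
    have hmin : ∀ l' < l, ¬ P l' (dyIdx a h l' x) := fun l' hl' => Nat.find_min hex' hl'
    simp only [Set.mem_iUnion]
    refine ⟨(l, dyIdx a h l x), ⟨x, hE hx, rfl, hl, hmin⟩, hx, ?_⟩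
    rw [mem_dyCell_iff a h hh _ _ _ (hE hx).1]
  have hmeas : ∀ q ∈ 𝒥, MeasurableSet (dyCell a h q.1 q.2) := fun q _ => measurableSet_Ico
  have hvol : ∀ l j, volume (dyCell a h l j) = ENNReal.ofReal (h / 2 ^ l) := by
    intro l j
    unfold dyCell
    rw [Real.volume_Ico]
    congr 1; ring
  have hcnt : 𝒥.Countable := Set.to_countable _
  calc volume E ≤ volume (⋃ q ∈ 𝒥, E ∩ dyCell a h q.1 q.2) := measure_mono hcov
    _ ≤ ∑' q : 𝒥, volume (E ∩ dyCell a h q.1.1 q.1.2) := measure_biUnion_le _ hcnt _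
    _ ≤ ∑' q : 𝒥, C * volume (dyCell a h q.1.1 q.1.2) := by
        apply ENNReal.tsum_le_tsum
        rintro ⟨⟨l, j⟩, hq⟩
        rw [hvol]
        have hq' := hq
        obtain ⟨x, hx, hj, hP, hmin⟩ := hq
        simp only at hj hP hmin ⊢
        rcases l with _ | l
        · exfalso
          apply hP0
          have : j = 0 := by
            rw [hj]
            unfold dyIdx
            rw [Nat.floor_eq_zero]
            simp
            rw [div_lt_one hh]; linarith [hx.2]
          rwa [this] at hP
        · apply hC l j
          · have := hmin l (Nat.lt_succ_self l)
            have h1 := dyIdx_div a h l 1 x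
            rw [pow_one, ← hj] at h1
            rwa [h1]
          · exact hP
          · rw [hj]
            unfold dyIdx
            have h0 : 0 ≤ (x - a) / h * 2 ^ (l+1) := by
              have : 0 ≤ x - a := by linarith [hx.1]
              positivity
            rw [Nat.floor_lt h0]
            push_cast
            have : (x - a) / h < 1 := by rw [div_lt_one hh]; linarith [hx.2]
            have h2 : (0:ℝ) < 2 ^ (l+1) := by positivity
            nlinarith
    _ = C * ∑' q : 𝒥, volume (dyCell a h q.1.1 q.1.2) := ENNReal.tsum_mul_left
    _ = C * volume (⋃ q ∈ 𝒥, dyCell a h q.1 q.2) := by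
        rw [measure_biUnion hcnt hdisj hmeas]
    _ ≤ C * volume (Set.Ico a (a+h)) := by
        gcongr
        exact Set.iUnion₂_subset hcellsub
    _ = C * ENNReal.ofReal h := by rw [Real.volume_Ico]; congr 2; ring
end Dyadic

section QND
set_option linter.unusedSectionVars false
variable {ι : Type} [Fintype ι] [DecidableEq ι]

/-- size of the wedge of the tuple `A` under `L` -/
noncomputable def psiN {d : ℕ} (L : (ι → ℝ) →ₗ[ℝ] (ι → ℝ)) (A : Fin d → ι → ℝ) : ℝ :=
  ‖mn (fun j => L (A j))‖

def TupN {d : ℕ} (Λ : Set (ι → ℝ)) (A : Fin d → ι → ℝ) : Prop :=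
  (∀ j, A j ∈ Λ) ∧ LinearIndependent ℝ A

def CmpN (F : Finset ℕ) (A : ∀ d : ℕ, Fin d → ι → ℝ) (d' : ℕ) (A' : Fin d' → ι → ℝ) : Prop :=
  ∀ d ∈ F, (d ≤ d' → Submodule.span ℝ (Set.range (A d)) ≤ Submodule.span ℝ (Set.range A')) ∧
    (d' ≤ d → Submodule.span ℝ (Set.range A') ≤ Submodule.span ℝ (Set.range (A d)))

lemma TupN_le {d : ℕ} {Λ : Set (ι → ℝ)} {A : Fin d → ι → ℝ} (h : TupN Λ A) : d ≤ Fintype.card ι := by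
  have := h.2.fintype_card_le_finrank
  simpa using this

lemma psiN_cons {d : ℕ} (L : (ι → ℝ) →ₗ[ℝ] (ι → ℝ)) (A : Fin d → ι → ℝ) (b : ι → ℝ) :
    psiN L (Fin.cons b A : Fin (d+1) → ι → ℝ) ≤ (d+1) * (psiN L A * ‖L b‖) := by
  have := mn_snoc (fun j => L (A j)) (L b)
  unfold psiN
  convert this using 4
  rename_i j
  refine Fin.cases ?_ (fun i => ?_) j <;> simp

lemma flag_pointwise (L : (ι → ℝ) →ₗ[ℝ] (ι → ℝ)) (Λ : Set (ι → ℝ)) (F : Finset ℕ) (h0 : 0 ∈ F)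
    (A : ∀ d : ℕ, Fin d → ι → ℝ) (δ ε η : ℝ) (hδ : 0 < δ)
    (hε : 3 * (Fintype.card ι) * δ ≤ ε) (hη : (Fintype.card ι) * δ ≤ η)
    (hT : ∀ d ∈ F, TupN Λ (A d)) (hC : ∀ d ∈ F, CmpN F A d (A d))
    (hup : ∀ d ∈ F, psiN L (A d) ≤ 1) (hlow : ∀ d ∈ F, ε ≤ psiN L (A d))
    (hsame : ∀ d ∈ F, ∀ A' : Fin d → ι → ℝ, TupN Λ A' → CmpN F A d A' → psiN L (A d) ≤ 3 * psiN L A')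
    (hbig : ∀ d, d ∉ F → ∀ A' : Fin d → ι → ℝ, TupN Λ A' → CmpN F A d A' → η ≤ psiN L A')
    (b : ι → ℝ) (hb : b ∈ Λ) (hb0 : b ≠ 0) (hbs : ‖L b‖ < δ) : False := by
  classical
  set S := F.filter (fun d => b ∉ Submodule.span ℝ (Set.range (A d))) with hS
  have hSne : S.Nonempty := by
    refine ⟨0, ?_⟩
    rw [hS, Finset.mem_filter]
    refine ⟨h0, ?_⟩
    have : Set.range (A 0) = ∅ := Set.range_eq_empty _
    rw [this, Submodule.span_empty]
    simpa using hb0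
  obtain ⟨d, hdS, hmax⟩ : ∃ d ∈ S, ∀ d' ∈ S, d' ≤ d := ⟨S.max' hSne, S.max'_mem hSne, fun d' hd' => S.le_max' d' hd'⟩
  rw [hS, Finset.mem_filter] at hdS
  obtain ⟨hdF, hbd⟩ := hdS
  have hin : ∀ d' ∈ F, d < d' → b ∈ Submodule.span ℝ (Set.range (A d')) := by
    intro d' hd' hlt
    by_contra hcon
    have := hmax d' (by rw [hS, Finset.mem_filter]; exact ⟨hd', hcon⟩)
    omega
  set Δ : Fin (d+1) → ι → ℝ := Fin.cons b (A d) with hΔ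
  have hΔT : TupN Λ Δ := by
    refine ⟨fun j => ?_, linearIndependent_finCons.2 ⟨(hT d hdF).2, hbd⟩⟩
    refine Fin.cases ?_ (fun i => ?_) j
    · simpa [hΔ] using hb
    · simpa [hΔ] using (hT d hdF).1 i
  have hrange : Set.range Δ = insert b (Set.range (A d)) := Fin.range_cons _ _
  have hAd : Submodule.span ℝ (Set.range (A d)) ≤ Submodule.span ℝ (Set.range Δ) := by
    rw [hrange]; exact Submodule.span_mono (Set.subset_insert _ _)
  have hle : ∀ d' ∈ F, d < d' → Submodule.span ℝ (Set.range Δ) ≤ Submodule.span ℝ (Set.range (A d')) := by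
    intro d' hd' hlt
    rw [hrange, Submodule.span_le]
    rintro x (rfl | hx)
    · exact hin d' hd' hlt
    · exact ((hC d hdF) d' hd').2 hlt.le (Submodule.subset_span hx)
  have hΔC : CmpN F A (d+1) Δ := by
    intro d' hd'
    refine ⟨fun h => ?_, fun h => hle d' hd' (by omega)⟩
    rcases Nat.lt_or_ge d d' with h1 | h1
    · have : d' = d + 1 := by omega
      subst this
      refine le_of_eq (Submodule.eq_of_le_of_finrank_eq (hle _ hd' (by omega)) ?_).symm
      rw [finrank_span_eq_card hΔT.2, finrank_span_eq_card (hT _ hd').2]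
    · exact le_trans (((hC d hdF) d' hd').1 h1) hAd
  have hdc : (d:ℝ) + 1 ≤ Fintype.card ι := by exact_mod_cast TupN_le hΔT
  have hsm : psiN L Δ < Fintype.card ι * δ := by
    have h1 := psiN_cons L (A d) b
    have h2 := hup d hdF
    have h3 : psiN L (A d) * ‖L b‖ ≤ 1 * ‖L b‖ := mul_le_mul_of_nonneg_right h2 (norm_nonneg _)
    have h4 : psiN L (A d) * ‖L b‖ < δ := by linarith
    calc psiN L Δ ≤ (d+1) * (psiN L (A d) * ‖L b‖) := h1
      _ < (d+1) * δ := by gcongr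
      _ ≤ _ := by gcongr
  by_cases hF : d + 1 ∈ F
  · have := hsame _ hF Δ hΔT hΔC
    have h2 := hlow _ hF
    nlinarith
  · have := hbig _ hF Δ hΔT hΔC
    linarith

/-- affine functions: the value in between is bounded by max of the end points. -/
lemma psi_convex {κ : Type} [Fintype κ] (u v : κ → ℝ) (a h η x : ℝ) (hh : 0 < h)
    (h1 : ‖u + a • v‖ ≤ η) (h2 : ‖u + (a + h) • v‖ ≤ η) (hx : x ∈ Set.Icc a (a + h)) :
    ‖u + x • v‖ ≤ η := by
  set θ := (x - a) / h
  have hθ0 : 0 ≤ θ := div_nonneg (by linarith [hx.1]) hh.le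
  have hθ1 : θ ≤ 1 := by rw [div_le_one hh]; linarith [hx.2]
  have hxe : x = a + θ * h := by simp only [θ]; field_simp; ring
  have : u + x • v = (1 - θ) • (u + a • v) + θ • (u + (a+h) • v) := by
    rw [hxe]; ext i; simp; ring
  rw [this]
  calc _ ≤ ‖(1 - θ) • (u + a • v)‖ + ‖θ • (u + (a+h) • v)‖ := norm_add_le _ _
    _ = (1-θ) * ‖u + a • v‖ + θ * ‖u + (a+h) • v‖ := by
      rw [norm_smul, norm_smul, Real.norm_of_nonneg hθ0, Real.norm_of_nonneg (by linarith)]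
    _ ≤ (1-θ) * η + θ * η := by
      gcongr
    _ = η := by ring

/-- if a parent cell has a big end point value then the child has one too, up to factor 3 -/
lemma psi_child {κ : Type} [Fintype κ] (u v : κ → ℝ) (a h a' η : ℝ)
    (ha : a' = a ∨ a' = a + h)
    (hb : η ≤ ‖u + a • v‖ ∨ η ≤ ‖u + (a + 2 * h) • v‖) :
    η / 3 ≤ ‖u + a' • v‖ ∨ η / 3 ≤ ‖u + (a' + h) • v‖ := by
  by_contra hcon
  push Not at hcon
  obtain ⟨c1, c2⟩ := hcon
  have e1 : ∀ y : ℝ, (u + y • v = u + y • v) := fun _ => rfl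
  have n2 : ∀ p q : κ → ℝ, ‖(2:ℝ) • p - q‖ ≤ 2 * ‖p‖ + ‖q‖ := by
    intro p q
    have := norm_sub_le ((2:ℝ) • p) q
    rw [norm_smul] at this
    simpa using this
  have hη : 0 ≤ η / 3 := (norm_nonneg _).trans c1.le
  rcases ha with rfl | rfl
  · have : u + (a' + 2*h) • v = (2:ℝ) • (u + (a'+h) • v) - (u + a' • v) := by
      ext i; simp; ring
    rcases hb with hb | hb
    · linarith
    · rw [this] at hb
      linarith [n2 (u + (a'+h) • v) (u + a' • v)]
  · have e2 : a + h + h = a + 2 * h := by ring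
    rw [e2] at c2
    have : u + a • v = (2:ℝ) • (u + (a+h) • v) - (u + (a + 2*h) • v) := by
      ext i; simp; ring
    rcases hb with hb | hb
    · rw [this] at hb
      linarith [n2 (u + (a+h) • v) (u + (a+2*h) • v)]
    · linarith

end QND

section QND2
variable {ι : Type} [Fintype ι] [DecidableEq ι]

lemma qnd_limit {κ : Type} [Fintype κ] (u v : κ → ℝ) (a h η x : ℝ) (hh : 0 < h) (hx : a ≤ x)
    (hb : ∀ l : ℕ, η ≤ ‖u + (a + (dyIdx a h l x : ℝ) * (h/2^l)) • v‖ ∨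
      η ≤ ‖u + (a + (dyIdx a h l x : ℝ) * (h/2^l) + h/2^l) • v‖) : η ≤ ‖u + x • v‖ := by
  have key : ∀ l : ℕ, η ≤ ‖u + x • v‖ + (h * ‖v‖) * (1/2)^l := by
    intro l
    have hc := (mem_dyCell_iff a h hh l (dyIdx a h l x) x hx).2 rfl
    unfold dyCell at hc
    have gen : ∀ y : ℝ, |y - x| ≤ h / 2^l → η ≤ ‖u + y • v‖ → η ≤ ‖u + x • v‖ + (h * ‖v‖) * (1/2)^l := by
      intro y hy h1
      have e : u + y • v = (u + x • v) + (y - x) • v := by ext i; simp; ring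
      have h2 := norm_add_le (u + x • v) ((y - x) • v)
      rw [← e, norm_smul, Real.norm_eq_abs] at h2
      have h3 : |y - x| * ‖v‖ ≤ h/2^l * ‖v‖ := by gcongr
      have h4 : h/2^l * ‖v‖ = (h * ‖v‖) * (1/2)^l := by rw [one_div, inv_pow]; ring
      linarith
    have hp : 0 < h / 2^l := by positivity
    rcases hb l with h1 | h1
    · exact gen _ (by rw [abs_le]; constructor <;> linarith [hc.1, hc.2]) h1
    · exact gen _ (by rw [abs_le]; constructor <;> linarith [hc.1, hc.2]) h1
  have ht : Filter.Tendsto (fun l : ℕ => ‖u + x • v‖ + (h * ‖v‖) * (1/2:ℝ)^l) Filter.atTop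
      (nhds (‖u + x • v‖ + (h * ‖v‖) * 0)) := by
    apply Filter.Tendsto.const_add
    apply Filter.Tendsto.const_mul
    exact tendsto_pow_atTop_nhds_zero_of_lt_one (by norm_num) (by norm_num)
  have := ge_of_tendsto' ht key
  simpa using this

lemma qnd_ind (L : ℝ → (ι → ℝ) →ₗ[ℝ] (ι → ℝ))
    (hL : ∀ (d : ℕ) (A : Fin d → ι → ℝ), ∃ u v, ∀ x, mn (fun j => L x (A j)) = u + x • v)
    (Λ : Set (ι → ℝ)) (δ ε η0 : ℝ) (hδ : 0 < δ) (hη0 : 0 < η0)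
    (hε : 3 * (Fintype.card ι) * δ ≤ ε) (hε0 : 0 ≤ ε) (hη : (Fintype.card ι) * δ ≤ η0) (e : ℕ) :
    ∀ a h : ℝ, 0 < h → ∀ F : Finset ℕ, F ⊆ Finset.range (Fintype.card ι + 1) → 0 ∈ F →
    Fintype.card ι + 1 ≤ F.card + e → ∀ (A : ∀ d : ℕ, Fin d → ι → ℝ) (η : ℝ), 3 ^ e * η0 ≤ η → η ≤ 1 →
    (∀ d ∈ F, TupN Λ (A d)) → (∀ d ∈ F, CmpN F A d (A d)) →
    (∀ x ∈ Set.Icc a (a+h), ∀ d ∈ F, psiN (L x) (A d) ≤ 1) →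
    (∀ x, ∀ d ∈ F, ∀ A' : Fin d → ι → ℝ, TupN Λ A' → CmpN F A d A' → psiN (L x) (A d) ≤ 3 * psiN (L x) A') →
    (∀ d, d ∉ F → ∀ A' : Fin d → ι → ℝ, TupN Λ A' → CmpN F A d A' →
      η ≤ psiN (L a) A' ∨ η ≤ psiN (L (a+h)) A') →
    volume {x | x ∈ Set.Ico a (a+h) ∧ (∀ d ∈ F, ε ≤ psiN (L x) (A d)) ∧ ∃ b ∈ Λ, b ≠ 0 ∧ ‖L x b‖ < δ}
      ≤ ENNReal.ofReal (e * (4 * ε / η0)) * ENNReal.ofReal h := by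
  classical
  induction e with
  | zero =>
    intro a h hh F hF h0 hcard A η hη1 hη2 hT hC hup hsame hbig
    have hFe : F = Finset.range (Fintype.card ι + 1) := by
      apply Finset.eq_of_subset_of_card_le hF
      simpa using hcard
    have : {x | x ∈ Set.Ico a (a+h) ∧ (∀ d ∈ F, ε ≤ psiN (L x) (A d)) ∧ ∃ b ∈ Λ, b ≠ 0 ∧ ‖L x b‖ < δ} = ∅ := by
      rw [Set.eq_empty_iff_forall_notMem]
      rintro x ⟨hx, hlow, b, hb, hb0, hbs⟩
      refine flag_pointwise (L x) Λ F h0 A δ ε η0 hδ hε hη hT hC (hup x ⟨hx.1, hx.2.le⟩) hlow (hsame x) ?_ b hb hb0 hbs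
      intro d hd A' hT' _
      exact absurd (by rw [hFe, Finset.mem_range]; have := TupN_le hT'; omega) hd
    rw [this]; simp
  | succ e ih =>
    intro a h hh F hF h0 hcard A η hη1 hη2 hT hC hup hsame hbig
    set E := {x | x ∈ Set.Ico a (a+h) ∧ (∀ d ∈ F, ε ≤ psiN (L x) (A d)) ∧ ∃ b ∈ Λ, b ≠ 0 ∧ ‖L x b‖ < δ} with hE
    have hηη : η0 ≤ η := by
      refine le_trans ?_ hη1
      have : (1:ℝ) ≤ 3^(e+1) := one_le_pow₀ (by norm_num)
      nlinarith
    have hηpos : 0 < η := lt_of_lt_of_le hη0 hηη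
    have hη3 : 3^e * η0 ≤ η/3 := by
      rw [pow_succ] at hη1; linarith
    have hη03 : η0 ≤ η/3 := by
      refine le_trans ?_ hη3
      have : (1:ℝ) ≤ 3^e := one_le_pow₀ (by norm_num)
      nlinarith
    let P : ℕ → ℕ → Prop := fun l j => ∃ d, d ∉ F ∧ ∃ A' : Fin d → ι → ℝ, TupN Λ A' ∧ CmpN F A d A' ∧
      psiN (L (a + j * (h/2^l))) A' < η ∧ psiN (L (a + j * (h/2^l) + h/2^l)) A' < η
    refine dyadic_cover a h hh P E (fun x hx => hx.1) ?_ ?_ _ ?_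
    · rintro ⟨d, hd, A', hT', hC', h1, h2⟩
      simp only [Nat.cast_zero, zero_mul, add_zero, pow_zero, div_one] at h1 h2
      rcases hbig d hd A' hT' hC' with h3 | h3 <;> linarith
    · rintro x ⟨hx, hlow, b, hb, hb0, hbs⟩
      by_contra hcon
      push Not at hcon
      refine flag_pointwise (L x) Λ F h0 A δ ε η hδ hε (hη.trans hηη) hT hC (hup x ⟨hx.1, hx.2.le⟩) hlow (hsame x) ?_ b hb hb0 hbs
      intro d hd A' hT' hC'
      obtain ⟨u, v, huv⟩ := hL d A'
      unfold psiN
      rw [huv]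
      apply qnd_limit u v a h η x hh hx.1
      intro l
      by_contra hc
      push Not at hc
      apply hcon l
      refine ⟨d, hd, A', hT', hC', ?_⟩
      unfold psiN
      rw [huv, huv]
      exact hc
    · intro l j hnp hp hj
      have hpar : ∀ d, d ∉ F → ∀ A' : Fin d → ι → ℝ, TupN Λ A' → CmpN F A d A' →
          η/3 ≤ psiN (L (a + j * (h/2^(l+1)))) A' ∨ η/3 ≤ psiN (L (a + j * (h/2^(l+1)) + h/2^(l+1))) A' := by
        intro d hd A' hT' hC'
        obtain ⟨u, v, huv⟩ := hL d A'
        unfold psiN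
        rw [huv, huv]
        have e2 : h/2^l = 2 * (h/2^(l+1)) := by rw [pow_succ]; field_simp
        refine psi_child u v (a + ((j/2 : ℕ):ℝ) * (h/2^l)) (h/2^(l+1)) _ η ?_ ?_
        · have hj2 : (j:ℝ) = 2 * ((j/2:ℕ):ℝ) + ((j%2:ℕ):ℝ) := by
            exact_mod_cast (Nat.div_add_mod j 2).symm
          rcases Nat.mod_two_eq_zero_or_one j with h2 | h2
          · left; rw [hj2, h2, e2]; push_cast; ring
          · right; rw [hj2, h2, e2]; push_cast; ring
        · by_contra hc
          push Not at hc
          apply hnp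
          refine ⟨d, hd, A', hT', hC', ?_⟩
          unfold psiN
          rw [huv, huv]
          refine ⟨hc.1, ?_⟩
          have := hc.2
          rwa [← e2] at this
      obtain ⟨d', hd', A', hT', hC', hs1, hs2⟩ := hp
      set a' := a + j * (h/2^(l+1)) with ha'
      set h' := h/2^(l+1) with hh'
      have hh'pos : 0 < h' := by positivity
      have hsub : Set.Icc a' (a'+h') ⊆ Set.Icc a (a+h) := by
        have hj1 : (j:ℝ) + 1 ≤ 2^(l+1) := by exact_mod_cast hj
        have hje : 2^(l+1) * h' = h := by rw [hh']; field_simp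
        have : ((j:ℝ)+1) * h' ≤ 2^(l+1) * h' := by gcongr
        have h0j : 0 ≤ (j:ℝ) * h' := by positivity
        intro y hy
        constructor
        · linarith [hy.1]
        · linarith [hy.2]
      set F' := insert d' F with hF'
      set B : ∀ d : ℕ, Fin d → ι → ℝ := Function.update A d' A' with hB
      have hBs : B d' = A' := Function.update_self _ _ _
      have hBn : ∀ d ∈ F, B d = A d := by
        intro d hd
        apply Function.update_of_ne
        rintro rfl; exact hd' hd
      have hCC : ∀ d (A'' : Fin d → ι → ℝ), CmpN F' B d A'' → CmpN F A d A'' := by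
        intro d A'' hc d2 hd2
        have := hc d2 (Finset.mem_insert_of_mem hd2)
        rwa [hBn d2 hd2] at this
      obtain ⟨u, v, huv⟩ := hL d' A'
      have hpsi : ∀ x, psiN (L x) A' = ‖u + x • v‖ := fun x => by unfold psiN; rw [huv]
      have ih' := ih a' h' hh'pos F' ?_ (Finset.mem_insert_of_mem h0) ?_ B (η/3) hη3 (by linarith) ?_ ?_ ?_ ?_ ?_
      · have hbg := hpar d' hd' A' hT' hC'
        rw [hpsi, hpsi] at hbg
        have hsmall := affine_small_volume u v a' h' (η/3) ε hh'pos (by linarith) hε0 hbg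
        have hcov : E ∩ dyCell a h (l+1) j ⊆ {x | x ∈ Set.Ico a' (a'+h') ∧ (∀ d ∈ F', ε ≤ psiN (L x) (B d)) ∧ ∃ b ∈ Λ, b ≠ 0 ∧ ‖L x b‖ < δ} ∪ {x | x ∈ Set.Icc a' (a'+h') ∧ ‖u + x • v‖ < ε} := by
          rintro x ⟨⟨hx, hlow, hb⟩, hxc⟩
          by_cases hc : ‖u + x • v‖ < ε
          · right; exact ⟨⟨hxc.1, hxc.2.le⟩, hc⟩
          · left
            refine ⟨hxc, ?_, hb⟩
            intro d hd
            rcases Finset.mem_insert.1 hd with rfl | hd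
            · rw [hBs, hpsi]; linarith
            · rw [hBn d hd]; exact hlow d hd
        refine (measure_mono hcov).trans ((measure_union_le _ _).trans ?_)
        refine (add_le_add ih' hsmall).trans ?_
        rw [← ENNReal.ofReal_mul (by positivity), ← ENNReal.ofReal_mul (by positivity), ← ENNReal.ofReal_add (by positivity) (by positivity)]
        apply ENNReal.ofReal_le_ofReal
        have : 4 * ε / (η/3) ≤ 4 * ε / η0 := by gcongr
        push_cast
        nlinarith
      · intro d hd
        rcases Finset.mem_insert.1 hd with rfl | hd
        · rw [Finset.mem_range]; have := TupN_le hT'; omega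
        · exact hF hd
      · rw [hF', Finset.card_insert_of_notMem hd']; omega
      · intro d hd
        rcases Finset.mem_insert.1 hd with rfl | hd
        · rw [hBs]; exact hT'
        · rw [hBn d hd]; exact hT d hd
      · intro d hd d2 hd2
        rcases Finset.mem_insert.1 hd with rfl | hdF
        · rcases Finset.mem_insert.1 hd2 with rfl | hd2
          · exact ⟨fun _ => le_rfl, fun _ => le_rfl⟩
          · rw [hBs, hBn d2 hd2]; exact hC' d2 hd2
        · rcases Finset.mem_insert.1 hd2 with rfl | hd2
          · rw [hBs, hBn d hdF]; exact ⟨(hC' d hdF).2, (hC' d hdF).1⟩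
          · rw [hBn d hdF, hBn d2 hd2]; exact hC d hdF d2 hd2
      · intro x hx d hd
        rcases Finset.mem_insert.1 hd with rfl | hd
        · rw [hBs, hpsi]
          rw [hpsi] at hs1 hs2
          exact (psi_convex u v a' h' η x hh'pos hs1.le hs2.le hx).trans hη2
        · rw [hBn d hd]; exact hup x (hsub hx) d hd
      · intro x d hd A'' hT'' hC''
        rcases Finset.mem_insert.1 hd with rfl | hd
        · rw [hBs]
          have hsp := (hC'' d (Finset.mem_insert_self _ _)).2 le_rfl
          rw [hBs] at hsp
          obtain ⟨s, hs⟩ := mn_span A' A'' (fun j => hsp (Submodule.subset_span ⟨j, rfl⟩))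
          have hs' : ∀ x, psiN (L x) A'' = |s| * psiN (L x) A' := by
            intro x; unfold psiN; rw [hs, norm_smul, Real.norm_eq_abs]
          have hbg := hpar d hd' A'' hT'' (hCC _ _ hC'')
          rw [hs', hs'] at hbg
          rw [hs']
          have hs3 : 1/3 ≤ |s| := by
            by_contra hcon
            push Not at hcon
            have n1 : 0 ≤ psiN (L a') A' := norm_nonneg _
            have n2 : 0 ≤ psiN (L (a'+h')) A' := norm_nonneg _
            rcases hbg with hbg | hbg <;> nlinarith [abs_nonneg s]
          have n1 : 0 ≤ psiN (L x) A' := norm_nonneg _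
          nlinarith
        · rw [hBn d hd]; exact hsame x d hd A'' hT'' (hCC _ _ hC'')
      · intro d hd A'' hT'' hC''
        exact hpar d (fun hc => hd (Finset.mem_insert_of_mem hc)) A'' hT'' (hCC _ _ hC'')

theorem qnd (D : ℕ) (hD : Fintype.card ι = D) (L : ℝ → (ι → ℝ) →ₗ[ℝ] (ι → ℝ))
    (hL : ∀ (d : ℕ) (A : Fin d → ι → ℝ), ∃ u v, ∀ x, mn (fun j => L x (A j)) = u + x • v)
    (Λ : Set (ι → ℝ)) (δ : ℝ) (hδ : 0 < δ) (a h : ℝ) (hh : 0 < h)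
    (hbig : ∀ d, 0 < d → ∀ A' : Fin d → ι → ℝ, TupN Λ A' →
      1 ≤ psiN (L a) A' ∨ 1 ≤ psiN (L (a+h)) A') :
    volume {x | x ∈ Set.Ico a (a+h) ∧ ∃ b ∈ Λ, b ≠ 0 ∧ ‖L x b‖ < δ}
      ≤ ENNReal.ofReal ((12 * (D+1)^2 * 3^(D+1)) * δ * h) := by
  classical
  set C : ℝ := 12 * (D+1)^2 * 3^(D+1) with hC
  have hCpos : 0 < C := by positivity
  by_cases hbigδ : 1 ≤ C * δ
  · refine (measure_mono (t := Set.Ico a (a+h)) fun x hx => hx.1).trans ?_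
    rw [Real.volume_Ico]
    apply ENNReal.ofReal_le_ofReal
    nlinarith
  push Not at hbigδ
  have h3 : (1:ℝ) ≤ 3^(D+1) := one_le_pow₀ (by norm_num)
  have hps0 : ∀ (x:ℝ) (A : Fin 0 → ι → ℝ), psiN (L x) A = 1 := by
    intro x A
    unfold psiN
    have : mn (fun j => L x (A j)) = fun _ => (1:ℝ) := by
      ext I; simp [mn]
    rw [this]
    simp
  set η0 : ℝ := ((3:ℝ)^(D+1))⁻¹ with hη0
  have hη0pos : 0 < η0 := by positivity
  set X : ℝ := 3^(D+1) with hX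
  have hDX : 3 * (D:ℝ) * δ ≤ 1 := by
    have h12 : 3 * (D:ℝ) ≤ C := by
      rw [hC]; nlinarith [sq_nonneg ((D:ℝ)+1), (Nat.cast_nonneg D : (0:ℝ) ≤ D)]
    nlinarith
  have hDη : (D:ℝ) * δ ≤ η0 := by
    rw [hη0, ← one_div, le_div_iff₀ (by linarith)]
    have h0 : (D:ℝ) ≤ 12 * (D+1)^2 := by nlinarith [(Nat.cast_nonneg D : (0:ℝ) ≤ D)]
    have h1 : (D:ℝ) * (δ * X) ≤ 12 * (D+1)^2 * (δ * X) := by gcongr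
    rw [hC] at hbigδ
    nlinarith
  have main := qnd_ind L hL Λ δ (3 * D * δ) η0 hδ hη0pos (by rw [hD]) (by positivity) (by rw [hD]; exact hDη)
    D a h hh {0} (by simp) (by simp) (by rw [hD]; simp [add_comm]) (fun _ _ => 0) 1 (by
      rw [hη0, hX, pow_succ]; field_simp; norm_num) le_rfl ?_ ?_ ?_ ?_ ?_
  · refine (measure_mono ?_).trans (main.trans ?_)
    · rintro x ⟨hx, hb⟩
      refine ⟨hx, ?_, hb⟩
      intro d hd
      rw [Finset.mem_singleton] at hd
      subst hd
      rw [hps0]; exact hDX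
    · rw [← ENNReal.ofReal_mul (by positivity)]
      apply ENNReal.ofReal_le_ofReal
      have : (D:ℝ) * (4 * (3 * D * δ) / η0) = 12 * D^2 * X * δ := by
        rw [hη0]; field_simp; ring
      rw [this, hC]
      gcongr
      linarith
  · intro d hd
    rw [Finset.mem_singleton] at hd
    subst hd
    exact ⟨fun j => j.elim0, linearIndependent_empty_type⟩
  · intro d hd d2 hd2
    rw [Finset.mem_singleton] at hd hd2
    subst hd
    subst hd2
    exact ⟨fun _ => le_rfl, fun _ => le_rfl⟩
  · intro x _ d hd
    rw [Finset.mem_singleton] at hd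
    subst hd
    rw [hps0]
  · intro x d hd A' _ _
    rw [Finset.mem_singleton] at hd
    subst hd
    rw [hps0, hps0]
    norm_num
  · intro d hd A' hT' _
    rw [Finset.mem_singleton] at hd
    exact hbig d (Nat.pos_of_ne_zero hd) A' hT'

end QND2

set_option linter.unusedSectionVars false

/-- data of the one-parameter problem -/
structure CD (ι : Type) [Fintype ι] [DecidableEq ι] where
  i0 : ι
  i1 : ι
  hne : i0 ≠ i1
  ρ : ι → ℝ
  ζ : ι → ℝ
  τ : ℝ
  hτ : 0 < τ
  hρ0 : ρ i0 = -1
  hρτ : ∀ i, i ≠ i0 → τ ≤ ρ i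
  hsum : ∑ i, ρ i = 0
  hζ : ζ i0 = 1

namespace CD
variable {ι : Type} [Fintype ι] [DecidableEq ι] (Q : CD ι)

noncomputable def co (x : ℝ) : (ι → ℝ) →ₗ[ℝ] (ι → ℝ) where
  toFun b i := if i = Q.i0 then ∑ j, Q.ζ j * b j + x * b Q.i1 else b i
  map_add' b c := by
    ext i
    by_cases h : i = Q.i0
    · simp [h, mul_add, Finset.sum_add_distrib]; ring
    · simp [h]
  map_smul' s b := by
    ext i
    by_cases h : i = Q.i0
    · simp only [h, if_true, Pi.smul_apply, smul_eq_mul, RingHom.id_apply, mul_add, Finset.mul_sum]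
      congr 1
      · exact Finset.sum_congr rfl fun j _ => by ring
      · ring
    · simp [h]

lemma co_i0 (x : ℝ) (b : ι → ℝ) : Q.co x b Q.i0 = ∑ j, Q.ζ j * b j + x * b Q.i1 := by simp [co]
lemma co_ne (x : ℝ) (b : ι → ℝ) {i : ι} (h : i ≠ Q.i0) : Q.co x b i = b i := by simp [co, h]

lemma co_inj (x : ℝ) (b : ι → ℝ) (h : Q.co x b = 0) : b = 0 := by
  have h1 : ∀ i, i ≠ Q.i0 → b i = 0 := fun i hi => by
    rw [← Q.co_ne x b hi, h]; rfl
  have h2 := congrFun h Q.i0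
  rw [co_i0, Finset.sum_eq_single Q.i0, Q.hζ, h1 Q.i1 Q.hne.symm] at h2
  · ext i
    by_cases hi : i = Q.i0
    · rw [hi]; simpa using h2
    · exact h1 i hi
  · intro j _ hj; rw [h1 j hj]; simp
  · simp

/-- scaled linear map -/
noncomputable def Ls (T : ι → ℝ) (x : ℝ) : (ι → ℝ) →ₗ[ℝ] (ι → ℝ) where
  toFun b i := Q.co x b i / T i
  map_add' b c := by ext i; simp [add_div]
  map_smul' s b := by ext i; simp [mul_div_assoc]

lemma mn_Ls {d : ℕ} (T : ι → ℝ) (x : ℝ) (A : Fin d → ι → ℝ) (I : Fin d → ι) :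
    mn (fun j => Q.Ls T x (A j)) I = (∏ p, T (I p))⁻¹ * mn (fun j => Q.co x (A j)) I := by
  unfold mn
  rw [← Finset.prod_inv_distrib, ← Matrix.det_mul_column]
  congr 1
  ext i j
  simp [Ls, div_eq_inv_mul]

/-- the raw minors -/
noncomputable def Wm {d : ℕ} (A : Fin d → ι → ℝ) (x : ℝ) (I : Fin d → ι) : ℝ := mn (fun j => Q.co x (A j)) I

lemma Wm_of_notMem {d : ℕ} (A : Fin d → ι → ℝ) (x : ℝ) (I : Fin d → ι) (h : ∀ p, I p ≠ Q.i0) :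
    Q.Wm A x I = mn A I := by
  unfold Wm mn
  congr 1
  ext i j
  simp [Q.co_ne x _ (h i)]

lemma Wm_expand {d : ℕ} (A : Fin d → ι → ℝ) (x : ℝ) (I : Fin d → ι) (p : Fin d) (hp : I p = Q.i0)
    (h : ∀ k, k ≠ p → I k ≠ Q.i0) :
    Q.Wm A x I = ∑ j, Q.ζ j * mn A (Function.update I p j) + x * mn A (Function.update I p Q.i1) := by
  have e1 : ∀ i : ι, mn A (Function.update I p i) =
      ((Matrix.of fun i j => A j (I i)).updateRow p (fun j => A j i)).det := by
    intro i
    unfold mn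
    congr 1
    ext k j
    by_cases hk : k = p
    · subst hk; simp
    · simp [Matrix.updateRow_ne hk, Function.update_of_ne hk]
  have e2 : Q.Wm A x I = ((Matrix.of fun i j => A j (I i)).updateRow p
      ((∑ i, Q.ζ i • (fun j => A j i)) + x • (fun j => A j Q.i1))).det := by
    unfold Wm mn
    congr 1
    ext k j
    by_cases hk : k = p
    · subst hk; simp [hp, co_i0]
    · simp [Matrix.updateRow_ne hk, Q.co_ne x _ (h k hk)]
  rw [e2, Matrix.det_updateRow_add, Matrix.det_updateRow_smul, e1]
  congr 1
  have := map_sum (((Matrix.detRowAlternating (R := ℝ) (n := Fin d)).toMultilinearMap.toLinearMap (Matrix.of fun i j => A j (I i)) p))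
     (fun i => Q.ζ i • (fun j => A j i)) Finset.univ
  simp only [map_smul] at this
  refine this.trans (Finset.sum_congr rfl fun i _ => ?_)
  rw [e1]
  rfl

lemma Wm_diff {d : ℕ} (A : Fin d → ι → ℝ) (x y : ℝ) (I : Fin d → ι) (p : Fin d) (hp : I p = Q.i1)
    (h : ∀ k, I k ≠ Q.i0) :
    Q.Wm A y (Function.update I p Q.i0) - Q.Wm A x (Function.update I p Q.i0) = (y - x) * mn A I := by
  have hk : ∀ k, k ≠ p → Function.update I p Q.i0 k ≠ Q.i0 := by
    intro k hk; rw [Function.update_of_ne hk]; exact h k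
  rw [Q.Wm_expand A x _ p (by simp) hk, Q.Wm_expand A y _ p (by simp) hk]
  have : Function.update (Function.update I p Q.i0) p Q.i1 = I := by
    rw [Function.update_idem, ← hp, Function.update_eq_self]
  rw [this]; ring

lemma rho_le_one {d : ℕ} (I : Fin d → ι) (hI : Function.Injective I) (h : ∀ p, I p ≠ Q.i0) :
    ∑ p, Q.ρ (I p) ≤ 1 := by
  have h1 : ∑ p, Q.ρ (I p) = ∑ i ∈ Finset.univ.image I, Q.ρ i := by
    rw [Finset.sum_image]; exact fun a _ b _ hab => hI hab
  have h2 := Q.hsum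
  rw [← Finset.add_sum_erase _ _ (Finset.mem_univ Q.i0), Q.hρ0] at h2
  have h3 : ∑ i ∈ Finset.univ.image I, Q.ρ i ≤ ∑ i ∈ Finset.univ.erase Q.i0, Q.ρ i := by
    apply Finset.sum_le_sum_of_subset_of_nonneg
    · intro i hi
      rw [Finset.mem_image] at hi
      obtain ⟨p, -, rfl⟩ := hi
      simp [h p]
    · intro i hi _
      exact Q.hτ.le.trans (Q.hρτ i (Finset.ne_of_mem_erase hi))
  linarith

lemma rho_neg {d : ℕ} (I : Fin d → ι) (hI : Function.Injective I) (h : ∃ p, I p = Q.i0)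
    (h' : ∃ i, ∀ p, I p ≠ i) :
    ∑ p, Q.ρ (I p) ≤ -Q.τ := by
  have h1 : ∑ p, Q.ρ (I p) = ∑ i ∈ Finset.univ.image I, Q.ρ i := by
    rw [Finset.sum_image]; exact fun a _ b _ hab => hI hab
  have h2 := Q.hsum
  obtain ⟨i, hi⟩ := h'
  obtain ⟨p0, hp0⟩ := h
  rw [← Finset.sum_add_sum_compl (Finset.univ.image I)] at h2
  have hnn : ∀ j ∈ (Finset.univ.image I)ᶜ, Q.τ ≤ Q.ρ j := by
    intro j hj
    apply Q.hρτ
    rintro rfl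
    rw [Finset.mem_compl] at hj
    exact hj (Finset.mem_image.2 ⟨p0, Finset.mem_univ _, hp0⟩)
  have him : i ∈ (Finset.univ.image I)ᶜ := by
    rw [Finset.mem_compl, Finset.mem_image]
    rintro ⟨p, -, hp⟩
    exact hi p hp
  have h3 : Q.ρ i ≤ ∑ j ∈ (Finset.univ.image I)ᶜ, Q.ρ j :=
    Finset.single_le_sum (fun j hj => Q.hτ.le.trans (hnn j hj)) him
  have := hnn i him
  linarith

lemma rho1_le : Q.ρ Q.i1 ≤ 1 := by
  have := Q.rho_le_one (fun _ : Fin 1 => Q.i1) (fun a b _ => Subsingleton.elim a b) (fun _ => Q.hne.symm)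
  simpa using this

lemma rho1_pos : 0 < Q.ρ Q.i1 := Q.hτ.trans_le (Q.hρτ _ Q.hne.symm)

/-- Minkowski in a box. -/
lemma mink_box {d : ℕ} (hd : 0 < d) (Γ : Fin d → ι → ℤ) 
    (hΓ : LinearIndependent ℝ (fun j i => (Γ j i : ℝ))) (x : ℝ) (u : ι → ℝ)
    (hW : ∀ I : Fin d → ι, Function.Injective I →
      |Q.Wm (fun j i => (Γ j i : ℝ)) x I| ≤ 2 ^ (∑ p, u (I p))) :
    ∃ k : Fin d → ℤ, (fun i => ∑ j, k j * Γ j i) ≠ 0 ∧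
      ∀ i, |Q.co x (fun i => ((∑ j, k j * Γ j i : ℤ) : ℝ)) i| ≤ 2 * d * 2 ^ (u i) := by
  set A : Fin d → ι → ℝ := fun j i => (Γ j i : ℝ) with hA
  have hker : ∀ b, Q.Ls (fun i => 2 ^ u i) x b = 0 → b = 0 := by
    intro b hb
    apply Q.co_inj x b
    ext i
    have : Q.co x b i / 2 ^ u i = 0 := congrFun hb i
    exact (div_eq_zero_iff.1 this).resolve_right (by positivity)
  have hli : LinearIndependent ℝ (fun j => Q.Ls (fun i => 2 ^ u i) x (A j)) :=
    hΓ.map' _ (LinearMap.ker_eq_bot'.2 hker)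
  obtain ⟨k, hk0, hk⟩ := minkowski_tuple hd _ (mn_ne_zero _ hli) (by
    intro I
    by_cases hI : Function.Injective I
    · rw [mn_Ls, abs_mul, abs_inv, abs_of_pos (by positivity), inv_mul_le_iff₀ (by positivity), mul_one]
      rw [← Real.rpow_sum_of_pos (by norm_num)]
      exact hW I hI
    · rw [mn_not_inj _ _ hI]; simp)
  refine ⟨k, ?_, ?_⟩
  · intro h0
    apply hk0
    have : ∑ j, (k j : ℝ) • A j = 0 := by
      ext i
      have := congrFun h0 i
      simp only [Pi.zero_apply] at this
      have h2 : ((∑ j, k j * Γ j i : ℤ) : ℝ) = 0 := by exact_mod_cast this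
      simpa [hA] using h2
    have h3 := Fintype.linearIndependent_iff.1 hΓ (fun j => (k j : ℝ)) this
    ext j
    exact_mod_cast h3 j
  · intro i
    have h1 := hk i
    have h2 : ∑ j, (k j:ℝ) * Q.Ls (fun i => 2 ^ u i) x (A j) i = Q.co x (fun i => ((∑ j, k j * Γ j i : ℤ) : ℝ)) i / 2 ^ u i := by
      have e : (fun i => ((∑ j, k j * Γ j i : ℤ) : ℝ)) = ∑ j, (k j : ℝ) • A j := by
        ext i; simp [hA]
      rw [e, map_sum]
      simp [Ls, Finset.sum_div, mul_div_assoc]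
    rw [h2, abs_div, abs_of_pos (by positivity : (0:ℝ) < 2 ^ u i), div_le_iff₀ (by positivity)] at h1
    exact h1

end CD

set_option linter.unusedSectionVars false

namespace CD
variable {ι : Type} [Fintype ι] [DecidableEq ι] (Q : CD ι)

noncomputable def tt (N k m : ℕ) : ℝ := (k + (N + 2) * m) / (1 + Q.ρ Q.i1)

/-- exponent of the box of class `m`, level `k` -/
noncomputable def Kx (N k m : ℕ) (i : ι) : ℝ :=
  Q.ρ i * Q.tt N k m + if i = Q.i1 then -((N:ℝ) * m) else 2 * m

/-- the dangerous set of class `m` level `k` -/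
def Bset (N k m : ℕ) : Set ℝ :=
  {x | ∃ b : ι → ℤ, b ≠ 0 ∧ ∀ i, |Q.co x (fun i => (b i : ℝ)) i| ≤ 2 ^ Q.Kx N k m i}

def Gen (γ t0 : ℝ) : Prop := ∀ t ≥ t0, ∀ b : ι → ℤ, b ≠ 0 → b Q.i1 = 0 →
  ∃ i, 2 ^ ((Q.ρ i + γ) * t) < |Q.co 0 (fun i => (b i : ℝ)) i|

lemma mn_int {d : ℕ} (Γ : Fin d → ι → ℤ) (I : Fin d → ι) :
    ∃ z : ℤ, mn (fun j i => (Γ j i : ℝ)) I = z := by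
  refine ⟨(Matrix.of fun i j => Γ j (I i)).det, ?_⟩
  unfold mn
  rw [Int.cast_det]
  rfl

lemma mn_one_le {d : ℕ} (Γ : Fin d → ι → ℤ) (I : Fin d → ι) (h : mn (fun j i => (Γ j i : ℝ)) I ≠ 0) :
    1 ≤ |mn (fun j i => (Γ j i : ℝ)) I| := by
  obtain ⟨z, hz⟩ := mn_int Γ I
  rw [hz] at h ⊢
  have : z ≠ 0 := by exact_mod_cast h
  exact_mod_cast Int.one_le_abs this

lemma Kx_div (N k m : ℕ) : Q.Kx N k m Q.i1 - Q.Kx N k m Q.i0 = k := by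
  have := Q.rho1_pos
  unfold Kx tt
  rw [if_pos rfl, if_neg Q.hne, Q.hρ0]
  field_simp
  ring

lemma tt_ge (N k m : ℕ) : (k:ℝ)/2 ≤ Q.tt N k m := by
  have h1 := Q.rho1_pos
  have h2 := Q.rho1_le
  unfold tt
  rw [div_le_div_iff₀ (by norm_num) (by linarith)]
  have : 0 ≤ ((N:ℝ)+2) * m := by positivity
  have hk : (0:ℝ) ≤ k := by positivity
  nlinarith

/-- full rank is impossible -/
lemma not_full {d : ℕ} (Γ : Fin d → ι → ℤ) (hΓ : LinearIndependent ℝ (fun j i => (Γ j i : ℝ)))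
    (x : ℝ) (N k m D : ℕ) (hD : Fintype.card ι ≤ D) (hN : N = 3 * D)
    (hW : ∀ I, Function.Injective I → |Q.Wm (fun j i => (Γ j i : ℝ)) x I| < 2 ^ (∑ p, (Q.Kx N k m (I p) + m))) :
    d < Fintype.card ι := by
  have hle : d ≤ Fintype.card ι := by
    have := hΓ.fintype_card_le_finrank
    simpa using this
  refine lt_of_le_of_ne hle ?_
  intro hd
  set A : Fin d → ι → ℝ := fun j i => (Γ j i : ℝ) with hA
  obtain ⟨I, hI⟩ := Function.ne_iff.1 (mn_ne_zero A hΓ)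
  have hI' : mn A I ≠ 0 := hI
  have hinj : Function.Injective I := by
    by_contra hc; exact hI' (mn_not_inj _ _ hc)
  have hbij : Function.Bijective I := (Fintype.bijective_iff_injective_and_card I).2 ⟨hinj, by simpa using hd⟩
  obtain ⟨p, hp⟩ := hbij.2 Q.i0
  have hWI : Q.Wm A x I = mn A I := by
    have hz : ∀ j, j ≠ Q.i0 → mn A (Function.update I p j) = 0 := by
      intro j hj
      apply mn_not_inj
      intro hc
      obtain ⟨q, hq⟩ := hbij.2 j
      have hqp : q ≠ p := by rintro rfl; exact hj (hq.symm.trans hp)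
      have : q = p := hc (by rw [Function.update_of_ne hqp, Function.update_self, hq])
      exact hqp this
    rw [Q.Wm_expand A x I p hp, hz _ Q.hne.symm, Finset.sum_eq_single Q.i0, Q.hζ]
    · rw [← hp, Function.update_eq_self]; ring
    · intro j _ hj; rw [hz j hj]; simp
    · simp
    · intro q hq hc
      exact hq (hinj (hc.trans hp.symm))
  have h1 := hW I hinj
  have h2 := mn_one_le Γ I hI'
  rw [hWI] at h1
  have h3 : ∑ p, (Q.Kx N k m (I p) + m) ≤ 0 := by
    rw [hbij.sum_comp (fun i => Q.Kx N k m i + (m:ℝ))]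
    unfold Kx
    rw [Finset.sum_add_distrib, Finset.sum_add_distrib, ← Finset.sum_mul, Q.hsum]
    have : ∑ i : ι, (if i = Q.i1 then -((N:ℝ) * m) else 2 * m) ≤ -((N:ℝ)*m) + 2 * m * D := by
      rw [← Finset.add_sum_erase _ _ (Finset.mem_univ Q.i1), if_pos rfl]
      gcongr
      calc _ ≤ ∑ i ∈ Finset.univ.erase Q.i1, (2 * (m:ℝ)) := by
            apply Finset.sum_le_sum
            intro i hi
            rw [if_neg (Finset.ne_of_mem_erase hi)]
        _ ≤ ∑ i : ι, (2 * (m:ℝ)) := Finset.sum_le_sum_of_subset_of_nonneg (Finset.erase_subset _ _) (fun _ _ _ => by positivity)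
        _ ≤ _ := by
          simp only [Finset.sum_const, Finset.card_univ, nsmul_eq_mul]
          have : (Fintype.card ι : ℝ) ≤ D := by exact_mod_cast hD
          nlinarith [(Nat.cast_nonneg m : (0:ℝ) ≤ m)]
    simp only [Finset.sum_const, Finset.card_univ, nsmul_eq_mul, zero_mul, zero_add]
    have h5 : (Fintype.card ι : ℝ) ≤ D := by exact_mod_cast hD
    have h6 : (Fintype.card ι : ℝ) * m ≤ D * m := by gcongr
    rw [hN] at this ⊢
    push_cast at this ⊢
    nlinarith
  have h4 : (2:ℝ) ^ (∑ p, (Q.Kx N k m (I p) + m)) ≤ 1 := Real.rpow_le_one_of_one_le_of_nonpos (by norm_num) h3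
  exact absurd (h2.trans_lt (h1.trans_le h4)) (lt_irrefl _)

lemma sum_Kx_le {d : ℕ} (N k m D : ℕ) (hd : d ≤ D) (I : Fin d → ι) :
    ∑ p, (Q.Kx N k m (I p) + m) ≤ (∑ p, Q.ρ (I p)) * Q.tt N k m + 3 * D * m := by
  unfold Kx
  simp only [Finset.sum_add_distrib, add_assoc]
  rw [← Finset.sum_mul, ← Finset.sum_add_distrib]
  gcongr
  calc _ ≤ ∑ p : Fin d, (3 * (m:ℝ)) := by
        apply Finset.sum_le_sum
        intro p _
        split_ifs
        · have : 0 ≤ (N:ℝ) * m := by positivity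
          have : 0 ≤ (m:ℝ) := by positivity
          linarith
        · linarith
    _ = d * (3 * (m:ℝ)) := by simp
    _ ≤ D * (3 * (m:ℝ)) := by gcongr
    _ = _ := by ring

lemma exists_not_range {d : ℕ} (hd : d < Fintype.card ι) (I : Fin d → ι) : ∃ i, ∀ p, I p ≠ i := by
  by_contra hc
  push Not at hc
  have : Function.Surjective I := hc
  have := Fintype.card_le_of_surjective I this
  simp at this
  omega

/-- root case -/
lemma no_small_root {d : ℕ} (hd0 : 0 < d) (Γ : Fin d → ι → ℤ)
    (hΓ : LinearIndependent ℝ (fun j i => (Γ j i : ℝ)))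
    (N k m D g : ℕ) (γ t0 : ℝ) (hD : Fintype.card ι ≤ D) (hN : N = 3 * D) (hm : D + 1 ≤ m)
    (hgen : Q.Gen γ t0) (ht0 : t0 ≤ g * m / 2) (hg1 : 2 * (3 * D + 2) ≤ g * Q.τ) (hg2 : 8 ≤ g * γ)
    (hγ : 0 < γ) (hk : g * m ≤ k)
    (h0 : ∀ I, Function.Injective I → |Q.Wm (fun j i => (Γ j i : ℝ)) 0 I| < 2 ^ (∑ p, (Q.Kx N k m (I p) + m)))
    (h1 : ∀ I, Function.Injective I → |Q.Wm (fun j i => (Γ j i : ℝ)) 1 I| < 2 ^ (∑ p, (Q.Kx N k m (I p) + m))) :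
    False := by
  have hdc := Q.not_full Γ hΓ 0 N k m D hD hN h0
  set A : Fin d → ι → ℝ := fun j i => (Γ j i : ℝ) with hA
  set t := Q.tt N k m with ht
  have hm1 : (D:ℝ) + 1 ≤ m := by exact_mod_cast hm
  have hkr : (g:ℝ) * m ≤ k := by exact_mod_cast hk
  have htge : (g:ℝ) * m / 2 ≤ t := by have := Q.tt_ge N k m; linarith
  have hτt : (3 * D + 2) * (m:ℝ) ≤ Q.τ * t := by
    have := Q.hτ
    calc (3 * D + 2) * (m:ℝ) = 2 * (3 * D + 2) * m / 2 := by ring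
      _ ≤ (g * Q.τ) * m / 2 := by gcongr
      _ = Q.τ * (g * m / 2) := by ring
      _ ≤ _ := by gcongr
  have hD0 : (0:ℝ) ≤ D := by positivity
  -- exponent bound
  have hexp : ∀ I : Fin d → ι, Function.Injective I → (∃ p, I p = Q.i0) →
      (2:ℝ) ^ (∑ p, (Q.Kx N k m (I p) + m)) ≤ 1/2 := by
    intro I hI hp
    have e1 := Q.sum_Kx_le N k m D (hdc.le.trans hD) I
    have e2 := Q.rho_neg I hI hp (exists_not_range hdc I)
    have htp : 0 ≤ t := le_trans (by positivity) htge
    have e3 : (∑ p, Q.ρ (I p)) * t ≤ -Q.τ * t := by gcongr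
    have e4 : ∑ p, (Q.Kx N k m (I p) + m) ≤ -1 := by nlinarith
    calc (2:ℝ) ^ (∑ p, (Q.Kx N k m (I p) + m)) ≤ 2 ^ (-1:ℝ) := Real.rpow_le_rpow_of_exponent_le (by norm_num) e4
      _ = 1/2 := by rw [Real.rpow_neg_one]; norm_num
  -- minors containing i1 and not i0 vanish
  have hz1 : ∀ I : Fin d → ι, (∃ p, I p = Q.i1) → (∀ p, I p ≠ Q.i0) → mn A I = 0 := by
    rintro I ⟨p, hp⟩ hI0
    by_cases hI : Function.Injective I
    swap
    · exact mn_not_inj _ _ hI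
    by_contra hne
    have h2 := mn_one_le Γ I hne
    have hdiff := Q.Wm_diff A 0 1 I p hp hI0
    set I' := Function.update I p Q.i0 with hI'
    have hinj : Function.Injective I' := by
      intro a b hab
      rw [hI'] at hab
      by_cases ha : a = p <;> by_cases hb : b = p
      · rw [ha, hb]
      · rw [ha, Function.update_self, Function.update_of_ne hb] at hab; exact absurd hab.symm (hI0 b)
      · rw [hb, Function.update_self, Function.update_of_ne ha] at hab; exact absurd hab (hI0 a)
      · rw [Function.update_of_ne ha, Function.update_of_ne hb] at hab; exact hI hab
    have a0 := h0 I' hinj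
    have a1 := h1 I' hinj
    have a2 := hexp I' hinj ⟨p, by simp [hI']⟩
    have a3 := abs_sub (Q.Wm A 1 I') (Q.Wm A 0 I')
    rw [hdiff] at a3
    simp only [sub_zero, one_mul] at a3
    linarith
  have hne := mn_ne_zero A hΓ
  obtain ⟨I0, hI0⟩ := Function.ne_iff.1 hne
  have hI0' : mn A I0 ≠ 0 := hI0
  by_cases hB : ∀ I : Fin d → ι, (∀ p, I p ≠ Q.i0) → mn A I = 0
  · have hp : ∃ p, I0 p = Q.i0 := by
      by_contra hc; push Not at hc; exact hI0' (hB I0 hc)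
    have hinj : Function.Injective I0 := by
      by_contra hc; exact hI0' (mn_not_inj _ _ hc)
    obtain ⟨p, hp⟩ := hp
    have hoth : ∀ k, k ≠ p → I0 k ≠ Q.i0 := fun q hq hc => hq (hinj (hc.trans hp.symm))
    have hz : ∀ j, j ≠ Q.i0 → mn A (Function.update I0 p j) = 0 := by
      intro j hj
      apply hB
      intro q
      by_cases hq : q = p
      · rw [hq, Function.update_self]; exact hj
      · rw [Function.update_of_ne hq]; exact hoth q hq
    have hWI : Q.Wm A 0 I0 = mn A I0 := by
      rw [Q.Wm_expand A 0 I0 p hp hoth, hz _ Q.hne.symm, Finset.sum_eq_single Q.i0, Q.hζ]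
      · rw [← hp, Function.update_eq_self]; ring
      · intro j _ hj; rw [hz j hj]; simp
      · simp
    have a0 := h0 I0 hinj
    rw [hWI] at a0
    have := mn_one_le Γ I0 hI0'
    have := hexp I0 hinj ⟨p, hp⟩
    linarith
  · push Not at hB
    obtain ⟨I, hIi0, hIne⟩ := hB
    have hIi1 : ∀ p, I p ≠ Q.i1 := by
      intro p hp; exact hIne (hz1 I ⟨p, hp⟩ hIi0)
    have hA1 : ∀ J : Fin d → ι, (∃ p, J p = Q.i1) → mn A J = 0 := by
      rintro J ⟨p, hp⟩
      have := mn_plucker A I J p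
      rw [hp] at this
      rw [Finset.sum_eq_zero] at this
      · exact (mul_eq_zero.1 this).resolve_left hIne
      · intro q _
        rw [hz1 _ ⟨q, by simp⟩ ?_, zero_mul]
        intro r
        by_cases hr : r = q
        · rw [hr, Function.update_self]; exact Q.hne.symm
        · rw [Function.update_of_ne hr]; exact hIi0 r
    have hb1 : ∀ j, A j Q.i1 = 0 := by
      intro j
      have := mn_cramer A I Q.i1 j
      rw [Finset.sum_eq_zero] at this
      · exact (mul_eq_zero.1 this).resolve_left hIne
      · intro q _
        rw [hA1 _ ⟨q, by simp⟩, zero_mul]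
    obtain ⟨kk, hk0, hkb⟩ := Q.mink_box hd0 Γ hΓ 0 (fun i => Q.Kx N k m i + m) (fun I hI => (h0 I hI).le)
    obtain ⟨i, hi⟩ := hgen t (ht0.trans htge) _ hk0 (by
      apply Finset.sum_eq_zero
      intro j _
      have : ((Γ j Q.i1 : ℤ) : ℝ) = 0 := hb1 j
      have h2 : Γ j Q.i1 = 0 := by exact_mod_cast this
      rw [h2, mul_zero])
    have h3 := hkb i
    have h4 : (2 * d : ℝ) ≤ 2 ^ (m:ℝ) := by
      rw [Real.rpow_natCast]
      have : d ≤ D := hdc.le.trans hD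
      have h5 : 2 * d ≤ 2 ^ m := by
        calc 2 * d ≤ 2 * 2 ^ D := by
              have := (Nat.lt_two_pow_self (n := D)).le; omega
          _ = 2 ^ (D+1) := by ring
          _ ≤ 2 ^ m := Nat.pow_le_pow_right (by norm_num) hm
      exact_mod_cast h5
    have h5 : (2 * d : ℝ) * 2 ^ (Q.Kx N k m i + m) ≤ 2 ^ ((Q.ρ i + γ) * t) := by
      calc (2 * d : ℝ) * 2 ^ (Q.Kx N k m i + m) ≤ 2 ^ (m:ℝ) * 2 ^ (Q.Kx N k m i + m) := by gcongr
        _ = 2 ^ (m + (Q.Kx N k m i + m)) := by rw [← Real.rpow_add (by norm_num)]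
        _ ≤ _ := by
          apply Real.rpow_le_rpow_of_exponent_le (by norm_num)
          unfold Kx
          rw [← ht]
          have e : (4:ℝ) * m ≤ γ * t := by
            calc (4:ℝ) * m = 8 * m / 2 := by ring
              _ ≤ (g * γ) * m / 2 := by gcongr
              _ = γ * (g * m / 2) := by ring
              _ ≤ _ := by gcongr
          have : 0 ≤ (N:ℝ) * m := by positivity
          split_ifs <;> nlinarith
    linarith

end CD

set_option linter.unusedSectionVars false

namespace CD
variable {ι : Type} [Fintype ι] [DecidableEq ι] (Q : CD ι)

lemma two_d_le {d D m : ℕ} (hd : d ≤ D) (hm : D + 1 ≤ m) : (2 * d : ℝ) ≤ 2 ^ (m:ℝ) := by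
  rw [Real.rpow_natCast]
  have h5 : 2 * d ≤ 2 ^ m := by
    calc 2 * d ≤ 2 * 2 ^ D := by
          have := (Nat.lt_two_pow_self (n := D)).le; omega
      _ = 2 ^ (D+1) := by ring
      _ ≤ 2 ^ m := Nat.pow_le_pow_right (by norm_num) hm
  exact_mod_cast h5

/-- producing a point of `Bset` from minors -/
lemma mem_Bset_of_minors {d : ℕ} (hd0 : 0 < d) (Γ : Fin d → ι → ℤ)
    (hΓ : LinearIndependent ℝ (fun j i => (Γ j i : ℝ)))
    (N k m M D : ℕ) (hdD : d ≤ D) (hm : D + 1 ≤ M) (x : ℝ)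
    (hW : ∀ I : Fin d → ι, Function.Injective I →
      |Q.Wm (fun j i => (Γ j i : ℝ)) x I| ≤ 2 ^ (∑ p, (Q.Kx N k m (I p) - M))) :
    x ∈ Q.Bset N k m := by
  obtain ⟨kk, h0, h1⟩ := Q.mink_box hd0 Γ hΓ x (fun i => Q.Kx N k m i - M) hW
  refine ⟨_, h0, fun i => (h1 i).trans ?_⟩
  calc (2 * d : ℝ) * 2 ^ (Q.Kx N k m i - M) ≤ 2 ^ (M:ℝ) * 2 ^ (Q.Kx N k m i - M) := by
        gcongr; exact two_d_le hdD hm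
    _ = 2 ^ Q.Kx N k m i := by rw [← Real.rpow_add (by norm_num)]; congr 1; ring

/-- non-root case -/
lemma no_small_nonroot {d : ℕ} (hd0 : 0 < d) (Γ : Fin d → ι → ℤ)
    (hΓ : LinearIndependent ℝ (fun j i => (Γ j i : ℝ)))
    (N k m D g q Ac : ℕ) (hD : Fintype.card ι ≤ D) (hN : N = 3 * D) (hm : D + 1 ≤ m)
    (hq : 4 * D ≤ q * Q.τ)
    (hA : 2 * g + N + 2 + q + 2 * (N + 2 + 2 * D + q + 1) ≤ Ac) (hk : Ac * m ≤ k)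
    (a H x0 : ℝ) (hH : H = 2 ^ (-((k:ℝ) - Ac * m)))
    (hx0 : ∀ k' m', k' < k → m ≤ m' → g * m' ≤ k' → x0 ∉ Q.Bset N k' m')
    (hx : ∀ I, Function.Injective I → |Q.Wm (fun j i => (Γ j i : ℝ)) x0 I| ≤ 2 ^ (∑ p, (Q.Kx N k m (I p) + m)))
    (h0 : ∀ I, Function.Injective I → |Q.Wm (fun j i => (Γ j i : ℝ)) a I| < 2 ^ (∑ p, (Q.Kx N k m (I p) + m)))
    (h1 : ∀ I, Function.Injective I → |Q.Wm (fun j i => (Γ j i : ℝ)) (a+H) I| < 2 ^ (∑ p, (Q.Kx N k m (I p) + m))) :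
    False := by
  have hdc := Q.not_full Γ hΓ a N k m D hD hN h0
  have hdD : d ≤ D := hdc.le.trans hD
  set A : Fin d → ι → ℝ := fun j i => (Γ j i : ℝ) with hA'
  set θ : (Fin d → ι) → ℝ := fun I => ∑ p, (Q.Kx N k m (I p) + m) with hθ
  have hm0 : (0:ℝ) < m := by have : 0 < m := by omega
                             exact_mod_cast this
  have hDm : (D:ℝ) + 1 ≤ m := by exact_mod_cast hm
  have hkr : (Ac:ℝ) * m ≤ k := by exact_mod_cast hk
  have hAr : 2 * (g:ℝ) + N + 2 + q + 2 * (N + 2 + 2 * D + q + 1) ≤ Ac := by exact_mod_cast hA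
  have hθpos : ∀ I, (0:ℝ) < 2 ^ θ I := fun I => by positivity
  have hx' : ∀ I, |Q.Wm A x0 I| ≤ 2 ^ θ I := by
    intro I
    by_cases hI : Function.Injective I
    · exact hx I hI
    · have : Q.Wm A x0 I = 0 := mn_not_inj _ _ hI
      rw [this, abs_zero]; exact (hθpos I).le
  -- replace one index
  have hθup : ∀ (I : Fin d → ι) p i, θ (Function.update I p i) = θ I - Q.Kx N k m (I p) + Q.Kx N k m i := by
    intro I p i
    have e1 : ∀ J : Fin d → ι, θ J = (Q.Kx N k m (J p) + m) + ∑ r ∈ Finset.univ.erase p, (Q.Kx N k m (J r) + m) := by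
      intro J; exact (Finset.add_sum_erase _ (fun r => Q.Kx N k m (J r) + (m:ℝ)) (Finset.mem_univ p)).symm
    rw [e1, e1 I, Function.update_self]
    have : ∑ r ∈ Finset.univ.erase p, (Q.Kx N k m (Function.update I p i r) + (m:ℝ)) = ∑ r ∈ Finset.univ.erase p, (Q.Kx N k m (I r) + m) := by
      apply Finset.sum_congr rfl
      intro r hr
      rw [Function.update_of_ne (Finset.ne_of_mem_erase hr)]
    rw [this]; ring
  -- minors containing i1 and not i0
  have hs1 : ∀ I : Fin d → ι, (∃ p, I p = Q.i1) → (∀ p, I p ≠ Q.i0) →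
      |Q.Wm A x0 I| ≤ 2 ^ (1 - (Ac:ℝ) * m) * 2 ^ θ I := by
    rintro I ⟨p, hp⟩ hI0
    by_cases hI : Function.Injective I
    swap
    · have : Q.Wm A x0 I = 0 := mn_not_inj _ _ hI
      rw [this, abs_zero]; positivity
    rw [Q.Wm_of_notMem A x0 I hI0]
    have hdiff := Q.Wm_diff A a (a+H) I p hp hI0
    set I' := Function.update I p Q.i0 with hI'
    have hinj : Function.Injective I' := by
      intro a b hab
      rw [hI'] at hab
      by_cases ha : a = p <;> by_cases hb : b = p
      · rw [ha, hb]
      · rw [ha, Function.update_self, Function.update_of_ne hb] at hab; exact absurd hab.symm (hI0 b)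
      · rw [hb, Function.update_self, Function.update_of_ne ha] at hab; exact absurd hab (hI0 a)
      · rw [Function.update_of_ne ha, Function.update_of_ne hb] at hab; exact hI hab
    have a0 : |Q.Wm A a I'| < 2 ^ θ I' := h0 I' hinj
    have a1 : |Q.Wm A (a+H) I'| < 2 ^ θ I' := h1 I' hinj
    have a3 := abs_sub (Q.Wm A (a+H) I') (Q.Wm A a I')
    have hHabs : |H| = 2 ^ (-((k:ℝ) - Ac * m)) := by rw [hH, abs_of_pos (by positivity)]
    rw [hdiff, abs_mul, add_sub_cancel_left, hHabs] at a3
    have a4 : θ I' = θ I - k := by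
      rw [hI', hθup, hp, ← Q.Kx_div N k m]; ring
    rw [a4] at a0 a1
    have a5 : (2:ℝ) ^ (-((k:ℝ) - Ac * m)) * |mn A I| ≤ 2 ^ (1 + (θ I - k)) := by
      rw [Real.rpow_add (by norm_num), Real.rpow_one]; linarith
    have a6 : |mn A I| = 2 ^ ((k:ℝ) - Ac * m) * (2 ^ (-((k:ℝ) - Ac * m)) * |mn A I|) := by
      rw [← mul_assoc, ← Real.rpow_add (by norm_num), add_neg_cancel, Real.rpow_zero, one_mul]
    rw [a6]
    calc (2:ℝ) ^ ((k:ℝ) - Ac * m) * (2 ^ (-((k:ℝ) - Ac * m)) * |mn A I|)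
        ≤ 2 ^ ((k:ℝ) - Ac * m) * 2 ^ (1 + (θ I - k)) := by gcongr
      _ = 2 ^ (1 - (Ac:ℝ) * m) * 2 ^ θ I := by
        rw [← Real.rpow_add (by norm_num), ← Real.rpow_add (by norm_num)]; congr 1; ring
  set σ : ℝ := (D + 1 - Ac * m) / 2 with hσ
  have hAm : (0:ℝ) ≤ Ac * m := by positivity
  have hσ1 : 1 - (Ac:ℝ) * m ≤ σ := by
    have : (1:ℝ) ≤ D := by exact_mod_cast hd0.trans_le hdD
    rw [hσ]; linarith
  have hs1' : ∀ I : Fin d → ι, (∃ p, I p = Q.i1) → (∀ p, I p ≠ Q.i0) →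
      |Q.Wm A x0 I| ≤ 2 ^ σ * 2 ^ θ I := by
    intro I h h'
    refine (hs1 I h h').trans ?_
    gcongr
    norm_num
  -- final exponent estimate for sigma
  have hσ2 : σ ≤ -((N + 2 + 2 * D + q) * m) := by
    have : 2 * ((N:ℝ) + 2 + 2 * D + q + 1) * m ≤ Ac * m := by
      gcongr
      have : (0:ℝ) ≤ g := by positivity
      have : (0:ℝ) ≤ N := by positivity
      have : (0:ℝ) ≤ q := by positivity
      linarith
    rw [hσ]; linarith
  by_cases hB : ∀ I : Fin d → ι, (∀ p, I p ≠ Q.i0) → |Q.Wm A x0 I| ≤ 2 ^ σ * 2 ^ θ I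
  · -- case B
    have hkq : g * m ≤ k - q * m := by
      have : (g + q) * m ≤ Ac * m := Nat.mul_le_mul_right _ (by omega)
      rw [add_mul] at this
      omega
    have hq0 : 0 < q := by
      by_contra hc
      have : q = 0 := by omega
      rw [this] at hq
      have : (1:ℝ) ≤ D := by exact_mod_cast hd0.trans_le hdD
      simp at hq
      linarith
    have hqm : q * m ≤ k := by
      have : (g + q) * m ≤ Ac * m := Nat.mul_le_mul_right _ (by omega)
      rw [add_mul] at this
      omega
    refine hx0 (k - q * m) m ?_ le_rfl hkq ?_
    · have : 0 < q * m := Nat.mul_pos hq0 (by omega)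
      omega
    set z : ℝ := q * m / (1 + Q.ρ Q.i1) with hz
    have hr1 := Q.rho1_pos
    have hr2 := Q.rho1_le
    have hz1 : z ≤ q * m := by
      rw [hz, div_le_iff₀ (by linarith)]
      have : (0:ℝ) ≤ q * m := by positivity
      nlinarith
    have hz2 : 2 * D * m ≤ Q.τ * z := by
      rw [hz, mul_div_assoc', le_div_iff₀ (by linarith)]
      have e1 : 4 * D * (m:ℝ) ≤ q * Q.τ * m := by gcongr
      have e2 : (0:ℝ) ≤ 2 * D * m := by positivity
      nlinarith
    have hKx : ∀ i, Q.Kx N (k - q * m) m i = Q.Kx N k m i - Q.ρ i * z := by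
      intro i
      unfold Kx tt
      rw [Nat.cast_sub hqm, hz]
      push_cast
      ring
    apply Q.mem_Bset_of_minors hd0 Γ hΓ N (k - q*m) m m D hdD hm
    intro I hI
    have hsum : ∑ p, (Q.Kx N (k - q * m) m (I p) - m) = θ I - (∑ p, Q.ρ (I p)) * z - 2 * d * m := by
      rw [hθ, Finset.sum_mul]
      simp only [hKx, Finset.sum_sub_distrib, Finset.sum_add_distrib]
      simp
      ring
    rw [hsum]
    have hdm : 2 * (d:ℝ) * m ≤ 2 * D * m := by gcongr
    have hz0 : 0 ≤ z := by rw [hz]; positivity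
    by_cases hp : ∃ p, I p = Q.i0
    · refine (hx' I).trans (Real.rpow_le_rpow_of_exponent_le (by norm_num) ?_)
      have := Q.rho_neg I hI hp (exists_not_range hdc I)
      have e3 : (∑ p, Q.ρ (I p)) * z ≤ -Q.τ * z := by gcongr
      linarith
    · push Not at hp
      refine (hB I hp).trans ?_
      rw [← Real.rpow_add (by norm_num)]
      refine Real.rpow_le_rpow_of_exponent_le (by norm_num) ?_
      have := Q.rho_le_one I hI hp
      have e3 : (∑ p, Q.ρ (I p)) * z ≤ 1 * z := by gcongr
      have e4 : (0:ℝ) ≤ N * m := by positivity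
      nlinarith
  · push Not at hB
    obtain ⟨I, hI0, hIbig⟩ := hB
    have hI1 : ∀ p, I p ≠ Q.i1 := by
      intro p hp
      have := hs1' I ⟨p, hp⟩ hI0
      linarith
    -- case A
    have hAJ : ∀ J : Fin d → ι, (∃ p, J p = Q.i1) → |Q.Wm A x0 J| ≤ 2 ^ σ * 2 ^ θ J := by
      rintro J ⟨p, hp⟩
      have hpl := mn_plucker (fun j => Q.co x0 (A j)) I J p
      have hb : |Q.Wm A x0 I * Q.Wm A x0 J| ≤ d * (2 ^ (1 - (Ac:ℝ) * m) * (2 ^ θ I * 2 ^ θ J)) := by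
        have : Q.Wm A x0 I * Q.Wm A x0 J = _ := hpl
        rw [this]
        refine (Finset.abs_sum_le_sum_abs _ _).trans ?_
        calc _ ≤ ∑ r : Fin d, (2 ^ (1 - (Ac:ℝ) * m) * ((2:ℝ) ^ θ I * 2 ^ θ J)) := by
              apply Finset.sum_le_sum
              intro r _
              rw [abs_mul]
              have b1 := hs1 (Function.update I r (J p)) ⟨r, by simp [hp]⟩ (by
                intro s
                by_cases hs : s = r
                · rw [hs, Function.update_self, hp]; exact Q.hne.symm
                · rw [Function.update_of_ne hs]; exact hI0 s)
              have b2 := hx' (Function.update J p (I r))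
              have b3 : |mn (fun j => Q.co x0 (A j)) (Function.update I r (J p))| * |mn (fun j => Q.co x0 (A j)) (Function.update J p (I r))| ≤ (2 ^ (1 - (Ac:ℝ) * m) * 2 ^ θ (Function.update I r (J p))) * 2 ^ θ (Function.update J p (I r)) := by
                apply mul_le_mul b1 b2 (abs_nonneg _) (by positivity)
              refine b3.trans (le_of_eq ?_)
              rw [mul_assoc]
              congr 1
              rw [← Real.rpow_add (by norm_num), ← Real.rpow_add (by norm_num), hθup, hθup]
              congr 1
              ring
          _ = _ := by simp
      by_contra hc
      push Not at hc
      rw [abs_mul] at hb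
      have c1 : (2 ^ σ * 2 ^ θ I) * (2 ^ σ * 2 ^ θ J) < |Q.Wm A x0 I| * |Q.Wm A x0 J| := by
        apply mul_lt_mul'' hIbig hc <;> positivity
      have c2 : (2 ^ σ * 2 ^ θ I) * (2 ^ σ * 2 ^ θ J) = (2:ℝ) ^ (2 * σ) * (2 ^ θ I * 2 ^ θ J) := by
        rw [two_mul, Real.rpow_add (by norm_num)]; ring
      have c3 : (d:ℝ) * 2 ^ (1 - (Ac:ℝ) * m) ≤ 2 ^ (2 * σ) := by
        have e : 2 * σ = D + (1 - (Ac:ℝ) * m) := by rw [hσ]; ring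
        rw [e, Real.rpow_add (by norm_num)]
        gcongr
        rw [Real.rpow_natCast]
        exact_mod_cast hdD.trans (Nat.lt_two_pow_self (n := D)).le
      have c4 : (d:ℝ) * (2 ^ (1 - (Ac:ℝ) * m) * (2 ^ θ I * 2 ^ θ J)) ≤ 2 ^ (2 * σ) * (2 ^ θ I * 2 ^ θ J) := by
        rw [← mul_assoc]; gcongr
      linarith
    have hNm : (2 * g + (N + 2)) * m ≤ k := (Nat.mul_le_mul_right _ (by omega)).trans hk
    have hNm' : (N + 2) * m ≤ k := (Nat.mul_le_mul_right _ (by omega)).trans hk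
    refine hx0 (k - (N+2) * m) (2 * m) ?_ (by omega) ?_ ?_
    · have : 0 < (N + 2) * m := Nat.mul_pos (by omega) (by omega)
      omega
    · rw [add_mul] at hNm
      have : g * (2 * m) = 2 * g * m := by ring
      omega
    have hKx : ∀ i, Q.Kx N (k - (N+2) * m) (2*m) i - (m:ℕ) = (Q.Kx N k m i + m) + (if i = Q.i1 then -(((N:ℝ) + 2) * m) else 0) - 0 := by
      intro i
      unfold Kx tt
      rw [Nat.cast_sub hNm']
      push_cast
      have e : (k:ℝ) - (N + 2) * m + (N+2) * (2 * m) = k + (N + 2) * m := by ring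
      rw [e]
      split_ifs <;> ring
    apply Q.mem_Bset_of_minors hd0 Γ hΓ N (k - (N+2)*m) (2*m) m D hdD hm
    intro J hJ
    have hsum : ∑ p, (Q.Kx N (k - (N+2) * m) (2*m) (J p) - (m:ℕ)) = θ J + ∑ p, (if J p = Q.i1 then -(((N:ℝ) + 2) * m) else 0) := by
      rw [hθ, ← Finset.sum_add_distrib]
      apply Finset.sum_congr rfl
      intro p _
      rw [hKx, sub_zero]
    rw [hsum]
    by_cases hp : ∃ p, J p = Q.i1
    · refine (hAJ J hp).trans ?_
      rw [← Real.rpow_add (by norm_num)]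
      refine Real.rpow_le_rpow_of_exponent_le (by norm_num) ?_
      obtain ⟨p, hp⟩ := hp
      rw [Finset.sum_eq_single p, if_pos hp]
      · have e4 : (0:ℝ) ≤ q * m := by positivity
        have e5 : (0:ℝ) ≤ D * m := by positivity
        nlinarith
      · intro r _ hr
        rw [if_neg]
        intro hc
        exact hr (hJ (hc.trans hp.symm))
      · simp
    · push Not at hp
      rw [Finset.sum_eq_zero fun p _ => if_neg (hp p), add_zero]
      exact hx' J

end CD

set_option linter.unusedSectionVars false

namespace CD
variable {ι : Type} [Fintype ι] [DecidableEq ι] (Q : CD ι)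

lemma Ls_affine (T : ι → ℝ) (d : ℕ) (A : Fin d → ι → ℝ) :
    ∃ u v, ∀ x, mn (fun j => Q.Ls T x (A j)) = u + x • v := by
  refine mn_affine Q.i0 (fun x b => Q.Ls T x b) (fun b => (∑ j, Q.ζ j * b j) / T Q.i0) (fun b => b Q.i1 / T Q.i0)
    (fun b i => b i / T i) ?_ A
  intro x b i
  by_cases h : i = Q.i0
  · subst h
    simp only [Ls, LinearMap.coe_mk, AddHom.coe_mk, co_i0, if_true]
    ring
  · simp [Ls, Q.co_ne x b h, h]

lemma Wm_of_psi {d : ℕ} (θ : ι → ℝ) (x : ℝ) (A : Fin d → ι → ℝ) (I : Fin d → ι) :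
    |Q.Wm A x I| ≤ psiN (Q.Ls (fun i => 2 ^ θ i) x) A * 2 ^ (∑ p, θ (I p)) := by
  have h1 := norm_le_pi_norm (mn (fun j => Q.Ls (fun i => 2 ^ θ i) x (A j))) I
  rw [mn_Ls, Real.norm_eq_abs, abs_mul, abs_inv, abs_of_pos (by positivity), inv_mul_le_iff₀ (by positivity),
    ← Real.rpow_sum_of_pos (by norm_num), mul_comm] at h1
  exact h1

theorem core (D : ℕ) (τ γ : ℝ) (hτ : 0 < τ) (hγ : 0 < γ) : ∃ Ac g : ℕ, 0 < g ∧ g ≤ Ac ∧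
    ∀ (ι : Type) [Fintype ι] [DecidableEq ι] (Q : CD ι), Fintype.card ι ≤ D → τ ≤ Q.τ →
    ∀ t0, Q.Gen γ t0 → ∃ m0 : ℕ, ∀ m, m0 ≤ m → ∀ k, g * m ≤ k → ∀ a H : ℝ,
    ((Ac * m ≤ k ∧ H = 2 ^ (-((k:ℝ) - Ac * m))) ∨ (a = 0 ∧ H = 1)) →
    (∃ x0 ∈ Set.Icc a (a+H), ∀ k' m', k' < k → m ≤ m' → g * m' ≤ k' → x0 ∉ Q.Bset (3*D) k' m') →
    volume {x | x ∈ Set.Ico a (a+H) ∧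
      ∃ b : ι → ℤ, b ≠ 0 ∧ ∀ i, |Q.co x (fun i => (b i : ℝ)) i| ≤ 2 * 2 ^ Q.Kx (3*D) k m i} ≤
      ENNReal.ofReal ((48 * (D+1)^2 * 3^(D+1)) * 2 ^ (-(m:ℝ)) * H) := by
  obtain ⟨q, hq⟩ := exists_nat_ge (4 * D / τ)
  obtain ⟨g1, hg1⟩ := exists_nat_ge (2 * (3 * D + 2) / τ)
  obtain ⟨g2, hg2⟩ := exists_nat_ge (8 / γ)
  rw [div_le_iff₀ hτ] at hq hg1
  rw [div_le_iff₀ hγ] at hg2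
  set g := g1 + g2 + 1 with hg
  set N := 3 * D with hN
  refine ⟨2 * g + N + 2 + q + 2 * (N + 2 + 2 * D + q + 1), g, by omega, by omega, ?_⟩
  set Ac := 2 * g + N + 2 + q + 2 * (N + 2 + 2 * D + q + 1) with hAc
  intro ι _ _ Q hD hQτ t0 hgen
  obtain ⟨M, hM⟩ := exists_nat_ge (2 * t0)
  refine ⟨M + D + 1, ?_⟩
  intro m hm k hk a H haH hx0
  have hHpos : 0 < H := by
    rcases haH with ⟨_, h⟩ | ⟨_, h⟩ <;> rw [h] <;> positivity
  set θ : ι → ℝ := fun i => Q.Kx N k m i + m with hθ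
  set L := Q.Ls (fun i => 2 ^ θ i) with hL
  set Λ : Set (ι → ℝ) := {b | ∃ z : ι → ℤ, b = fun i => (z i : ℝ)} with hΛ
  have hbig : ∀ d, 0 < d → ∀ A' : Fin d → ι → ℝ, TupN Λ A' →
      1 ≤ psiN (L a) A' ∨ 1 ≤ psiN (L (a+H)) A' := by
    intro d hd A' hT
    by_contra hcon
    push Not at hcon
    obtain ⟨c1, c2⟩ := hcon
    obtain ⟨hz, hli⟩ := hT
    choose Γ hΓ using hz
    have hA' : A' = fun j i => (Γ j i : ℝ) := by ext j i; rw [hΓ j]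
    rw [hA'] at c1 c2 hli
    have b0 : ∀ y, psiN (L y) (fun j i => (Γ j i : ℝ)) < 1 → ∀ I : Fin d → ι, Function.Injective I →
        |Q.Wm (fun j i => (Γ j i : ℝ)) y I| < 2 ^ (∑ p, (Q.Kx N k m (I p) + m)) := by
      intro y hy I _
      refine (Q.Wm_of_psi θ y _ I).trans_lt ?_
      have : (0:ℝ) < 2 ^ (∑ p, θ (I p)) := by positivity
      exact mul_lt_of_lt_one_left this hy
    rcases haH with ⟨hAk, hH⟩ | ⟨ha, hH⟩
    · obtain ⟨x0, hx0m, hx0⟩ := hx0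
      refine Q.no_small_nonroot hd Γ hli N k m D g q Ac hD hN (by omega) ?_ le_rfl hAk a H x0 hH hx0 ?_ (b0 _ c1) (b0 _ c2)
      · exact hq.trans (by gcongr)
      · intro I _
        refine (Q.Wm_of_psi θ x0 _ I).trans ?_
        obtain ⟨u, v, huv⟩ := Q.Ls_affine (fun i => 2 ^ θ i) d (fun j i => (Γ j i : ℝ))
        have hle : psiN (L x0) (fun j i => (Γ j i : ℝ)) ≤ 1 := by
          unfold psiN at c1 c2 ⊢
          rw [hL, huv] at c1 c2 ⊢
          exact psi_convex u v a H 1 x0 hHpos c1.le c2.le hx0m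
        have : (0:ℝ) < 2 ^ (∑ p, θ (I p)) := by positivity
        exact mul_le_of_le_one_left this.le hle
    · rw [ha] at c1
      rw [ha, hH, zero_add] at c2
      refine Q.no_small_root hd Γ hli N k m D g γ t0 hD hN (by omega) hgen ?_ ?_ ?_ hγ hk (b0 _ c1) (b0 _ c2)
      · have h1 : (1:ℝ) ≤ g := by rw [hg]; push_cast; linarith [(Nat.cast_nonneg g1 : (0:ℝ) ≤ g1), (Nat.cast_nonneg g2 : (0:ℝ) ≤ g2)]
        have h2 : (M:ℝ) ≤ m := by exact_mod_cast (by omega : M ≤ m)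
        have h3 : (m:ℝ) ≤ g * m := le_mul_of_one_le_left (by positivity) h1
        linarith
      · refine hg1.trans ?_
        have : (g1:ℝ) ≤ g := by exact_mod_cast (by omega : g1 ≤ g)
        gcongr
      · refine hg2.trans ?_
        have : (g2:ℝ) ≤ g := by exact_mod_cast (by omega : g2 ≤ g)
        gcongr
  have hq := qnd (Fintype.card ι) rfl L (fun d A => Q.Ls_affine _ d A) Λ (2 ^ (2 - (m:ℝ))) (by positivity) a H hHpos hbig
  refine (measure_mono ?_).trans (hq.trans ?_)
  · rintro x ⟨hx, b, hb0, hb⟩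
    refine ⟨hx, fun i => (b i : ℝ), ⟨b, rfl⟩, ?_, ?_⟩
    · intro h
      apply hb0
      ext i
      have : ((b i : ℤ) : ℝ) = 0 := congrFun h i
      simpa using this
    · have hle : ‖L x (fun i => (b i : ℝ))‖ ≤ 2 ^ (1 - (m:ℝ)) := by
        rw [pi_norm_le_iff_of_nonneg (by positivity)]
        intro i
        have e : L x (fun i => (b i : ℝ)) i = Q.co x (fun i => (b i : ℝ)) i / 2 ^ θ i := rfl
        rw [e, Real.norm_eq_abs, abs_div, abs_of_pos (by positivity : (0:ℝ) < 2 ^ θ i), div_le_iff₀ (by positivity)]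
        refine (hb i).trans (le_of_eq ?_)
        rw [← Real.rpow_add (by norm_num), hθ]
        nth_rewrite 1 [← Real.rpow_one 2]
        rw [← Real.rpow_add (by norm_num)]
        congr 1; ring
      refine hle.trans_lt ?_
      exact Real.rpow_lt_rpow_of_exponent_lt (by norm_num) (by linarith)
  · apply ENNReal.ofReal_le_ofReal
    have hc : (Fintype.card ι : ℝ) ≤ D := by exact_mod_cast hD
    rw [Real.rpow_sub (by norm_num), Real.rpow_neg (by norm_num)]
    have : (12 * ((Fintype.card ι:ℝ)+1)^2 * 3^(Fintype.card ι+1)) ≤ 12 * ((D:ℝ)+1)^2 * 3^(D+1) := by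
      gcongr
      norm_num
    calc _ ≤ (12 * ((D:ℝ)+1)^2 * 3^(D+1)) * (2 ^ (2:ℝ) / 2 ^ (m:ℝ)) * H := by gcongr
      _ = _ := by
        have : (2:ℝ)^(2:ℝ) = 4 := by norm_num
        rw [this]; field_simp; norm_num

end CD

section Cantor

/-- growth of the number of survivors -/
lemma growth (f : ℕ → ℝ) (lam : ℝ) (Ac ms : ℕ) (e v : ℕ → ℝ) (h1 : 1 ≤ lam) (h2 : lam ≤ 2)
    (hA : 1 ≤ Ac) (hms : 1 ≤ ms) (hω : (2 / lam) ^ Ac ≤ 3/2) (he : ∀ m, 0 ≤ e m) (f0 : f 0 = 1) (hf : ∀ k, 0 ≤ f k)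
    (hsum : ∀ K, ∑ m ∈ Finset.Icc ms K, e m * (3/2)^m * lam ≤ (2 - lam)/2)
    (hv : ∀ k, v (k+1) ≤ (2 - lam)/2 * lam^k)
    (hrec : ∀ k, 2 * f k - ∑ m ∈ Finset.Icc ms (k+1), e m * 2 ^ (min (k+1) (Ac*m)) * f (k + 1 - min (k+1) (Ac * m)) - v (k+1)
      ≤ f (k+1)) :
    ∀ k, lam * f k ≤ f (k+1) := by
  intro k
  induction k using Nat.strong_induction_on with
  | _ k ih =>
  have hlam : 0 < lam := by linarith
  have hback : ∀ p, p ≤ k → lam ^ p * f (k - p) ≤ f k := by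
    intro p
    induction p with
    | zero => intro _; simp
    | succ p ihp =>
      intro hp
      have := ih (k - (p+1)) (by omega)
      have e1 : k - (p+1) + 1 = k - p := by omega
      rw [e1] at this
      refine le_trans ?_ (ihp (by omega))
      rw [pow_succ, mul_assoc]
      gcongr
  have hk1 : lam ^ k ≤ f k := by
    have := hback k le_rfl
    simpa [f0] using this
  have hq : 1 ≤ 2 / lam := by rw [le_div_iff₀ hlam]; linarith
  have hterm : ∀ m ∈ Finset.Icc ms (k+1), e m * 2 ^ (min (k+1) (Ac*m)) * f (k + 1 - min (k+1) (Ac * m)) ≤ (e m * (3/2)^m * lam) * f k := by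
    intro m hm
    rw [Finset.mem_Icc] at hm
    set p := min (k+1) (Ac*m) with hp
    have hp1 : 1 ≤ p := by
      rw [hp, le_min_iff]
      exact ⟨by omega, Nat.mul_pos hA (by omega)⟩
    have hpk : p ≤ k + 1 := min_le_left _ _
    have hpA : p ≤ Ac * m := min_le_right _ _
    obtain ⟨r, hr⟩ : ∃ r, p = r + 1 := ⟨p - 1, by omega⟩
    have h3 := hback r (by omega)
    have e2 : k + 1 - p = k - r := by omega
    rw [e2]
    have h4 : 2 ^ p = (2/lam)^p * (lam * lam ^ r) := by
      rw [hr, div_pow, ← pow_succ']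
      field_simp
    have h5 : (2/lam)^p ≤ (3/2)^m := by
      calc (2/lam)^p ≤ (2/lam)^(Ac*m) := pow_le_pow_right₀ hq hpA
        _ = ((2/lam)^Ac)^m := by rw [pow_mul]
        _ ≤ _ := by gcongr
    calc e m * 2 ^ p * f (k - r) = e m * (2/lam)^p * lam * (lam^r * f (k-r)) := by rw [h4]; ring
      _ ≤ e m * (3/2)^m * lam * f k := by
        have := he m
        have := hf (k - r)
        gcongr
  have hS := Finset.sum_le_sum hterm
  rw [← Finset.sum_mul] at hS
  have h6 := hrec k
  have h7 := hv k
  have h8 : (∑ m ∈ Finset.Icc ms (k+1), e m * (3/2)^m * lam) * f k ≤ (2-lam)/2 * f k := by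
    gcongr
    · exact hf k
    · exact hsum _
  have h9 : (2 - lam)/2 * lam^k ≤ (2-lam)/2 * f k := by
    have : 0 ≤ (2 - lam)/2 := by linarith
    gcongr
  linarith

/-- closed dyadic interval -/
def dyI (k i : ℕ) : Set ℝ := Set.Icc ((i:ℝ) / 2^k) (((i:ℝ)+1) / 2^k)

lemma dyI_parent (k i : ℕ) : dyI (k+1) i ⊆ dyI k (i/2) := by
  intro x hx
  unfold dyI at *
  have h1 : 2 * (i/2) ≤ i := by omega
  have h2 : i + 1 ≤ 2 * (i/2 + 1) := by omega
  have h1' : 2 * ((i/2:ℕ):ℝ) ≤ i := by exact_mod_cast h1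
  have h2' : (i:ℝ) + 1 ≤ 2 * (((i/2:ℕ):ℝ) + 1) := by exact_mod_cast h2
  constructor
  · refine le_trans ?_ hx.1
    rw [pow_succ, div_le_div_iff₀ (by positivity) (by positivity)]
    have : (0:ℝ) < 2^k := by positivity
    nlinarith
  · refine hx.2.trans ?_
    rw [pow_succ, div_le_div_iff₀ (by positivity) (by positivity)]
    have : (0:ℝ) < 2^k := by positivity
    nlinarith

lemma dyI_anc (k p i : ℕ) : dyI (k+p) i ⊆ dyI k (i/2^p) := by
  induction p generalizing i with
  | zero => simp
  | succ p ih =>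
    refine (dyI_parent (k+p) i).trans ((ih (i/2)).trans ?_)
    rw [Nat.div_div_eq_div_mul, pow_succ, mul_comm]

open Classical in
/-- survivors -/
noncomputable def surv (P : ℕ → ℕ → Prop) (R : ℕ → Finset ℕ) : ℕ → Finset ℕ
  | 0 => {0}
  | k+1 => (Finset.range (2^(k+1))).filter (fun i => i/2 ∈ surv P R k ∧ ¬ P (k+1) i ∧ i ∉ R (k+1))

lemma surv_anc (P : ℕ → ℕ → Prop) (R : ℕ → Finset ℕ) (k p i : ℕ) (h : i ∈ surv P R (k+p)) :
    i / 2^p ∈ surv P R k := by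
  induction p generalizing i with
  | zero => simpa using h
  | succ p ih =>
    have : i ∈ surv P R (k+p+1) := h
    simp only [surv, Finset.mem_filter] at this
    have := ih (i/2) this.2.1
    rwa [Nat.div_div_eq_div_mul, ← pow_succ'] at this

lemma surv_lt (P : ℕ → ℕ → Prop) (R : ℕ → Finset ℕ) (k i : ℕ) (h : i ∈ surv P R k) : i < 2^k := by
  cases k with
  | zero => simp [surv] at h; simp [h]
  | succ k => simp only [surv, Finset.mem_filter, Finset.mem_range] at h; exact h.1

theorem cantor (B : ℕ → ℕ → ℕ → Set ℝ) (m0 : ℕ → ℕ) (g Ac ms : ℕ) (hg : 1 ≤ g) (hA : 1 ≤ Ac) (hms : 1 ≤ ms)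
    (C lam : ℝ) (hC : 0 ≤ C) (h1 : 1 ≤ lam) (h2 : lam ≤ 2) (hω : (2 / lam) ^ Ac ≤ 3/2)
    (hm0 : ∀ j, j ≤ m0 j ∧ ms ≤ m0 j)
    (hsum : ∀ K, ∑ m ∈ Finset.Icc ms K, ((m+1) * (C * (1/2)^m)) * (3/2)^m * lam ≤ (2 - lam)/2)
    (R : ℕ → Finset ℕ) (hR : ∀ k, ((R (k+1)).card : ℝ) ≤ (2 - lam)/2 * lam^k)
    (hB : ∀ j m k, m0 j ≤ m → g * m ≤ k → ∀ l p, k = l + p → (p = Ac * m ∨ l = 0) → ∀ c < 2^l,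
      (∃ x0 ∈ dyI l c, ∀ k' m', k' < k → m ≤ m' → g * m' ≤ k' → x0 ∉ B j k' m') →
      ∀ T : Finset ℕ, (∀ i ∈ T, i / 2^p = c ∧ (dyI k i ∩ B j k m).Nonempty) →
        (T.card : ℝ) ≤ C * (1/2)^m * 2^p) :
    ∃ x : ℝ, x ∈ Set.Icc (0:ℝ) 1 ∧ (∀ j m k, m0 j ≤ m → g * m ≤ k → x ∉ B j k m) ∧
      ∀ k, ∃ i, i ∉ R (k+1) ∧ x ∈ dyI (k+1) i := by
  classical
  set P : ℕ → ℕ → Prop := fun k i => ∃ j m, m0 j ≤ m ∧ g * m ≤ k ∧ (dyI k i ∩ B j k m).Nonempty with hP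
  set S := surv P R with hS
  -- survivors avoid
  have havoid : ∀ k i x, i ∈ S k → x ∈ dyI k i → ∀ j m k', k' ≤ k → m0 j ≤ m → g * m ≤ k' → x ∉ B j k' m := by
    intro k i x hi hx j m k' hk' hm hgk hxB
    have hk0 : 0 < k' := by
      have : 0 < g * m := Nat.mul_pos hg (by have := hm0 j; omega)
      omega
    obtain ⟨p, hp⟩ := Nat.exists_eq_add_of_le hk'
    subst hp
    have a1 := surv_anc P R k' p i hi
    obtain ⟨k'', rfl⟩ : ∃ k'', k' = k'' + 1 := ⟨k' - 1, by omega⟩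
    simp only [surv, Finset.mem_filter] at a1
    exact a1.2.2.1 ⟨j, m, hm, hgk, x, dyI_anc _ p i hx, hxB⟩
  set ch : ℕ → Finset ℕ := fun k => (Finset.range (2^(k+1))).filter (fun i => i/2 ∈ S k) with hch
  have hchcard : ∀ k, (ch k).card = 2 * (S k).card := by
    intro k
    have : ch k = (S k).biUnion (fun i => {2*i, 2*i+1}) := by
      ext i
      simp only [hch, Finset.mem_filter, Finset.mem_range, Finset.mem_biUnion, Finset.mem_insert, Finset.mem_singleton]
      constructor
      · rintro ⟨-, h⟩; exact ⟨i/2, h, by omega⟩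
      · rintro ⟨a, ha, h⟩
        have := surv_lt P R k a ha
        have e : i / 2 = a := by omega
        rw [e, pow_succ]
        exact ⟨by omega, ha⟩
    rw [this, Finset.card_biUnion]
    · rw [Finset.sum_congr rfl (fun i _ => Finset.card_pair (by omega)), Finset.sum_const]
      simp [mul_comm]
    · intro a _ b _ hab
      simp only [Function.onFun]
      rw [Finset.disjoint_left]
      intro x hx hy
      simp only [Finset.mem_insert, Finset.mem_singleton] at hx hy
      omega
  set f : ℕ → ℝ := fun k => ((S k).card : ℝ) with hf
  have hgrow : ∀ k, lam * f k ≤ f (k+1) := by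
    refine growth f lam Ac ms (fun m => (m+1) * (C * (1/2)^m)) (fun k => ((R k).card : ℝ)) h1 h2 hA hms hω
      (fun m => by positivity) (by simp [hf, hS, surv]) (fun k => by positivity) hsum hR ?_
    intro k
    -- removed sets
    set Hh : ℕ → ℕ → Finset ℕ := fun m j => if m0 j ≤ m ∧ g * m ≤ k + 1 then
      (ch k).filter (fun i => (dyI (k+1) i ∩ B j (k+1) m).Nonempty) else ∅ with hHh
    have hcov : ch k ⊆ S (k+1) ∪ (((Finset.Icc ms (k+1)).biUnion fun m => (Finset.range (m+1)).biUnion fun j => Hh m j) ∪ R (k+1)) := by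
      intro i hi
      by_cases hiR : i ∈ R (k+1)
      · simp [hiR]
      by_cases hiP : P (k+1) i
      · obtain ⟨j, m, hm, hgk, hne⟩ := hiP
        rw [Finset.mem_union]
        right
        rw [Finset.mem_union]
        left
        simp only [Finset.mem_biUnion, Finset.mem_Icc, Finset.mem_range]
        have := hm0 j
        have : m ≤ g * m := Nat.le_mul_of_pos_left m hg
        refine ⟨m, ⟨by omega, by omega⟩, j, by omega, ?_⟩
        rw [hHh]
        simp only [if_pos (And.intro hm hgk), Finset.mem_filter]
        exact ⟨hi, hne⟩
      · rw [Finset.mem_union]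
        left
        simp only [hch, Finset.mem_filter] at hi
        simp only [hS, surv, Finset.mem_filter]
        exact ⟨hi.1, hi.2, hiP, hiR⟩
    have hHcard : ∀ m ∈ Finset.Icc ms (k+1), ∀ j, ((Hh m j).card : ℝ) ≤ (C * (1/2)^m) * 2 ^ (min (k+1) (Ac*m)) * f (k + 1 - min (k+1) (Ac * m)) := by
      intro m hm j
      rw [Finset.mem_Icc] at hm
      by_cases hc : m0 j ≤ m ∧ g * m ≤ k + 1
      swap
      · simp only [hHh, if_neg hc, Finset.card_empty, Nat.cast_zero, hf]; positivity
      set p := min (k+1) (Ac*m) with hp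
      set l := k + 1 - p with hl
      have hp1 : 1 ≤ p := by
        rw [hp, le_min_iff]
        exact ⟨by omega, Nat.mul_pos hA (by omega)⟩
      have hpk : p ≤ k + 1 := min_le_left _ _
      have hkl : k + 1 = l + p := by omega
      have hmaps : ∀ i ∈ Hh m j, i / 2^p ∈ S l := by
        intro i hi
        simp only [hHh, if_pos hc, Finset.mem_filter, hch] at hi
        have h3 := hi.1.2
        obtain ⟨r, hr⟩ : ∃ r, p = r + 1 := ⟨p - 1, by omega⟩
        have hk2 : k = l + r := by omega
        rw [hk2] at h3
        have := surv_anc P R l r _ h3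
        rwa [Nat.div_div_eq_div_mul, ← pow_succ', ← hr] at this
      have hcard := Finset.card_eq_sum_card_fiberwise hmaps
      rw [hcard]
      push_cast
      calc ∑ c ∈ S l, (((Hh m j).filter (fun i => i / 2^p = c)).card : ℝ) ≤ ∑ c ∈ S l, C * (1/2)^m * 2^p := by
            apply Finset.sum_le_sum
            intro c hcS
            by_cases hemp : ((Hh m j).filter (fun i => i / 2^p = c)) = ∅
            · rw [hemp]; simp; positivity
            obtain ⟨i0, hi0⟩ := Finset.nonempty_iff_ne_empty.2 hemp
            refine hB j m (k+1) hc.1 hc.2 l p hkl ?_ c (surv_lt P R l c hcS) ?_ _ ?_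
            · rcases Nat.le_total (Ac*m) (k+1) with h | h
              · left; rw [hp, min_eq_right h]
              · right; rw [hl, hp, min_eq_left h]; omega
            · rw [Finset.mem_filter] at hi0
              have hi1 := hi0.1
              simp only [hHh, if_pos hc, Finset.mem_filter, hch] at hi1
              have hmem : ((i0/2 : ℕ) : ℝ)/2^k ∈ dyI k (i0/2) := by
                unfold dyI
                refine ⟨le_rfl, ?_⟩
                gcongr
                linarith
              refine ⟨((i0/2 : ℕ) : ℝ)/2^k, ?_, ?_⟩
              · obtain ⟨r, hr⟩ : ∃ r, p = r + 1 := ⟨p - 1, by omega⟩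
                have hk2 : k = l + r := by omega
                have := dyI_anc l r (i0/2)
                rw [← hk2] at this
                have h4 := this hmem
                rwa [Nat.div_div_eq_div_mul, ← pow_succ', ← hr, hi0.2] at h4
              · intro k' m' hk' hm' hgk'
                exact havoid k (i0/2) _ hi1.1.2 hmem j m' k' (by omega) (by omega) hgk'
            · intro i hi
              rw [Finset.mem_filter] at hi
              have hi1 := hi.1
              simp only [hHh, if_pos hc, Finset.mem_filter] at hi1
              exact ⟨hi.2, hi1.2⟩
        _ = _ := by simp [hf]; ring
    have c1 := Finset.card_le_card hcov
    have c2 : ((ch k).card : ℝ) ≤ (S (k+1)).card + ((((Finset.Icc ms (k+1)).biUnion fun m => (Finset.range (m+1)).biUnion fun j => Hh m j)).card + (R (k+1)).card) := by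
      exact_mod_cast c1.trans ((Finset.card_union_le _ _).trans (Nat.add_le_add_left (Finset.card_union_le _ _) _))
    have c3 : ((((Finset.Icc ms (k+1)).biUnion fun m => (Finset.range (m+1)).biUnion fun j => Hh m j)).card : ℝ) ≤ ∑ m ∈ Finset.Icc ms (k+1), ∑ j ∈ Finset.range (m+1), ((Hh m j).card : ℝ) := by
      have : (((Finset.Icc ms (k+1)).biUnion fun m => (Finset.range (m+1)).biUnion fun j => Hh m j)).card ≤ ∑ m ∈ Finset.Icc ms (k+1), ∑ j ∈ Finset.range (m+1), (Hh m j).card :=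
        Finset.card_biUnion_le.trans (Finset.sum_le_sum fun m _ => Finset.card_biUnion_le)
      exact_mod_cast this
    have c4 : ∑ m ∈ Finset.Icc ms (k+1), ∑ j ∈ Finset.range (m+1), ((Hh m j).card : ℝ) ≤ ∑ m ∈ Finset.Icc ms (k+1), ((m:ℝ)+1) * (C * (1/2)^m) * 2 ^ (min (k+1) (Ac*m)) * f (k + 1 - min (k+1) (Ac * m)) := by
      apply Finset.sum_le_sum
      intro m hm
      refine (Finset.sum_le_sum fun j _ => hHcard m hm j).trans (le_of_eq ?_)
      rw [Finset.sum_const, Finset.card_range, nsmul_eq_mul]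
      push_cast
      ring
    have c5 : ((ch k).card : ℝ) = 2 * f k := by rw [hchcard]; push_cast; rfl
    have c6 : f (k+1) = (S (k+1)).card := rfl
    rw [c6]
    linarith
  have hpos : ∀ k, 0 < f k := by
    intro k
    induction k with
    | zero => simp [hf, hS, surv]
    | succ k ih => exact lt_of_lt_of_le (mul_pos (by linarith) ih) (hgrow k)
  set U : ℕ → Set ℝ := fun k => ⋃ i ∈ S k, dyI k i with hU
  have hUc : ∀ k, IsCompact (U k) := fun k => (S k).isCompact_biUnion (fun i _ => isCompact_Icc)
  obtain ⟨x, hx⟩ := IsCompact.nonempty_iInter_of_sequence_nonempty_isCompact_isClosed U (by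
      intro k x hx
      simp only [hU, Set.mem_iUnion] at hx ⊢
      obtain ⟨i, hi, hxi⟩ := hx
      simp only [hS, surv, Finset.mem_filter] at hi
      exact ⟨i/2, hi.2.1, dyI_parent k i hxi⟩) (by
      intro k
      have : 0 < (S k).card := by have := hpos k; simp only [hf] at this; exact_mod_cast this
      obtain ⟨i, hi⟩ := Finset.card_pos.1 this
      refine ⟨(i:ℝ)/2^k, ?_⟩
      simp only [hU, Set.mem_iUnion]
      refine ⟨i, hi, le_rfl, ?_⟩
      gcongr
      linarith) (hUc 0) (fun k => (hUc k).isClosed)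
  rw [Set.mem_iInter] at hx
  have hx' : ∀ k, ∃ i ∈ S k, x ∈ dyI k i := by
    intro k
    have := hx k
    simp only [hU, Set.mem_iUnion] at this
    obtain ⟨i, hi, h⟩ := this
    exact ⟨i, hi, h⟩
  refine ⟨x, ?_, ?_, ?_⟩
  · obtain ⟨i, hi, h⟩ := hx' 0
    simp only [hS, surv, Finset.mem_singleton] at hi
    subst hi
    simpa [dyI] using h
  · intro j m k hm hgk
    obtain ⟨i, hi, h⟩ := hx' k
    exact havoid k i x hi h j m k le_rfl hm hgk
  · intro k
    obtain ⟨i, hi, h⟩ := hx' (k+1)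
    simp only [hS, surv, Finset.mem_filter] at hi
    exact ⟨i, hi.2.2.2, h⟩

end Cantor

lemma dy_disj (k : ℕ) : Pairwise (Function.onFun Disjoint (fun i : ℕ => Set.Ico ((i:ℝ)/2^k) (((i:ℝ)+1)/2^k))) := by
  have key : ∀ i j : ℕ, i < j → Disjoint (Set.Ico ((i:ℝ)/2^k) (((i:ℝ)+1)/2^k)) (Set.Ico ((j:ℝ)/2^k) (((j:ℝ)+1)/2^k)) := by
    intro i j hij
    rw [Set.disjoint_left]
    intro x hx hy
    have h1 : ((i:ℝ)+1)/2^k ≤ (j:ℝ)/2^k := by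
      gcongr
      exact_mod_cast hij
    linarith [hx.2, hy.1]
  intro i j hij
  rcases lt_or_gt_of_ne hij with h | h
  · exact key i j h
  · exact (key j i h).symm

namespace CD

theorem core_card (D : ℕ) (τ γ : ℝ) (hτ : 0 < τ) (hγ : 0 < γ) :
    ∃ Ac g : ℕ, 0 < g ∧ g ≤ Ac ∧ ∀ (ι : Type) [Fintype ι] [DecidableEq ι] (Q : CD ι),
      Fintype.card ι ≤ D → τ ≤ Q.τ → ∀ t0, Q.Gen γ t0 → ∃ m0 : ℕ, ∀ m k : ℕ, m0 ≤ m → g * m ≤ k →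
      ∀ l p, k = l + p → (p = Ac * m ∨ l = 0) → ∀ c < 2^l,
      (∃ x0 ∈ dyI l c, ∀ k' m', k' < k → m ≤ m' → g * m' ≤ k' → x0 ∉ Q.Bset (3*D) k' m') →
      ∀ T : Finset ℕ, (∀ i ∈ T, i / 2^p = c ∧ (dyI k i ∩ Q.Bset (3*D) k m).Nonempty) →
      (T.card : ℝ) ≤ (48*(D+1)^2*3^(D+1)) * (1/2)^m * 2^p := by
  obtain ⟨Ac, g, hg, hgA, H⟩ := CD.core D τ γ hτ hγ
  refine ⟨Ac, g, hg, hgA, ?_⟩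
  intro ι _ _ Q hD hQ t0 hG
  obtain ⟨m0, h0⟩ := H ι Q hD hQ t0 hG
  refine ⟨m0, ?_⟩
  intro m k hm hgk l p hkl hpl c hc hx0 T hT
  have key := h0 m hm k hgk ((c:ℝ)/2^l) (1/2^l) (by
    rcases hpl with hp | hl
    · left
      refine ⟨?_, ?_⟩
      · rw [hkl, hp]; push_cast; exact_mod_cast (by omega : Ac * m ≤ l + Ac * m)
      · have : ((k:ℝ) - Ac * m) = (l:ℝ) := by rw [hkl, hp]; push_cast; ring
        rw [this, Real.rpow_neg (by norm_num), Real.rpow_natCast, one_div]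
    · right
      subst hl
      have : c = 0 := by simpa using hc
      subst this
      simp) (by
    obtain ⟨x0, hx, hx'⟩ := hx0
    refine ⟨x0, ?_, hx'⟩
    unfold dyI at hx
    rwa [add_div] at hx)
  have hsub : (⋃ i ∈ T, Set.Ico ((i:ℝ)/2^k) (((i:ℝ)+1)/2^k)) ⊆ {x | x ∈ Set.Ico ((c:ℝ)/2^l) ((c:ℝ)/2^l + 1/2^l) ∧ ∃ b : ι → ℤ, b ≠ 0 ∧ ∀ i, |Q.co x (fun i => (b i : ℝ)) i| ≤ 2 * 2 ^ Q.Kx (3*D) k m i} := by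
    intro y hy
    simp only [Set.mem_iUnion] at hy
    obtain ⟨i, hi, hy⟩ := hy
    obtain ⟨hic, x, hxI, b, hb0, hb⟩ := hT i hi
    constructor
    · have h1 : c * 2^p ≤ i := by rw [← hic]; exact Nat.div_mul_le_self _ _
      have h2 : i + 1 ≤ (c+1) * 2^p := by
        have := Nat.lt_div_mul_add (a := i) (b := 2^p) (by positivity)
        rw [hic] at this
        rw [add_mul]; omega
      have h1' : (c:ℝ) * 2^p ≤ i := by exact_mod_cast h1
      have h2' : (i:ℝ) + 1 ≤ (c+1) * 2^p := by exact_mod_cast h2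
      rw [hkl, pow_add] at hy
      have hp0 : (0:ℝ) < 2^p := by positivity
      have hl0 : (0:ℝ) < 2^l := by positivity
      refine ⟨?_, ?_⟩
      · refine le_trans ?_ hy.1
        rw [div_le_div_iff₀ hl0 (by positivity)]
        nlinarith
      · refine lt_of_lt_of_le hy.2 ?_
        rw [← add_div, div_le_div_iff₀ (by positivity) hl0]
        nlinarith
    · refine ⟨b, hb0, ?_⟩
      intro j
      by_cases hj : j = Q.i0
      · subst hj
        have e1 := hb Q.i0
        have e2 := hb Q.i1
        rw [Q.co_ne _ _ Q.hne.symm] at e2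
        have e3 : Q.co y (fun i => (b i : ℝ)) Q.i0 = Q.co x (fun i => (b i : ℝ)) Q.i0 + (y - x) * b Q.i1 := by
          rw [co_i0, co_i0]; ring
        have e4 : |y - x| ≤ 1/2^k := by
          unfold dyI at hxI
          have a1 := hxI.1
          have a2 := hxI.2
          have a3 := hy.1
          have a4 := hy.2
          rw [add_div] at a2 a4
          rw [abs_le]; constructor <;> linarith
        have e5 : (1/2^k : ℝ) * 2 ^ Q.Kx (3*D) k m Q.i1 = 2 ^ Q.Kx (3*D) k m Q.i0 := by
          have := Q.Kx_div (3*D) k m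
          have h : Q.Kx (3*D) k m Q.i1 = k + Q.Kx (3*D) k m Q.i0 := by linarith
          rw [h, Real.rpow_add (by norm_num), Real.rpow_natCast]
          field_simp
        rw [e3]
        calc _ ≤ |Q.co x (fun i => (b i : ℝ)) Q.i0| + |(y - x) * b Q.i1| := abs_add_le _ _
          _ ≤ 2 ^ Q.Kx (3*D) k m Q.i0 + (1/2^k : ℝ) * 2 ^ Q.Kx (3*D) k m Q.i1 := by
            rw [abs_mul]; gcongr
          _ = _ := by rw [e5]; ring
      · have e1 := hb j
        rw [Q.co_ne _ _ hj] at e1 ⊢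
        have : (0:ℝ) < 2 ^ Q.Kx (3*D) k m j := by positivity
        linarith
  have h5 := (measure_mono (μ := volume) hsub).trans key
  rw [measure_biUnion_finset (fun i _ j _ hij => dy_disj k hij) (fun i _ => measurableSet_Ico)] at h5
  have h6 : ∀ i ∈ T, volume (Set.Ico ((i:ℝ)/2^k) (((i:ℝ)+1)/2^k)) = ENNReal.ofReal (1/2^k) := by
    intro i _
    rw [Real.volume_Ico]; congr 1; ring
  rw [Finset.sum_congr rfl h6, Finset.sum_const, nsmul_eq_mul, ← ENNReal.ofReal_natCast, ← ENNReal.ofReal_mul (by positivity),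
    ENNReal.ofReal_le_ofReal_iff (by positivity), Real.rpow_neg (by norm_num), Real.rpow_natCast] at h5
  rw [hkl, pow_add, mul_one_div, mul_one_div, div_le_div_iff₀ (by positivity) (by positivity)] at h5
  have hl0 : (0:ℝ) < 2^l := by positivity
  have h7 : (T.card : ℝ) * 2^l ≤ ((48*(D+1)^2*3^(D+1)) * (1/2)^m * 2^p) * 2^l := by
    calc _ ≤ _ := h5
      _ = _ := by rw [one_div, inv_pow]; ring
  exact le_of_mul_le_mul_right h7 hl0

end CD

noncomputable def cubeM (n : ℕ) : Measure (Fin n → ℝ) := Measure.pi (fun _ : Fin n => volume.restrict (Set.Ioc (0:ℝ) 1))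

lemma cubeM_eq (n : ℕ) : cubeM n = volume.restrict (Set.pi Set.univ (fun _ : Fin n => Set.Ioc (0:ℝ) 1)) := by
  unfold cubeM
  rw [volume_pi, Measure.restrict_pi_pi]

instance (n : ℕ) : IsProbabilityMeasure (cubeM n) := by
  constructor
  unfold cubeM
  rw [Measure.pi_univ]
  simp

lemma strip_meas {n : ℕ} (c : Fin n → ℤ) (hc : c ≠ 0) (ε : ℝ) :
    cubeM n {z | ∃ p : ℤ, |p + ∑ i, (c i : ℝ) * z i| ≤ ε} ≤ ENNReal.ofReal (2 * ε) := by
  have : Fact ((0:ℝ) < 1) := ⟨one_pos⟩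
  obtain ⟨j, hj⟩ : ∃ j, c j ≠ 0 := by
    by_contra h; push Not at h; exact hc (funext h)
  let φ : (Fin n → UnitAddCircle) →+ UnitAddCircle :=
    { toFun := fun z => ∑ i, c i • z i
      map_zero' := by simp
      map_add' := by intro a b; simp [Finset.sum_add_distrib] }
  have hφc : Continuous φ := by
    change Continuous (fun z : Fin n → UnitAddCircle => ∑ i, c i • z i)
    fun_prop
  have hφs : Function.Surjective φ := by
    intro w
    refine ⟨Pi.single j (DivisibleBy.div w (c j)), ?_⟩
    change ∑ i, c i • (Pi.single j (DivisibleBy.div w (c j)) : Fin n → UnitAddCircle) i = w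
    rw [Finset.sum_eq_single j]
    · rw [Pi.single_eq_same]; exact DivisibleBy.div_cancel w hj
    · intro b _ hb; simp [Pi.single_eq_of_ne hb]
    · simp
  have hmp := AddMonoidHom.measurePreserving (μ := (volume : Measure (Fin n → UnitAddCircle))) (ν := (volume : Measure UnitAddCircle)) (f := φ) hφc hφs (by rw [volume_pi, Measure.pi_univ]; simp)
  have h1 := measurePreserving_pi (fun _ : Fin n => volume.restrict (Set.Ioc (0:ℝ) (0+1))) (fun _ => (volume : Measure UnitAddCircle)) (fun i => AddCircle.measurePreserving_mk 1 0)
  have h2 := hmp.comp h1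
  rw [zero_add] at h2
  have h3 := h2.measure_preimage (s := Metric.closedBall 0 ε) measurableSet_closedBall.nullMeasurableSet
  rw [AddCircle.volume_closedBall] at h3
  have h4 : {z : Fin n → ℝ | ∃ p : ℤ, |p + ∑ i, (c i : ℝ) * z i| ≤ ε} ⊆ (φ ∘ fun a i => ((a i : ℝ) : UnitAddCircle)) ⁻¹' Metric.closedBall 0 ε := by
    rintro z ⟨p, hp⟩
    rw [Set.mem_preimage, mem_closedBall_zero_iff]
    have e : (φ ∘ fun a i => ((a i : ℝ) : UnitAddCircle)) z = ((p + ∑ i, (c i : ℝ) * z i : ℝ) : UnitAddCircle) := by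
      have hp0 : ((p:ℝ) : UnitAddCircle) = 0 := by
        rw [AddCircle.coe_eq_zero_iff]; exact ⟨p, by simp⟩
      rw [AddCircle.coe_add, hp0, zero_add]
      change ∑ i, c i • ((z i : ℝ) : UnitAddCircle) = _
      have := map_sum (QuotientAddGroup.mk' (AddSubgroup.zmultiples (1:ℝ))) (fun i => (c i : ℝ) * z i) Finset.univ
      refine Eq.trans ?_ this.symm
      refine Finset.sum_congr rfl fun i _ => ?_
      rw [← zsmul_eq_mul]
      rfl
    rw [e, UnitAddCircle.norm_eq]
    refine le_trans ?_ hp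
    have := round_le (p + ∑ i, (c i : ℝ) * z i) 0
    simpa using this
  refine (measure_mono h4).trans ?_
  unfold cubeM
  rw [h3]
  exact ENNReal.ofReal_le_ofReal (min_le_right _ _)

section Qr
variable {n : ℕ} (r : Fin n → ℝ) (τ : ℝ) (hτ : 0 < τ) (hr : ∑ i, r i = 1) (h0 : ∀ i, 0 ≤ r i)
  (ht : ∀ i, 0 < r i → τ ≤ r i) (i1 : {i : Fin n // 0 < r i}) (z : Fin n → ℝ)

lemma sum_supp (h0 : ∀ i, 0 ≤ r i) (f : Fin n → ℝ) (hf : ∀ i, r i = 0 → f i = 0) :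
    ∑ i : {i : Fin n // 0 < r i}, f i = ∑ i, f i := by
  rw [← Finset.sum_subtype (Finset.univ.filter (fun i => 0 < r i)) (by simp) f, Finset.sum_filter]
  refine Finset.sum_congr rfl fun i _ => ?_
  split_ifs with h
  · rfl
  · exact (hf i (le_antisymm (not_lt.1 h) (h0 i))).symm

noncomputable def Qr : CD (Option {i : Fin n // 0 < r i}) where
  i0 := none
  i1 := some i1
  hne := by simp
  ρ := fun o => o.elim (-1) (fun i => r i)
  ζ := fun o => o.elim 1 (fun i => if i = i1 then z i1 else z i - z i1)
  τ := τ
  hτ := hτ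
  hρ0 := rfl
  hρτ := by
    intro i hi
    cases i with
    | none => exact absurd rfl hi
    | some i => exact ht i i.2
  hsum := by
    rw [Fintype.sum_option]
    have := sum_supp r h0 r (fun i h => h)
    simp only [Option.elim]
    rw [this, hr]; norm_num
  hζ := rfl

end Qr

lemma gen_ae {n : ℕ} (r : Fin n → ℝ) (τ : ℝ) (hτ : 0 < τ) (hr : ∑ i, r i = 1) (h0 : ∀ i, 0 ≤ r i)
    (ht : ∀ i, 0 < r i → τ ≤ r i) (i1 : {i : Fin n // 0 < r i}) (γ : ℝ) (hγ : 0 < γ) (hγ1 : γ < 1)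
    (hγτ : (n+1) * γ < τ) :
    ∀ᵐ z ∂(cubeM n), ∃ t0, (Qr r τ hτ hr h0 ht i1 z).Gen γ t0 := by
  set V : ℕ → Finset ({i : Fin n // 0 < r i} → ℤ) := fun l => Fintype.piFinset (fun i => if i = i1 then {0} else Finset.Icc (-⌊(2:ℝ)^((r i + γ) * (l+1))⌋) ⌊(2:ℝ)^((r i + γ) * (l+1))⌋) with hV
  set cc : ({i : Fin n // 0 < r i} → ℤ) → Fin n → ℤ := fun v j => (if h : 0 < r j then v ⟨j, h⟩ else 0) - if j = i1 then ∑ i, v i else 0 with hcc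
  have hccz : ∀ v (z : Fin n → ℝ), ∑ j, (cc v j : ℝ) * z j = ∑ i, (v i : ℝ) * (z i - z i1) := by
    intro v z
    have e1 : ∑ j, ((if h : 0 < r j then v ⟨j, h⟩ else 0 : ℤ) : ℝ) * z j = ∑ i, (v i : ℝ) * z i := by
      rw [← sum_supp r h0 (fun j => ((if h : 0 < r j then v ⟨j, h⟩ else 0 : ℤ) : ℝ) * z j)]
      · refine Finset.sum_congr rfl fun i _ => ?_
        simp [i.2]
      · intro i hi; simp [hi]
    simp only [hcc]
    push_cast at e1 ⊢
    simp only [sub_mul, mul_sub, Finset.sum_sub_distrib]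
    rw [e1]
    congr 1
    rw [Finset.sum_eq_single i1.1]
    · rw [if_pos rfl, Finset.sum_mul]
    · intro b _ hb; rw [if_neg hb]; simp
    · simp
  have hcc0 : ∀ v, v i1 = 0 → v ≠ 0 → cc v ≠ 0 := by
    intro v hv1 hv h
    apply hv
    funext i
    by_cases hi : i = i1
    · rw [hi, hv1]; rfl
    · have := congrFun h i
      have hne : (i : Fin n) ≠ i1 := fun h => hi (Subtype.ext h)
      simpa [hcc, i.2, hne] using this
  set E : ℕ → Set (Fin n → ℝ) := fun l => ⋃ v ∈ (V l).filter (fun v => v ≠ 0), {z | ∃ p : ℤ, |p + ∑ i, (cc v i : ℝ) * z i| ≤ 2^((-1+γ)*l)} with hE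
  have hVcard : ∀ l : ℕ, ((V l).card : ℝ) ≤ 3^n * 2^((1 - r i1 + n * γ) * (l+1)) := by
    intro l
    simp only [hV, Fintype.card_piFinset]
    push_cast
    have hN : ∀ i : {i : Fin n // 0 < r i}, (((if i = i1 then {0} else Finset.Icc (-⌊(2:ℝ)^((r i + γ) * (l+1))⌋) ⌊(2:ℝ)^((r i + γ) * (l+1))⌋) : Finset ℤ).card : ℝ) ≤ 3 * 2^(((if i = i1 then 0 else r i) + γ) * (l+1)) := by
      intro i
      split_ifs with h
      · simp only [Finset.card_singleton]
        have : (1:ℝ) ≤ 2^((0+γ) * (l+1)) := Real.one_le_rpow (by norm_num) (by positivity)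
        push_cast; linarith
      · rw [Int.card_Icc]
        have hr0 := i.2
        have h1 : (1:ℝ) ≤ 2^((r i+γ) * (l+1)) := Real.one_le_rpow (by norm_num) (by positivity)
        have h2 : 0 ≤ ⌊(2:ℝ)^((r i + γ) * (l+1))⌋ := Int.floor_nonneg.2 (by positivity)
        have h3 : (((⌊(2:ℝ)^((r i + γ) * (l+1))⌋ + 1 - -⌊(2:ℝ)^((r i + γ) * (l+1))⌋).toNat : ℤ) : ℝ) = 2 * ⌊(2:ℝ)^((r i + γ) * (l+1))⌋ + 1 := by
          rw [Int.toNat_of_nonneg (by omega)]; push_cast; ring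
        rw [Int.cast_natCast] at h3
        rw [h3]
        have := Int.floor_le ((2:ℝ)^((r i + γ) * (l+1)))
        linarith
    refine (Finset.prod_le_prod (fun _ _ => by positivity) (fun i _ => hN i)).trans ?_
    rw [Finset.prod_mul_distrib, Finset.prod_const, ← Real.rpow_sum_of_pos (by norm_num)]
    have hcd : (Finset.univ : Finset {i : Fin n // 0 < r i}).card ≤ n := by
      rw [Finset.card_univ]
      exact (Fintype.card_subtype_le _).trans (by simp)
    have hsum : ∑ i : {i : Fin n // 0 < r i}, ((if i = i1 then 0 else r i) + γ) * ((l:ℝ)+1) ≤ (1 - r i1 + n * γ) * (l+1) := by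
      rw [← Finset.sum_mul]
      refine mul_le_mul_of_nonneg_right ?_ (by positivity)
      rw [Finset.sum_add_distrib, Finset.sum_const, nsmul_eq_mul]
      have h5 : ∑ i : {i : Fin n // 0 < r i}, (if i = i1 then 0 else r i) = 1 - r i1 := by
        have h6 : ∀ i : {i : Fin n // 0 < r i}, (if i = i1 then 0 else r i) = r i - if i = i1 then r i else 0 := by
          intro i; split_ifs <;> simp
        rw [Finset.sum_congr rfl fun i _ => h6 i, Finset.sum_sub_distrib, sum_supp r h0 r (fun i h => h), hr]
        simp
      rw [h5]
      have : ((Finset.univ : Finset {i : Fin n // 0 < r i}).card : ℝ) ≤ n := by exact_mod_cast hcd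
      gcongr
    gcongr
    · norm_num
    · norm_num
  have hE1 : ∀ l, cubeM n (E l) ≤ ENNReal.ofReal (3^n * 2^((1 - r i1 + n * γ)) * 2 * (2^(-(τ - (n+1)*γ)))^l) := by
    intro l
    have hv1 : ∀ v ∈ (V l).filter (fun v => v ≠ 0), cc v ≠ 0 := by
      intro v hv
      rw [Finset.mem_filter] at hv
      refine hcc0 v ?_ hv.2
      have := Fintype.mem_piFinset.1 hv.1 i1
      simpa using this
    calc cubeM n (E l) ≤ ∑ v ∈ (V l).filter (fun v => v ≠ 0), ENNReal.ofReal (2 * 2^((-1+γ)*l)) :=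
          (measure_biUnion_finset_le _ _).trans (Finset.sum_le_sum fun v hv => strip_meas _ (hv1 v hv) _)
      _ = ENNReal.ofReal (((V l).filter (fun v => v ≠ 0)).card * (2 * 2^((-1+γ)*l))) := by
          rw [Finset.sum_const, nsmul_eq_mul, ENNReal.ofReal_mul (Nat.cast_nonneg _), ENNReal.ofReal_natCast]
      _ ≤ _ := by
          apply ENNReal.ofReal_le_ofReal
          have h1 : (((V l).filter (fun v => v ≠ 0)).card : ℝ) ≤ 3^n * 2^((1 - r i1 + n * γ) * (l+1)) := by
            refine le_trans ?_ (hVcard l)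
            exact_mod_cast Finset.card_filter_le _ _
          calc _ ≤ 3^n * 2^((1 - r i1 + n * γ) * (l+1)) * (2 * (2:ℝ)^((-1+γ)*l)) := by gcongr
            _ = 3^n * 2^((1 - r i1 + n * γ)) * 2 * (2^((1 - r i1 + n * γ) * l + (-1+γ)*l)) := by
              rw [mul_add _ (l:ℝ) 1, mul_one, Real.rpow_add (by norm_num) (_ * _) (1 - r i1 + n * γ), Real.rpow_add (by norm_num) (_ * _) ((-1+γ)*l)]; ring
            _ ≤ _ := by
              rw [← Real.rpow_mul_natCast (by norm_num)]
              have := ht i1 i1.2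
              have hl : (0:ℝ) ≤ l := by positivity
              gcongr
              · norm_num
              · nlinarith
  have hfin : (∑' l, cubeM n (E l)) ≠ ∞ := by
    have hq1 : (2:ℝ)^(-(τ - (n+1)*γ)) < 1 := Real.rpow_lt_one_of_one_lt_of_neg (by norm_num) (by linarith)
    have hs : Summable (fun l : ℕ => 3^n * 2^((1 - r i1 + n * γ)) * 2 * ((2:ℝ)^(-(τ - (n+1)*γ)))^l) :=
      (summable_geometric_of_lt_one (by positivity) hq1).mul_left _
    refine ne_top_of_le_ne_top ?_ (ENNReal.tsum_le_tsum hE1)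
    rw [← ENNReal.ofReal_tsum_of_nonneg (fun l => by positivity) hs]
    exact ENNReal.ofReal_ne_top
  filter_upwards [ae_eventually_notMem hfin] with z hz
  rw [Filter.eventually_atTop] at hz
  obtain ⟨L, hL⟩ := hz
  refine ⟨L + 1, ?_⟩
  intro t htL b hb hb1
  by_contra hcon
  push Not at hcon
  have htpos : 0 < t := by have : (0:ℝ) ≤ L := by positivity
                           linarith
  set l := ⌊t⌋₊ with hl
  have hlt : (l:ℝ) ≤ t := Nat.floor_le htpos.le
  have hlt' : t < l + 1 := Nat.lt_floor_add_one t
  have hLl : L ≤ l := Nat.le_floor (by linarith)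
  apply hL l hLl
  have hb1' : b (some i1) = 0 := hb1
  have hco := hcon none
  have hco0 : (Qr r τ hτ hr h0 ht i1 z).co 0 (fun i => (b i:ℝ)) none = b none + ∑ i, (b (some i) : ℝ) * (z i - z i1) := by
    have := (Qr r τ hτ hr h0 ht i1 z).co_i0 0 (fun i => (b i:ℝ))
    change _ = _ at this
    refine this.trans ?_
    rw [Fintype.sum_option, zero_mul, add_zero]
    simp only [Qr, Option.elim, one_mul]
    congr 1
    refine Finset.sum_congr rfl fun i _ => ?_
    split_ifs with h
    · subst h; rw [hb1']; simp
    · ring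
  rw [hco0] at hco
  have hρn : (Qr r τ hτ hr h0 ht i1 z).ρ none = -1 := rfl
  rw [hρn] at hco
  simp only [hE, Set.mem_iUnion]
  refine ⟨fun i => b (some i), ?_, b none, ?_⟩
  · rw [Finset.mem_filter]
    constructor
    · rw [hV, Fintype.mem_piFinset]
      intro i
      split_ifs with h
      · subst h; simp [hb1']
      · have := hcon (some i)
        rw [CD.co_ne _ _ _ (by simp [Qr])] at this
        have hρ : (Qr r τ hτ hr h0 ht i1 z).ρ (some i) = r i := rfl
        rw [hρ] at this
        have hri := i.2
        have h6 : |(b (some i) : ℝ)| ≤ 2^((r i + γ) * (l+1)) := this.trans (by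
          apply Real.rpow_le_rpow_of_exponent_le (by norm_num)
          gcongr)
        rw [Finset.mem_Icc, ← abs_le]
        apply Int.le_floor.2
        rw [Int.cast_abs]; exact h6
    · intro hz0
      have hz1 : ∀ i, b (some i) = 0 := fun i => congrFun hz0 i
      have hbn : b none ≠ 0 := by
        intro h
        apply hb
        funext o
        cases o with
        | none => exact h
        | some i => exact hz1 i
      simp only [hz1, Int.cast_zero, zero_mul, Finset.sum_const_zero, add_zero] at hco
      have h7 : (1:ℝ) ≤ |(b none : ℝ)| := by exact_mod_cast Int.one_le_abs hbn
      have h8 : (2:ℝ)^((-1+γ)*t) < 1 := Real.rpow_lt_one_of_one_lt_of_neg (by norm_num) (by nlinarith)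
      linarith
  · have h9 := hccz (fun i => b (some i)) z
    rw [h9]
    refine hco.trans ?_
    apply Real.rpow_le_rpow_of_exponent_le (by norm_num)
    nlinarith

lemma pigeon {S : Type} [Fintype S] [DecidableEq S] (ρ : S → ℝ) (hsum : ∑ i, ρ i = 1)
    (q : ℕ) (hq : 1 ≤ q) (P : S → ℤ) :
    ∃ a : S → ℤ, a ≠ 0 ∧ (∀ i, |(a i : ℝ)| ≤ (q:ℝ)^(ρ i)) ∧ ∃ a0 : ℤ, a0 * q + ∑ i, a i * P i = 0 := by
  have hq0 : (0:ℝ) < q := by exact_mod_cast hq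
  set A : Finset (S → ℕ) := Fintype.piFinset (fun i => Finset.range (⌊(q:ℝ)^(ρ i)⌋₊ + 1)) with hA
  have hcard : q < A.card := by
    rw [hA, Fintype.card_piFinset]
    simp only [Finset.card_range]
    have hne : Nonempty S := by
      by_contra h
      rw [not_nonempty_iff] at h
      simp at hsum
    have h1 : (q:ℝ) < ((∏ i, (⌊(q:ℝ)^(ρ i)⌋₊ + 1) : ℕ) : ℝ) := by
      calc (q:ℝ) = ∏ i, (q:ℝ)^(ρ i) := by rw [← Real.rpow_sum_of_pos hq0, hsum, Real.rpow_one]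
        _ < _ := by
          push_cast
          exact Finset.prod_lt_prod_of_nonempty (fun i _ => by positivity) (fun i _ => Nat.lt_floor_add_one _) Finset.univ_nonempty
    exact_mod_cast h1
  obtain ⟨u, hu, v, hv, huv, he⟩ := Finset.exists_ne_map_eq_of_card_lt_of_maps_to (s := A) (t := Finset.range q)
    (f := fun a => ((∑ i, (a i : ℤ) * P i) % q).toNat) (by simpa using hcard) (by
      intro a _
      have h1 := Int.emod_nonneg (∑ i, (a i : ℤ) * P i) (show (q:ℤ) ≠ 0 by omega)
      have h2 := Int.emod_lt_of_pos (∑ i, (a i : ℤ) * P i) (show (0:ℤ) < q by omega)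
      simp only [Finset.coe_range, Set.mem_Iio]
      omega)
  have he' : (∑ i, (u i : ℤ) * P i) % q = (∑ i, (v i : ℤ) * P i) % q := by
    have h1 := Int.emod_nonneg (∑ i, (u i : ℤ) * P i) (show (q:ℤ) ≠ 0 by omega)
    have h2 := Int.emod_nonneg (∑ i, (v i : ℤ) * P i) (show (q:ℤ) ≠ 0 by omega)
    omega
  obtain ⟨w, hw⟩ := (Int.ModEq.dvd he' : (q:ℤ) ∣ _)
  refine ⟨fun i => (u i : ℤ) - v i, ?_, ?_, w, ?_⟩
  · intro h
    apply huv
    funext i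
    have := congrFun h i
    simp only [Pi.zero_apply] at this
    omega
  · intro i
    have h1 := Fintype.mem_piFinset.1 hu i
    have h2 := Fintype.mem_piFinset.1 hv i
    simp only [Finset.mem_range] at h1 h2
    have h3 := Nat.floor_le (show (0:ℝ) ≤ (q:ℝ)^(ρ i) by positivity)
    have h1' : (u i : ℝ) ≤ ⌊(q:ℝ)^(ρ i)⌋₊ := by exact_mod_cast Nat.lt_succ_iff.1 h1
    have h2' : (v i : ℝ) ≤ ⌊(q:ℝ)^(ρ i)⌋₊ := by exact_mod_cast Nat.lt_succ_iff.1 h2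
    have h4 : (0:ℝ) ≤ u i := by positivity
    have h5 : (0:ℝ) ≤ v i := by positivity
    push_cast
    rw [abs_le]
    constructor <;> linarith
  · simp only [sub_mul, Finset.sum_sub_distrib]
    linarith

lemma Qr_co {n : ℕ} (r : Fin n → ℝ) (τ : ℝ) (hτ : 0 < τ) (hr : ∑ i, r i = 1) (h0 : ∀ i, 0 ≤ r i)
    (ht : ∀ i, 0 < r i → τ ≤ r i) (i1 : {i : Fin n // 0 < r i}) (z : Fin n → ℝ) (x : ℝ)
    (a0 : ℤ) (a : {i : Fin n // 0 < r i} → ℤ) :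
    (Qr r τ hτ hr h0 ht i1 z).co x (fun o => ((o.elim a0 (fun i => if i = i1 then ∑ j, a j else a i) : ℤ) : ℝ)) none
      = a0 + ∑ i, (a i : ℝ) * (z i + x) := by
  have := (Qr r τ hτ hr h0 ht i1 z).co_i0 x (fun o => ((o.elim a0 (fun i => if i = i1 then ∑ j, a j else a i) : ℤ) : ℝ))
  refine Eq.trans this ?_
  rw [Fintype.sum_option]
  simp only [Qr, Option.elim, one_mul, if_true]
  have e1 : ∀ i : {i : Fin n // 0 < r i}, (if i = i1 then z i1 else z i - z i1) * ((if i = i1 then ∑ j, a j else a i : ℤ) : ℝ)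
      = (z i - z i1) * a i + if i = i1 then z i1 * ((∑ j, a j : ℤ) : ℝ) else 0 := by
    intro i
    split_ifs with h
    · subst h; ring
    · ring
  rw [Finset.sum_congr rfl fun i _ => e1 i, Finset.sum_add_distrib, Finset.sum_ite_eq' Finset.univ i1]
  simp only [Finset.mem_univ, if_true]
  push_cast
  have e2 : ∑ i, (a i : ℝ) * (z i + x) = ∑ i : {i : Fin n // 0 < r i}, (z i - z i1) * (a i : ℝ) + z i1 * ∑ i, (a i : ℝ) + x * ∑ i, (a i : ℝ) := by
    rw [Finset.mul_sum, Finset.mul_sum, ← Finset.sum_add_distrib, ← Finset.sum_add_distrib]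
    exact Finset.sum_congr rfl fun i _ => by ring
  rw [e2]; ring

set_option maxHeartbeats 1000000 in
lemma transf {n : ℕ} (r : Fin n → ℝ) (τ : ℝ) (hτ : 0 < τ) (hr : ∑ i, r i = 1) (h0 : ∀ i, 0 ≤ r i)
    (ht : ∀ i, 0 < r i → τ ≤ r i) (i1 : {i : Fin n // 0 < r i}) (hmax : ∀ i, r i ≤ r i1) (z : Fin n → ℝ)
    (N g m : ℕ) (x : ℝ) (hx : ∀ k, g * m ≤ k → x ∉ (Qr r τ hτ hr h0 ht i1 z).Bset N k m) :
    (WithLp.toLp 2 (fun i => z i + x) : EuclideanSpace ℝ (Fin n)) ∈ BadSet r := by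
  set M : ℕ := 2^((g+N+2)*m) with hM
  have hM1 : 1 ≤ M := Nat.one_le_two_pow
  have hM0 : (0:ℝ) < M := by exact_mod_cast hM1
  set D' : ℝ := (N*m+n)/τ with hD'
  have hD0 : 0 ≤ D' := by positivity
  set η : ℝ := 2^(-D'-1) / ((n+1) * M) with hη
  have hη0 : 0 < η := by positivity
  set c : ℝ := min 1 (η^(1/τ)) / M with hc
  have hc0 : 0 < c := by positivity
  have hMc : M * c = min 1 (η^(1/τ)) := by rw [hc]; field_simp
  have hMc1 : M * c ≤ 1 := by rw [hMc]; exact min_le_left _ _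
  have hMcτ : (M * c)^τ ≤ η := by
    calc (M * c)^τ ≤ (η^(1/τ))^τ := by
          apply Real.rpow_le_rpow (by positivity) _ hτ.le
          rw [hMc]; exact min_le_right _ _
      _ = η := by rw [← Real.rpow_mul hη0.le, one_div_mul_cancel hτ.ne', Real.rpow_one]
  refine ⟨c, hc0, ?_⟩
  intro q hq
  by_contra hcon
  push Not at hcon
  have hq0 : (0:ℝ) < q := by exact_mod_cast hq
  have hp : ∀ i : {i : Fin n // 0 < r i}, ∃ p : ℤ, |q * (z i + x) - p| < (c * (q:ℝ)⁻¹)^(r i) := by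
    intro i
    have h1 := hcon i
    simp only [badPow, if_neg i.2.ne'] at h1
    set d := distNearestInt (q * (z i + x)) with hd
    have hd0 : 0 ≤ d := Real.iInf_nonneg fun p => abs_nonneg _
    have h2 : d < (c * (q:ℝ)⁻¹)^(r i) := by
      have := Real.rpow_lt_rpow (by positivity) h1 i.2
      rwa [← Real.rpow_mul hd0, one_div_mul_cancel i.2.ne', Real.rpow_one] at this
    exact exists_lt_of_ciInf_lt h2
  choose p hp using hp
  have hsum : ∑ i : {i : Fin n // 0 < r i}, r i = 1 := by rw [sum_supp r h0 r (fun i h => h), hr]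
  obtain ⟨a, ha0, hab, a0, hae⟩ := pigeon (fun i : {i : Fin n // 0 < r i} => r i) hsum (M*q) (Nat.mul_pos hM1 hq) (fun i => M * p i)
  have hcd : ((Finset.univ : Finset {i : Fin n // 0 < r i}).card : ℝ) ≤ n := by
    rw [Finset.card_univ]
    exact_mod_cast (Fintype.card_subtype_le _).trans (by simp)
  set q' : ℝ := ((M*q : ℕ) : ℝ) with hq'
  have hq'e : q' = M * q := by rw [hq']; push_cast; ring
  have hq'0 : 0 < q' := by rw [hq'e]; positivity
  set L : ℝ := Real.logb 2 q' with hL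
  have h2L : (2:ℝ)^L = q' := Real.rpow_logb (by norm_num) (by norm_num) hq'0
  have hLM : (((g+N+2)*m : ℕ):ℝ) ≤ L := by
    rw [hL, Real.le_logb_iff_rpow_le (by norm_num) hq'0, Real.rpow_natCast, hq'e]
    have h3 : ((2:ℝ)^((g+N+2)*m)) = M := by rw [hM]; push_cast; rfl
    rw [h3]
    have : (1:ℝ) ≤ q := by exact_mod_cast hq
    nlinarith
  -- the linear form
  have hform : |(a0:ℝ) + ∑ i, (a i : ℝ) * (z i + x)| ≤ 2^(-(L + D' + 1)) := by
    have e1 : q' * ((a0:ℝ) + ∑ i, (a i : ℝ) * (z i + x)) = ∑ i, (a i : ℝ) * (M * (q * (z i + x) - p i)) := by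
      have hae' : (a0:ℝ) * q' + ∑ i, (a i : ℝ) * (M * p i) = 0 := by rw [hq']; exact_mod_cast hae
      have e2 : ∑ i, (a i : ℝ) * (M * (q * (z i + x) - p i)) = q' * ∑ i, (a i : ℝ) * (z i + x) - ∑ i, (a i : ℝ) * (M * p i) := by
        rw [Finset.mul_sum, ← Finset.sum_sub_distrib]
        refine Finset.sum_congr rfl fun i _ => ?_
        rw [hq'e]; ring
      rw [e2]; linarith
    have e3 : |q' * ((a0:ℝ) + ∑ i, (a i : ℝ) * (z i + x))| ≤ 2^(-D'-1) := by
      rw [e1]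
      calc _ ≤ ∑ i, |(a i : ℝ) * (M * (q * (z i + x) - p i))| := Finset.abs_sum_le_sum_abs _ _
        _ ≤ ∑ i : {i : Fin n // 0 < r i}, M * η := by
          refine Finset.sum_le_sum fun i _ => ?_
          rw [abs_mul, abs_mul, Nat.abs_cast]
          calc |(a i : ℝ)| * (M * |q * (z i + x) - p i|) ≤ q'^(r i) * (M * (c * (q:ℝ)⁻¹)^(r i)) := by
                gcongr
                · exact hab i
                · exact (hp i).le
            _ = M * (q' * (c * (q:ℝ)⁻¹))^(r i) := by
                rw [Real.mul_rpow hq'0.le (by positivity)]; ring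
            _ = M * (M * c)^(r i) := by
                congr 2; rw [hq'e]; field_simp
            _ ≤ M * η := by
                gcongr
                refine le_trans ?_ hMcτ
                exact Real.rpow_le_rpow_of_exponent_ge (by positivity) hMc1 (ht i i.2)
        _ ≤ n * (M * η) := by
          rw [Finset.sum_const, nsmul_eq_mul]
          gcongr
        _ ≤ (n+1) * (M * η) := by gcongr; linarith
        _ = _ := by rw [hη]; field_simp
    rw [abs_mul, abs_of_pos hq'0] at e3
    have e4 : (2:ℝ)^(-(L + D' + 1)) = 2^(-D'-1) / q' := by
      rw [show -(L + D' + 1) = (-D'-1) - L by ring, Real.rpow_sub (by norm_num), h2L]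
    rw [e4, le_div_iff₀ hq'0]; linarith
  set Q := Qr r τ hτ hr h0 ht i1 z with hQ
  have hρ1 : Q.ρ Q.i1 = r i1 := rfl
  have hr1 : 0 < r i1 := i1.2
  set k : ℕ := ⌈(1 + r i1) * (L + D') - (N+2)*m⌉₊ with hk
  have hbig : ((g:ℝ) + N + 2) * m ≤ L + D' := by push_cast at hLM; linarith
  have hmN : (0:ℝ) ≤ (N+2) * m := by positivity
  have hgm : (0:ℝ) ≤ g * m := by positivity
  have hLD : 0 ≤ L + D' := by nlinarith
  have hk1 : (1 + r i1) * (L + D') - (N+2)*m ≤ k := Nat.le_ceil _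
  have hk2 : (k:ℝ) < (1 + r i1) * (L + D') - (N+2)*m + 1 := Nat.ceil_lt_add_one (by nlinarith)
  have hgk : g * m ≤ k := by
    have : (g:ℝ) * m ≤ k := by nlinarith
    exact_mod_cast this
  have ht1 : L + D' ≤ Q.tt N k m := by
    unfold CD.tt
    rw [hρ1, le_div_iff₀ (by positivity)]; linarith
  have ht2 : Q.tt N k m ≤ L + D' + 1 := by
    unfold CD.tt
    rw [hρ1, div_le_iff₀ (by positivity)]; nlinarith
  apply hx k hgk
  refine ⟨fun o => o.elim a0 (fun i => if i = i1 then ∑ j, a j else a i), ?_, ?_⟩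
  · intro hz
    apply ha0
    have h1 : ∀ i, i ≠ i1 → a i = 0 := by
      intro i hi
      have := congrFun hz (some i)
      simpa [hi] using this
    have h2 : ∑ j, a j = 0 := by
      have := congrFun hz (some i1)
      simpa using this
    rw [Finset.sum_eq_single i1 (fun b _ hb => h1 b hb) (by simp)] at h2
    funext i
    by_cases hi : i = i1
    · rw [hi, h2]; rfl
    · exact h1 i hi
  · intro o
    cases o with
    | none =>
      rw [hQ, Qr_co, ← hQ]
      refine hform.trans ?_
      have : Q.Kx N k m none = -Q.tt N k m + 2 * m := by
        have h1 : (none : Option {i : Fin n // 0 < r i}) ≠ Q.i1 := Q.hne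
        unfold CD.Kx
        rw [if_neg h1]
        have h2 : Q.ρ none = -1 := rfl
        rw [h2]; ring
      rw [this]
      apply Real.rpow_le_rpow_of_exponent_le (by norm_num)
      have : (0:ℝ) ≤ m := by positivity
      linarith
    | some i =>
      have h3 : (some i : Option {i : Fin n // 0 < r i}) ≠ Q.i0 := Option.some_ne_none _
      rw [Q.co_ne _ _ h3]
      have hρi : Q.ρ (some i) = r i := rfl
      have hri : 0 < r i := i.2
      by_cases hi : i = i1
      · subst hi
        simp only [Option.elim, if_true]
        have : Q.Kx N k m (some i) = r i * Q.tt N k m - N * m := by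
          have h1 : (some i : Option {i : Fin n // 0 < r i}) = Q.i1 := rfl
          unfold CD.Kx
          rw [if_pos h1, hρi]; ring
        rw [this]
        push_cast
        calc |∑ j, (a j : ℝ)| ≤ ∑ j, |(a j : ℝ)| := Finset.abs_sum_le_sum_abs _ _
          _ ≤ ∑ j : {i : Fin n // 0 < r i}, q'^(r i) := by
            refine Finset.sum_le_sum fun j _ => (hab j).trans ?_
            apply Real.rpow_le_rpow_of_exponent_le
            · rw [hq']; exact_mod_cast Nat.mul_pos hM1 hq
            · exact hmax j
          _ ≤ n * q'^(r i) := by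
            rw [Finset.sum_const, nsmul_eq_mul]; gcongr
          _ ≤ 2^(n:ℝ) * q'^(r i) := by
            gcongr
            rw [Real.rpow_natCast]
            exact_mod_cast Nat.lt_two_pow_self.le
          _ = 2^((n:ℝ) + L * r i) := by
            rw [Real.rpow_add (by norm_num), Real.rpow_mul (by norm_num), h2L]
          _ ≤ _ := by
            apply Real.rpow_le_rpow_of_exponent_le (by norm_num)
            have h5 : (N:ℝ)*m+n = τ * D' := by rw [hD']; field_simp
            have h6 := ht i i.2
            nlinarith
      · simp only [Option.elim, if_neg hi]
        refine (hab i).trans ?_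
        change q'^(r i) ≤ _
        rw [← h2L, ← Real.rpow_mul (by norm_num)]
        apply Real.rpow_le_rpow_of_exponent_le (by norm_num)
        have : Q.Kx N k m (some i) = r i * Q.tt N k m + 2 * m := by
          have h1 : (some i : Option {i : Fin n // 0 < r i}) ≠ Q.i1 := fun h => hi (Option.some.inj h)
          unfold CD.Kx
          rw [if_neg h1, hρi]
        rw [this]
        have : (0:ℝ) ≤ m := by positivity
        nlinarith

/-- a measurable set containing the tube of `U` in the diagonal direction has small measure -/
lemma tube {n : ℕ} (U : Set (Fin n → ℝ)) (d : ℝ) (hd : 0 < d) (hd1 : d ≤ 1)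
    (hU : ∀ u ∈ U, ∀ v ∈ U, ∀ i, |u i - v i| ≤ d) :
    ∃ T : Set (Fin n → ℝ), MeasurableSet T ∧ (∀ z x, x ∈ Set.Icc (0:ℝ) 1 → (fun i => z i + x) ∈ U → z ∈ T) ∧
      volume T ≤ ENNReal.ofReal (2 * 3^n * (d^n / d)) := by
  rcases U.eq_empty_or_nonempty with h | ⟨u, hu⟩
  · exact ⟨∅, MeasurableSet.empty, by simp [h], by simp⟩
  set J : ℕ := ⌊1/d⌋₊ + 1 with hJ
  set Bx : ℕ → Set (Fin n → ℝ) := fun j => Set.Icc (fun i => u i - d - (j+1) * d) (fun i => u i + d - j * d) with hBx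
  refine ⟨⋃ j ∈ Finset.range J, Bx j, Finset.measurableSet_biUnion _ fun j _ => measurableSet_Icc, ?_, ?_⟩
  · intro z x hx hz
    simp only [Set.mem_iUnion, Finset.mem_range]
    have hxd : 0 ≤ x / d := div_nonneg hx.1 hd.le
    have h1 := Nat.floor_le hxd
    have h2 := Nat.lt_floor_add_one (x/d)
    rw [le_div_iff₀ hd] at h1
    rw [div_lt_iff₀ hd] at h2
    refine ⟨⌊x/d⌋₊, ?_, ?_⟩
    · rw [hJ, Nat.lt_succ_iff]
      apply Nat.floor_le_floor
      gcongr
      exact hx.2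
    · simp only [hBx, Set.mem_Icc, Pi.le_def]
      constructor
      · intro i
        have := abs_le.1 (hU _ hz _ hu i)
        linarith [this.1]
      · intro i
        have := abs_le.1 (hU _ hz _ hu i)
        linarith [this.2]
  · refine (measure_biUnion_finset_le _ _).trans ?_
    have h3 : ∀ j, volume (Bx j) = ENNReal.ofReal ((3*d)^n) := by
      intro j
      rw [hBx, Real.volume_Icc_pi]
      have : ∀ i, (u i + d - j * d) - (u i - d - (j+1) * d) = 3 * d := fun i => by ring
      simp only [this, Finset.prod_const, Finset.card_univ, Fintype.card_fin]
      rw [ENNReal.ofReal_pow (by positivity)]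
    simp only [h3, Finset.sum_const, Finset.card_range, nsmul_eq_mul]
    rw [← ENNReal.ofReal_natCast, ← ENNReal.ofReal_mul (by positivity)]
    apply ENNReal.ofReal_le_ofReal
    have hJ2 : (J:ℝ) ≤ 2 / d := by
      have := Nat.floor_le (show 0 ≤ 1/d by positivity)
      have h5 : 1 ≤ 1/d := by rw [le_div_iff₀ hd]; linarith
      rw [hJ]; push_cast
      have : 2 / d = 1/d + 1/d := by ring
      linarith
    calc (J:ℝ) * (3*d)^n ≤ 2/d * (3*d)^n := by gcongr
      _ = _ := by rw [mul_pow]; ring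

lemma cover {n : ℕ} (X : Set (EuclideanSpace ℝ (Fin n))) (σ : ℝ) (hσ : 0 < σ)
    (hX : Measure.hausdorffMeasure σ X = 0) (η : ℝ) (hη : 0 < η) :
    ∃ (U : ℕ → Set (EuclideanSpace ℝ (Fin n))) (d : ℕ → ℝ), X ⊆ (⋃ i, U i) ∧ (∀ i, 0 < d i ∧ d i ≤ 1/2) ∧
      (∀ i, ∀ u ∈ U i, ∀ v ∈ U i, ∀ j, |u j - v j| ≤ d i) ∧ ∑' i, ENNReal.ofReal (d i ^ σ) ≤ ENNReal.ofReal η := by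
  rw [Measure.hausdorffMeasure_apply] at hX
  simp only [ENNReal.iSup_eq_zero] at hX
  have h1 := hX (ENNReal.ofReal (1/4)) (by positivity)
  have h2 : (0:ℝ≥0∞) < ENNReal.ofReal (η/2) := by simpa using hη
  rw [← h1] at h2
  simp only [iInf_lt_iff] at h2
  obtain ⟨U, hXU, hdU, hs⟩ := h2
  have hdU' : ∀ i, Metric.ediam (U i) ≠ ∞ := fun i => ne_top_of_le_ne_top ENNReal.ofReal_ne_top (hdU i)
  have hdr : ∀ i, (Metric.ediam (U i)).toReal ≤ 1/4 := by
    intro i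
    exact ENNReal.toReal_le_of_le_ofReal (by norm_num) (hdU i)
  have hsup : ∀ i, (⨆ _ : (U i).Nonempty, Metric.ediam (U i) ^ σ) = ENNReal.ofReal ((Metric.ediam (U i)).toReal ^ σ) := by
    intro i
    rcases (U i).eq_empty_or_nonempty with h | h
    · simp [h, Real.zero_rpow hσ.ne']
    · simp only [h, iSup_pos]
      rw [← ENNReal.ofReal_rpow_of_nonneg ENNReal.toReal_nonneg hσ.le, ENNReal.ofReal_toReal (hdU' i)]
  simp only [hsup] at hs
  have hd : ∀ i : ℕ, ∃ d : ℝ, 0 < d ∧ d ≤ 1/2 ∧ (Metric.ediam (U i)).toReal ≤ d ∧ d ^ σ ≤ (Metric.ediam (U i)).toReal ^ σ + η/4 * (1/2)^i := by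
    intro i
    have hc : Filter.Tendsto (fun x : ℝ => x^σ) (nhdsWithin (Metric.ediam (U i)).toReal (Set.Ioi (Metric.ediam (U i)).toReal)) (nhds ((Metric.ediam (U i)).toReal ^ σ)) :=
      ((Real.continuousAt_rpow_const _ _ (Or.inr hσ.le)).tendsto).mono_left nhdsWithin_le_nhds
    have e1 := hc.eventually_lt_const (show (Metric.ediam (U i)).toReal ^ σ < (Metric.ediam (U i)).toReal ^ σ + η/4 * (1/2)^i by
      have : 0 < η/4 * (1/2)^i := by positivity
      linarith)
    have e2 : ∀ᶠ x in nhdsWithin (Metric.ediam (U i)).toReal (Set.Ioi (Metric.ediam (U i)).toReal), x ∈ Set.Ioo (Metric.ediam (U i)).toReal (1/2) :=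
      Ioo_mem_nhdsGT (by linarith [hdr i])
    obtain ⟨d, h3, h4⟩ := (e1.and e2).exists
    exact ⟨d, lt_of_le_of_lt ENNReal.toReal_nonneg h4.1, h4.2.le, h4.1.le, h3.le⟩
  choose d hd0 hd1 hd2 hd3 using hd
  refine ⟨U, d, hXU, fun i => ⟨hd0 i, hd1 i⟩, ?_, ?_⟩
  · intro i u hu v hv j
    have e1 : dist u v ≤ (Metric.ediam (U i)).toReal := by
      rw [dist_edist]
      exact ENNReal.toReal_mono (hdU' i) (Metric.edist_le_ediam_of_mem hu hv)
    have e2 : |u j - v j| ≤ dist u v := by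
      rw [dist_eq_norm]
      have := PiLp.norm_apply_le (u - v) j
      simpa using this
    linarith [hd2 i]
  · calc ∑' i, ENNReal.ofReal (d i ^ σ) ≤ ∑' i, (ENNReal.ofReal ((Metric.ediam (U i)).toReal ^ σ) + ENNReal.ofReal (η/4 * (1/2)^i)) := by
          apply ENNReal.tsum_le_tsum
          intro i
          rw [← ENNReal.ofReal_add (by positivity) (by positivity)]
          exact ENNReal.ofReal_le_ofReal (hd3 i)
      _ = ∑' i, ENNReal.ofReal ((Metric.ediam (U i)).toReal ^ σ) + ∑' i : ℕ, ENNReal.ofReal (η/4 * (1/2)^i) := ENNReal.tsum_add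
      _ ≤ ENNReal.ofReal (η/2) + ENNReal.ofReal (η/2) := by
          gcongr
          rw [← ENNReal.ofReal_tsum_of_nonneg (fun i => by positivity) (summable_geometric_two.mul_left _), tsum_mul_left, tsum_geometric_two]
          apply ENNReal.ofReal_le_ofReal
          linarith
      _ = ENNReal.ofReal η := by
          rw [← ENNReal.ofReal_add (by positivity) (by positivity)]; congr 1; ring

open Classical in
lemma removal (V : ℕ → Set ℝ) (d : ℕ → ℝ) (hd : ∀ i, 0 < d i ∧ d i ≤ 1/2) (hV0 : ∀ i, V i ⊆ Set.Icc 0 1)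
    (hV : ∀ i, ∀ x ∈ V i, ∀ y ∈ V i, |x - y| ≤ d i) (s δ lam : ℝ) (hs0 : 0 < s) (hs1 : s ≤ 1) (hδ : 0 < δ)
    (hlam : (2:ℝ)^s ≤ lam) (hδl : 16 * δ ≤ (2 - lam)/2)
    (hsum : ∑' i, (if (V i).Nonempty then ENNReal.ofReal (d i ^ s) else 0) ≤ ENNReal.ofReal δ) :
    ∃ R : ℕ → Finset ℕ, (∀ k, ((R (k+1)).card : ℝ) ≤ (2 - lam)/2 * lam^k) ∧
      ∀ i, ∀ x ∈ V i, ∃ k, ∀ j, x ∈ dyI (k+1) j → j ∈ R (k+1) := by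
  set A : ℕ → Set ℕ := fun k => {i | (V i).Nonempty ∧ (1/2:ℝ)^(k+2) < d i ∧ d i ≤ (1/2)^(k+1)} with hA
  have hF : ∀ k, ∀ F : Finset ℕ, (F : Set ℕ) ⊆ A k → (F.card : ℝ) ≤ 4 * δ * lam^k := by
    intro k F hF
    have h1 : ∑ i ∈ F, ENNReal.ofReal (((1/2:ℝ)^(k+2))^s) ≤ ENNReal.ofReal δ := by
      refine le_trans ?_ ((ENNReal.sum_le_tsum F).trans hsum)
      refine Finset.sum_le_sum fun i hi => ?_
      have := hF hi
      rw [if_pos this.1]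
      apply ENNReal.ofReal_le_ofReal
      exact Real.rpow_le_rpow (by positivity) this.2.1.le hs0.le
    rw [Finset.sum_const, nsmul_eq_mul, ← ENNReal.ofReal_natCast, ← ENNReal.ofReal_mul (by positivity), ENNReal.ofReal_le_ofReal_iff hδ.le] at h1
    have h2 : ((1/2:ℝ)^(k+2))^s * ((2:ℝ)^s)^(k+2) = 1 := by
      rw [← Real.rpow_natCast_mul (by norm_num), ← Real.rpow_mul_natCast (by norm_num), mul_comm s, ← Real.mul_rpow (by norm_num) (by norm_num)]
      norm_num
    have h3 : (F.card : ℝ) ≤ δ * ((2:ℝ)^s)^(k+2) := by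
      calc (F.card : ℝ) = (F.card * ((1/2:ℝ)^(k+2))^s) * ((2:ℝ)^s)^(k+2) := by rw [mul_assoc, h2, mul_one]
        _ ≤ _ := by gcongr
    refine h3.trans ?_
    have h4 : (2:ℝ)^s ≤ 2 := by
      calc (2:ℝ)^s ≤ 2^(1:ℝ) := Real.rpow_le_rpow_of_exponent_le (by norm_num) hs1
        _ = 2 := Real.rpow_one 2
    have h5 : (0:ℝ) < 2^s := by positivity
    have h6 : (0:ℝ) ≤ lam^k := pow_nonneg (by linarith) _
    calc δ * ((2:ℝ)^s)^(k+2) = δ * (((2:ℝ)^s)^k * ((2:ℝ)^s)^2) := by rw [pow_add]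
      _ ≤ δ * (lam^k * 2^2) := by gcongr
      _ = _ := by ring
  have hAf : ∀ k, (A k).Finite := by
    intro k
    by_contra hinf
    obtain ⟨F, hFA, hFc⟩ := Set.Infinite.exists_subset_card_eq hinf (⌊4 * δ * lam^k⌋₊ + 1)
    have h1 := hF k F hFA
    rw [hFc] at h1
    have := Nat.lt_floor_add_one (4 * δ * lam^k)
    push_cast at h1
    linarith
  set j0 : ℕ → ℕ → ℕ := fun k i => if h : (V i).Nonempty then ⌊h.some * 2^(k+1)⌋₊ else 0 with hj0
  refine ⟨fun k => (hAf (k-1)).toFinset.biUnion (fun i => Finset.Icc (j0 (k-1) i - 2) (j0 (k-1) i + 1)), ?_, ?_⟩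
  · intro k
    simp only [Nat.add_sub_cancel]
    have h1 : ((hAf k).toFinset.biUnion (fun i => Finset.Icc (j0 k i - 2) (j0 k i + 1))).card ≤ (hAf k).toFinset.card * 4 := by
      apply Finset.card_biUnion_le_card_mul
      intro i _
      rw [Nat.card_Icc]; omega
    have h2 := hF k (hAf k).toFinset (by simp)
    have h3 : (((hAf k).toFinset.biUnion (fun i => Finset.Icc (j0 k i - 2) (j0 k i + 1))).card : ℝ) ≤ (hAf k).toFinset.card * 4 := by exact_mod_cast h1
    have h5 : (0:ℝ) < 2^s := by positivity
    have h4 : (0:ℝ) ≤ lam^k := pow_nonneg (by linarith) _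
    nlinarith
  · intro i x hx
    have hne : (V i).Nonempty := ⟨x, hx⟩
    obtain ⟨k, hk1, hk2⟩ := exists_nat_pow_near_of_lt_one (x := 2 * d i) (y := (1/2:ℝ)) (by linarith [(hd i).1]) (by linarith [(hd i).2]) (by norm_num) (by norm_num)
    refine ⟨k, ?_⟩
    intro j hj
    simp only [Nat.add_sub_cancel, Finset.mem_biUnion, Set.Finite.mem_toFinset]
    refine ⟨i, ⟨hne, by rw [pow_succ]; linarith, by rw [pow_succ]; linarith⟩, ?_⟩
    have hv := hne.some_mem
    simp only [hj0, dif_pos hne]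
    set v := hne.some with hvdef
    have hv0 := (hV0 i hv).1
    have h1 := hV i x hx v hv
    have hd2 : d i * 2^(k+1) ≤ 1 := by
      calc d i * 2^(k+1) ≤ (1/2)^(k+1) * 2^(k+1) := by
            gcongr
            rw [pow_succ]; linarith
        _ = 1 := by rw [← mul_pow]; norm_num
    have hp : (0:ℝ) < 2^(k+1) := by positivity
    have h2 : |x * 2^(k+1) - v * 2^(k+1)| ≤ 1 := by
      rw [← sub_mul, abs_mul, abs_of_pos hp]
      nlinarith
    rw [abs_le] at h2
    unfold dyI at hj
    have h3 := hj.1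
    have h4 := hj.2
    rw [div_le_iff₀ hp] at h3
    rw [le_div_iff₀ hp] at h4
    have h5 := Nat.floor_le (show 0 ≤ v * 2^(k+1) by positivity)
    have h6 := Nat.lt_floor_add_one (v * 2^(k+1))
    set f := ⌊v * 2^(k+1)⌋₊
    have h7 : (j:ℝ) < f + 2 := by linarith
    have h8 : (f:ℝ) ≤ j + 2 := by linarith
    have h7' : j < f + 2 := by exact_mod_cast h7
    have h8' : f ≤ j + 2 := by exact_mod_cast h8
    rw [Finset.mem_Icc]
    omega

lemma consts (Ac : ℕ) (C s : ℝ) (hC : 0 ≤ C) (hs1 : s < 1) :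
    ∃ lam : ℝ, 1 ≤ lam ∧ lam < 2 ∧ (2:ℝ)^s ≤ lam ∧ (2/lam)^Ac ≤ 3/2 ∧ ∃ ms : ℕ, 1 ≤ ms ∧
      ∀ K, ∑ m ∈ Finset.Icc ms K, (((m:ℝ)+1) * (C * (1/2)^m)) * (3/2)^m * lam ≤ (2 - lam)/2 := by
  have h2s : (2:ℝ)^s < 2 := by
    calc (2:ℝ)^s < 2^(1:ℝ) := Real.rpow_lt_rpow_of_exponent_lt (by norm_num) hs1
      _ = 2 := Real.rpow_one 2
  have hc : ContinuousAt (fun l : ℝ => (2/l)^Ac) 2 := by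
    apply ContinuousAt.pow
    exact continuousAt_const.div continuousAt_id (by norm_num)
  have e1 : ∀ᶠ l in nhdsWithin (2:ℝ) (Set.Iio 2), (2/l)^Ac < 3/2 :=
    (hc.tendsto.mono_left nhdsWithin_le_nhds).eventually_lt_const (by norm_num)
  have e2 : ∀ᶠ l in nhdsWithin (2:ℝ) (Set.Iio 2), l ∈ Set.Ioo (max 1 ((2:ℝ)^s)) 2 :=
    Ioo_mem_nhdsLT (by simp [h2s])
  obtain ⟨lam, h1, h2⟩ := (e1.and e2).exists
  have h3 : 1 ≤ lam := (le_max_left _ _).trans h2.1.le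
  refine ⟨lam, h3, h2.2, (le_max_right _ _).trans h2.1.le, h1.le, ?_⟩
  set f : ℕ → ℝ := fun m => (((m:ℝ)+1) * (C * (1/2)^m)) * (3/2)^m * lam with hf
  have hf0 : ∀ m, 0 ≤ f m := fun m => by simp only [hf]; positivity
  have hfs : Summable f := by
    have a1 := summable_pow_mul_geometric_of_norm_lt_one (R := ℝ) 1 (r := 3/4) (by rw [Real.norm_eq_abs]; norm_num [abs_lt])
    have a2 := summable_geometric_of_lt_one (r := (3/4:ℝ)) (by norm_num) (by norm_num)
    refine ((a1.add a2).mul_left (C * lam)).congr fun m => ?_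
    simp only [hf]
    rw [show (3/4:ℝ) = 1/2 * (3/2) by norm_num, mul_pow]; ring
  have ht := _root_.tendsto_sum_nat_add f
  have hpos : 0 < (2 - lam)/2 := by linarith [h2.2]
  obtain ⟨ms, h4, h5⟩ := ((ht.eventually_lt_const hpos).and (Filter.eventually_ge_atTop 1)).exists
  refine ⟨ms, h5, fun K => ?_⟩
  change ∑ m ∈ Finset.Icc ms K, f m ≤ _
  refine le_trans ?_ h4.le
  have hss : Summable (fun k => f (k + ms)) := (summable_nat_add_iff ms).2 hfs
  calc ∑ m ∈ Finset.Icc ms K, f m ≤ ∑ k ∈ Finset.range (K+1), f (k + ms) := by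
        rw [← Finset.sum_image (f := f) (s := Finset.range (K+1)) (g := fun k => k + ms) (by intro a _ b _ h; simpa using h)]
        apply Finset.sum_le_sum_of_subset_of_nonneg
        · intro m hm
          rw [Finset.mem_Icc] at hm
          rw [Finset.mem_image]
          exact ⟨m - ms, by rw [Finset.mem_range]; omega, by omega⟩
        · intro m _ _; exact hf0 m
    _ ≤ _ := hss.sum_le_tsum _ (fun i _ => hf0 _)

lemma slice {n : ℕ} (hn : 1 ≤ n) (X : Set (EuclideanSpace ℝ (Fin n))) (s : ℝ) (hs0 : 0 < s) (hs1 : s < 1)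
    (hX : Measure.hausdorffMeasure ((n:ℝ) - 1 + s) X = 0) (lam : ℝ) (hl2 : lam < 2)
    (hlam : (2:ℝ)^s ≤ lam) (G : (Fin n → ℝ) → Prop) (hG : ∀ᵐ z ∂(cubeM n), G z) :
    ∃ z, G z ∧ ∃ R : ℕ → Finset ℕ, (∀ k, ((R (k+1)).card : ℝ) ≤ (2 - lam)/2 * lam^k) ∧
      ∀ x ∈ Set.Icc (0:ℝ) 1, (WithLp.toLp 2 (fun i => z i + x) : EuclideanSpace ℝ (Fin n)) ∈ X →
        ∃ k, ∀ j, x ∈ dyI (k+1) j → j ∈ R (k+1) := by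
  classical
  have hn1 : (1:ℝ) ≤ n := by exact_mod_cast hn
  set δ : ℝ := (2 - lam)/32 with hδ
  have hδ0 : 0 < δ := by rw [hδ]; linarith
  set η : ℝ := δ / (2 * 3^n) with hη
  have hη0 : 0 < η := by positivity
  obtain ⟨U, d, hXU, hd, hUd, hsum⟩ := cover X ((n:ℝ)-1+s) (by linarith) hX η hη0
  have hT := fun i => tube (n := n) (WithLp.ofLp '' U i) (d i) (hd i).1 (by linarith [(hd i).2]) (by
    rintro _ ⟨u, hu, rfl⟩ _ ⟨v, hv, rfl⟩ j
    exact hUd i u hu v hv j)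
  choose T hTm hTz hTv using hT
  set Φ : (Fin n → ℝ) → ℝ≥0∞ := fun z => ∑' i, ENNReal.ofReal (d i ^ s) * (T i).indicator 1 z with hΦ
  have hintg : ∫⁻ z, Φ z ∂(cubeM n) ≤ ENNReal.ofReal δ := by
    rw [hΦ, lintegral_tsum (fun i => ((measurable_one.indicator (hTm i)).const_mul _).aemeasurable)]
    calc ∑' i, ∫⁻ z, ENNReal.ofReal (d i ^ s) * (T i).indicator 1 z ∂(cubeM n) ≤ ∑' i, ENNReal.ofReal (2 * 3^n) * ENNReal.ofReal (d i ^ ((n:ℝ) - 1 + s)) := by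
          apply ENNReal.tsum_le_tsum
          intro i
          rw [lintegral_const_mul _ (measurable_one.indicator (hTm i)), lintegral_indicator_one (hTm i)]
          have h1 : cubeM n (T i) ≤ ENNReal.ofReal (2 * 3^n * (d i^n / d i)) := by
            rw [cubeM_eq]
            exact (Measure.restrict_apply_le _ _).trans (hTv i)
          have hd0 := (hd i).1
          calc _ ≤ ENNReal.ofReal (d i ^ s) * ENNReal.ofReal (2 * 3^n * (d i^n / d i)) := by gcongr
            _ = _ := by
              rw [← ENNReal.ofReal_mul (by positivity), ← ENNReal.ofReal_mul (by positivity)]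
              congr 1
              rw [Real.rpow_add hd0, Real.rpow_sub hd0, Real.rpow_natCast, Real.rpow_one]
              ring
      _ ≤ ENNReal.ofReal (2 * 3^n) * ENNReal.ofReal η := by
          rw [ENNReal.tsum_mul_left]; gcongr
      _ = ENNReal.ofReal δ := by
          rw [← ENNReal.ofReal_mul (by positivity), hη]; congr 1; field_simp
  obtain ⟨z, hzN, hz⟩ := exists_notMem_null_le_lintegral (μ := cubeM n) (f := Φ) (N := {z | ¬ G z}) (Measurable.ennreal_tsum fun i => (measurable_one.indicator (hTm i)).const_mul _).aemeasurable hG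
  have hGz : G z := by simpa using hzN
  refine ⟨z, hGz, ?_⟩
  have hz' := hz.trans hintg
  set V : ℕ → Set ℝ := fun i => {x | x ∈ Set.Icc (0:ℝ) 1 ∧ (WithLp.toLp 2 (fun i => z i + x) : EuclideanSpace ℝ (Fin n)) ∈ U i} with hV
  obtain ⟨R, hR1, hR2⟩ := removal V d hd (fun i x hx => hx.1) (by
      intro i x hx y hy
      have := hUd i _ hx.2 _ hy.2 ⟨0, hn⟩
      simpa using this) s δ lam hs0 hs1.le hδ0 hlam (by rw [hδ]; linarith) (by
      refine le_trans ?_ hz'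
      apply ENNReal.tsum_le_tsum
      intro i
      split_ifs with h
      · obtain ⟨x, hx, hxU⟩ := h
        have : z ∈ T i := hTz i z x hx ⟨_, hxU, rfl⟩
        simp [this]
      · exact zero_le)
  refine ⟨R, hR1, ?_⟩
  intro x hx hxX
  obtain ⟨i, hi⟩ := Set.mem_iUnion.1 (hXU hxX)
  exact hR2 i x ⟨hx, hi⟩

theorem stmt2 (n : ℕ) (hn : 1 ≤ n)
    (W : Set (Fin n → ℝ)) (hWcnt : W.Countable) (hWsub : W ⊆ Weights n)
    (hτ : ∃ ε > 0, ∀ r ∈ W, ε ≤ tauW r) :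
    dimH (⋂ r ∈ W, BadSet r) = (n : ℝ≥0∞) := by
  have huniv : dimH (Set.univ : Set (EuclideanSpace ℝ (Fin n))) = n := by
    rw [Real.dimH_univ_eq_finrank]; simp
  rcases W.eq_empty_or_nonempty with hW | hW
  · simp [hW, huniv]
  refine le_antisymm ((dimH_mono (Set.subset_univ _)).trans huniv.le) ?_
  by_contra hlt
  rw [not_le] at hlt
  obtain ⟨τ, hτ0, hτW⟩ := hτ
  obtain ⟨f, hf⟩ := hWcnt.exists_eq_range hW
  have hfW : ∀ j, f j ∈ W := fun j => by rw [hf]; exact ⟨j, rfl⟩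
  have hr : ∀ j, ∑ i, f j i = 1 := fun j => (hWsub (hfW j)).1
  have h0 : ∀ j i, 0 ≤ f j i := fun j => (hWsub (hfW j)).2
  have ht : ∀ j i, 0 < f j i → τ ≤ f j i := by
    intro j i hi
    refine (hτW _ (hfW j)).trans ?_
    unfold tauW
    exact csInf_le ⟨0, fun t ht => ht.1.le⟩ ⟨hi, i, rfl⟩
  have hmx : ∀ j, ∃ i1 : {i : Fin n // 0 < f j i}, ∀ i, f j i ≤ f j i1 := by
    intro j
    have : Nonempty (Fin n) := ⟨⟨0, hn⟩⟩
    obtain ⟨i1, hi1⟩ := Finite.exists_max (f j)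
    refine ⟨⟨i1, ?_⟩, hi1⟩
    by_contra hneg
    have : ∑ i, f j i ≤ 0 := Finset.sum_nonpos fun i _ => (hi1 i).trans (not_lt.1 hneg)
    linarith [hr j]
  choose i1 hi1 using hmx
  set γ : ℝ := min (1/2) (τ / (2 * (n+1))) with hγ
  have hγ0 : 0 < γ := by positivity
  have hγ1 : γ < 1 := (min_le_left _ _).trans_lt (by norm_num)
  have hγτ : (n+1) * γ < τ := by
    have h1 : γ ≤ τ / (2 * (n+1)) := min_le_right _ _
    rw [le_div_iff₀ (by positivity)] at h1
    nlinarith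
  obtain ⟨Ac, g, hg, hgA, hcore⟩ := CD.core_card (n+1) τ γ hτ0 hγ0
  obtain ⟨σ, hσ1, hσ2⟩ := ENNReal.lt_iff_exists_nnreal_btwn.1 hlt
  have hσn : (σ:ℝ) < n := by
    have : σ < (n : NNReal) := by exact_mod_cast hσ2
    exact_mod_cast this
  set s : ℝ := max ((σ:ℝ) - (n-1)) (1/2) with hs
  have hs0 : 0 < s := lt_of_lt_of_le (by norm_num) (le_max_right _ _)
  have hs1 : s < 1 := max_lt (by linarith) (by norm_num)
  have hn1 : (1:ℝ) ≤ n := by exact_mod_cast hn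
  have hX0 : Measure.hausdorffMeasure ((n:ℝ) - 1 + s) (⋂ r ∈ W, BadSet r) = 0 := by
    have hσ0 : 0 ≤ (n:ℝ) - 1 + s := by linarith
    obtain ⟨d, hd⟩ : ∃ d : NNReal, (d:ℝ) = (n:ℝ) - 1 + s := ⟨⟨_, hσ0⟩, rfl⟩
    have h1 : dimH (⋂ r ∈ W, BadSet r) < (d : ℝ≥0∞) := by
      refine lt_of_lt_of_le hσ1 ?_
      rw [ENNReal.coe_le_coe, ← NNReal.coe_le_coe, hd]
      have : (σ:ℝ) - (n-1) ≤ s := le_max_left _ _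
      linarith
    have h2 := hausdorffMeasure_of_dimH_lt h1
    rw [hd] at h2
    exact h2
  set C : ℝ := 48*(((n+1 : ℕ):ℝ)+1)^2*3^(n+1+1) with hC
  have hC0 : 0 ≤ C := by positivity
  obtain ⟨lam, hl1, hl2, hls, hlA, ms, hms, hmsum⟩ := consts Ac C s hC0 hs1
  have hgen : ∀ᵐ z ∂(cubeM n), ∀ j, ∃ t0, (Qr (f j) τ hτ0 (hr j) (h0 j) (ht j) (i1 j) z).Gen γ t0 :=
    ae_all_iff.2 fun j => gen_ae (f j) τ hτ0 (hr j) (h0 j) (ht j) (i1 j) γ hγ0 hγ1 hγτ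
  obtain ⟨z, hz, R, hR1, hR2⟩ := slice hn _ s hs0 hs1 hX0 lam hl2 hls _ hgen
  choose t0 ht0 using hz
  have hcd : ∀ j, Fintype.card (Option {i : Fin n // 0 < f j i}) ≤ n + 1 := by
    intro j
    rw [Fintype.card_option]
    have := (Fintype.card_subtype_le (fun i : Fin n => 0 < f j i)).trans (by simp : Fintype.card (Fin n) ≤ n)
    omega
  have hm := fun j => hcore _ (Qr (f j) τ hτ0 (hr j) (h0 j) (ht j) (i1 j) z) (hcd j) le_rfl (t0 j) (ht0 j)
  choose m0 hm0 using hm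
  obtain ⟨x, hx01, hxB, hxR⟩ := cantor (fun j k m => (Qr (f j) τ hτ0 (hr j) (h0 j) (ht j) (i1 j) z).Bset (3*(n+1)) k m)
    (fun j => max (m0 j) (max j ms)) g Ac ms hg (hg.trans_le hgA) hms C lam hC0 hl1 hl2.le hlA
    (fun j => ⟨(le_max_left _ _).trans (le_max_right _ _), (le_max_right _ _).trans (le_max_right _ _)⟩)
    hmsum R hR1 (by
      intro j m k hmj hgk l p hkl hpl c hc hx0 T hT
      exact hm0 j m k ((le_max_left _ _).trans hmj) hgk l p hkl hpl c hc hx0 T hT)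
  have hmem : (WithLp.toLp 2 (fun i => z i + x) : EuclideanSpace ℝ (Fin n)) ∈ ⋂ r ∈ W, BadSet r := by
    rw [Set.mem_iInter₂]
    intro r hrW
    rw [hf] at hrW
    obtain ⟨j, rfl⟩ := hrW
    exact transf (f j) τ hτ0 (hr j) (h0 j) (ht j) (i1 j) (hi1 j) z (3*(n+1)) g (max (m0 j) (max j ms)) x
      (fun k hk => hxB j _ k le_rfl hk)
  obtain ⟨k, hk⟩ := hR2 x hx01 hmem
  obtain ⟨i, hi, hxi⟩ := hxR k
  exact hi (hk i hxi)
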